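/- The edge-inducibility constant λ_{5,3} equals (255·√17 − 535)/1024. Moreover, the problem of maximising λ_{5,3} is perfectly stable with respect to the family of all blowups of the pattern consisting of one edge plus an isolated looped vertex, i.e., the family of graphs that are vertex-disjoint unions of a complete bipartite graph (with possibly empty parts) and a clique (possibly empty), with no edges between the two pieces. -/

import Mathlib

open Finset
open scoped Classical

/-- Number of edges of `G` inside the vertex subset `S`. -/
noncomputable def edgeCount {n : ℕ} (G : SimpleGraph (Fin n)) (S : Finset (Fin n)) : ℕ :=
  (Finset.univ.filter (fun p : Fin n × Fin n =>
    p.1 ∈ S ∧ p.2 ∈ S ∧ p.1 < p.2 ∧ G.Adj p.1 p.2)).card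

/-- `Λ_{κ,ℓ}(G)`: number of `κ`-subsets of vertices inducing exactly `ℓ` edges. -/
noncomputable def numKL (κ ℓ : ℕ) {n : ℕ} (G : SimpleGraph (Fin n)) : ℕ :=
  ((Finset.powersetCard κ Finset.univ).filter (fun S => edgeCount G S = ℓ)).card

/-- `λ_{κ,ℓ}(G) = Λ_{κ,ℓ}(G) / C(n,κ)`. -/
noncomputable def lamKL (κ ℓ : ℕ) {n : ℕ} (G : SimpleGraph (Fin n)) : ℝ :=
  (numKL κ ℓ G : ℝ) / (n.choose κ : ℝ)

/-- `λ_{κ,ℓ}(n)`: the maximum of `λ_{κ,ℓ}(G)` over all graphs on `n` vertices. -/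
noncomputable def lamKLmax (κ ℓ n : ℕ) : ℝ :=
  ⨆ G : SimpleGraph (Fin n), lamKL κ ℓ G

/-- Edit distance between two graphs on `Fin n`: the minimum over bijections of the number
of vertex pairs whose adjacency must be changed in `G` to obtain a graph isomorphic to `H`. -/
noncomputable def editDist {n : ℕ} (G H : SimpleGraph (Fin n)) : ℕ :=
  ⨅ σ : Equiv.Perm (Fin n),
    (Finset.univ.filter (fun p : Fin n × Fin n =>
      p.1 < p.2 ∧ ¬ (G.Adj p.1 p.2 ↔ H.Adj (σ p.1) (σ p.2)))).card

/-- Edit distance of `G` to the family of `n`-vertex graphs satisfying `P`. -/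
noncomputable def distToFam {n : ℕ} (G : SimpleGraph (Fin n))
    (P : SimpleGraph (Fin n) → Prop) : ℕ :=
  ⨅ H : {H : SimpleGraph (Fin n) // P H}, editDist G H.1

/-- A vertex-disjoint union of a complete bipartite graph (with possibly empty parts)
and a clique (possibly empty), with no edges between the two pieces: a blowup of the
pattern consisting of one edge plus an isolated looped vertex. -/
def isBipartitePlusClique {n : ℕ} (G : SimpleGraph (Fin n)) : Prop :=
  ∃ c : Fin n → Fin 3, ∀ u v,
    G.Adj u v ↔ ((c u = 0 ∧ c v = 1) ∨ (c u = 1 ∧ c v = 0) ∨ (u ≠ v ∧ c u = 2 ∧ c v = 2))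

set_option linter.all false

/-! ### Certificate data -/

/-- Packed table of the certificate matrices (rational parts). -/
def rowsA : List ℕ := [
  1037378893195665269704921680920036686285712906715322171949111662780128932896824860053090360723373139628683114961962720879015658272818779310501547591919718946129236159590449955846912,
  1037378893348210148486097907476305777874808250223558806546824209366168805695419810672039953845575944378049277442783737713286298152792473747630790982592409362675635948048547520259712,
  1037378893186382621286117395107775078908475526740284138040478975968666698550501374444163227108191138644244608442147473978447151111924394469334945168184122983239985715247210456678400,
  1037378893182346642118616852317826141870361392022513604378994408383471029211247141264708191250601784717609921526314804717056834331165908202861048403930431677297600298549226622708928,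
  1037378893186382621278281228578735987991655578663217410770031822799488812458788989325005369299420576223422598203934378599881838036739977324520668934146146773428903277623818951065600,
  1037378893182346642117350297149532044342417912434171055786534151865353804703170162812702377688641216133778429801057981208748571043660984830541732625886824106485681103222315221544128,
  1037378893187578108646995686331667012226635933289907678614414285377257311585629564050735192785189894107002826969786002404319589958068032305155031678583350707256781436803118331124736,
  1037378893186382621282199311843255533450065552701750774405255399384077755504645181884584298203805857433833603323040926289164494574332185896927807051165134878334444496435514703872000,
  1037378893195295494983116044951808356903140784831928040534261544598689445734118839100696440676899725052161278251308775923029633333857377754973175612076570348373508768909561449572414,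
  1037378893186382621286478118772322254528081225087436055132148847128509623395661476707613138581293585837749386050166115956230790808538636436175129497762148210558272229643389816012800,
  1037378893188832520985107469789021990312364581797779397915633044989223794773940277637611901725689633422460390723292074241271891371471140066908770484922054385068237440181836828939786,
  1037378893186382621282199311843255533450065552701750774405255399384077755504645181884584298203805857433833603323040926289164494574332185896927807051165134878334444496435514703872000,
  1037378893186382621282199311843255533450065552701750774405255399384077755504645181884584298203805857433833603323040926289164494574332185896927807051165134878334444496435514703872000,
  1037378893186382621269469402682250834063557263822608917041446402109055563031788215347349430148873934411388566551562131206605049977051079180700526833472429054125339375533776751820800,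
  1037378893195295494981525128094073088106237576144505787199223165019361910747558181660426852170863266224731079219691607834405986575202448431103142680398519180136974241049421145598014,
  1037378893186382621277920504914188812372049880316065493678361951639645887613628887061555457826318129029917820595915736622098198340125735357680484604568121546110616763227639591731200,
  1037378893186382621282199311843255533450065552701750774405255399384077755504645181884584298203805857433833603323040926289164494574332185896927807051165134878334444496435514703872000,
  1037378893186382621294929221004260232836573841580892631769064396659099947977502148421819166258737780456278640094519721371723939171613292613155087268857840702543549617337252655923200,
  1037378893094466918758329159558522807999672799708216538206975213115918630011876032185615017974243102993231889682571987461688194432543692132494914551897836460823839225073211015649984,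
  1037378893186382621282199311843255533450065552701750774405255399384077755504645181884584298203805857433833603323040926289164494574332185896927807051165134878334444496435514703872000,
  984185667406762765694074064891711926045897858149294012431777784828003095449670309750402099733513120051193860568449534274613597471088390107577196163595152322899760091992973874084864,
  1040237908962210973143671690733994373955817502898022308943633073681491300555259164546690772387480379914931031378812152765887568934792498148359101906396229869623815239983356366576592,
  1039417328522723580575792458494277268763669051326484588496703391108026197961701945211912007615606118235975906919889547533545696021991709582995053493416277250527660368622341155183360,
  1037378893186382621282199311843255533450065552701750774405255399384077755504645181884584298203805857433833603323040926289164494574332185896927807051165134878334444496435514703872000,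
  1039417328522723580575792458494277268763669051326484588496703391108026197961701945211912007615606118235975906919889547533545696021991709582995053493416277250527660368622341155183360,
  1037378893186382621282199311843255533450065552701750774405255399384077755504645181884584298203805857433833603323040926289164494574332185896927807051165134878334444496435514703872000,
  1002313254521931016308970476175346747749171824685256732527026346582927733049250605255895999515466508557446572121454437138648096704603285940252843427855578136571661056921777967767808,
  1052623844472381838552620566240162787035066082400349153269371944825830588088465976707856305494947475609187152761723503405827493236875027126339178696952607273386194449410537665167104,
  1042692292201229325987421087505005817261025633460699079927913692990518592764595673457560430178717755927418068090598591247723880371593418971775075531745330028584577863345656911883776,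
  1060428849951668598333967844288492391906578767232678554016571657683940421368153950856956425404577429191428084068106653231855630207061552139048814614921860240992369638864146983678976,
  1097848208381739002605583452213071823603336287782086069853033425563866032231432169117051637704302052575002436855269584393247507623557091126816772225243448939509580658504063197681664,
  1035067405086815354583003370406102554746739414726977658677049713739217450704726742439857042827095618708763420111009906037950894486278000761236523942803828393787113831680200910208398,
  1064180357481212647906597546534760249431099112944352909672342651233358917690734336427657667043948025164997582875146178380092939771790111260034616132060361087322516013963577657213184,
  1037378893186382621282199311843255533450065552701750774405255399384077755504645181884584298203805857433833603323040926289164494574332185896927807051165134878334444496435514703872000,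
  1042692292201229325987421087505005817261025633460699079927913692990518592764595673457560430178717755927418068090598591247723880371593418971775075531745330028584577863345656911883776,
  1060428849951668598333967844288492391906578767232678554016571657683940421368153950856956425404577429191428084068106653231855630207061552139048814614921860240992369638864146983678976,
  1064180357481212647906597546534760249431099112944352909672342651233358917690734336427657667043948025164997582875146178380092939771790111260034616132060361087322516013963577657213184,
  1037378893186382621282199311843255533450065552701750774405255399384077755504645181884584298203805857433833603323040926289164494574332185896927807051165134878334444496435514703872000,
  1037378893186382621282199311843255533450065552701750774405255399384077755504645181884584298203805857433833603323040926289164494574332185896927807051165134878334444496435514703872000,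
  1035791032008925290173530885679959448949485949016219526198279399989656077920837445588976489618102984557737833524953842161101489043976832622412285890031333642847898434791436517767328]

/-- Packed table of the certificate matrices (irrational parts). -/
def rowsB : List ℕ := [
  1037378893184398665083164403660463998439930545378296002106925903586029060074462488397382570386308562502178171393360704308051525042643225247927212602811576027269339047309338527071488,
  1037378893145237124938438774392968672574601043491000898311620933566259870581081042382791522829050447957412489973861511461444892374683884064597174573726595738885832179702155667599232,
  1037378893186382621282199311843255533460048758171178261790066979015095518136464018752326123236336049069100149643653525570600907454552763636058507176099287127300144516966999759257600,
  1037378893187816860603375540311867108128232540389849119956483729706084972314603227164761909486284719559477373661906485007336250283063292268724231454819243358183434747821039754622144,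
  1037378893186382621282199311843255533440082347232323287020443819753059992872826345016842473171275665798567057002428327007728081694111608157797106926230982629368744475904029648486400,
  1037378893187816860603375540311867108136952697856583850970594813975069128602948779538079282681382255071428911592001947256236765739586399249241496737161972308901436738394469532644544,
  1037378893186339777226351118075462752129749157559312386505658386571597410389176084832792705342936530028653160763428125039911479700218263957883743436710167409140927603966376178352128,
  1037378893186382621282199311843255533450065552701750774405255399384077755504645181884584298203805857433833603323040926289164494574332185896927807051165134878334444496435514703872000,
  1037378893184940708613655110498893437114027716920835726434993772285419194196262870114102033798498336753276839431344113196670816297438030538361135438562230602260113988519139579637006,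
  1037378893186382621279982518511350544226331538108224849630532624061418784554327895221355208868090955804737221858706432849314925469710593477533253813993937225401343073129468212019200,
  1037378893185047502029744459077350040551939823831017249685778951960049350484863123667026747023545140448245765036829447759407483550400854257607602194671906674311282431438739957433050,
  1037378893186382621282199311843255533450065552701750774405255399384077755504645181884584298203805857433833603323040926289164494574332185896927807051165134878334444496435514703872000,
  1037378893186382621282199311843255533450065552701750774405255399384077755504645181884584298203805857433833603323040926289164494574332185896927807051165134878334444496435514703872000,
  1037378893186382621282199311843255533448142790984628559031561591366462217621574883516414723504025310579049331195255299370232600636221044832878019568736912102619652930565617955635200,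
  1037378893184940708613655110498893437112091837218417423948139330071718893607356557226654774382374389448184124744405354551045672393426000574614680803909573732996390037165735044033806,
  1037378893186382621284416105175160522673799567295276699179978174706736726454962468547813387539520759062929984787375419729014063678953778316322360288336332531267545919741561195724800,
  1037378893186382621282199311843255533450065552701750774405255399384077755504645181884584298203805857433833603323040926289164494574332185896927807051165134878334444496435514703872000,
  1037378893186382621282199311843255533451988314418872989778949207401693293387715480252753872903586404288617875450826553208096388512443326960977594533593357654049236062305411452108800,
  1037378893210201152201159679396184348751122129629155582513683247590059343736234568815039123151389378892844398107393214786126653795108171509084336492526504162507336739471478605977280,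
  1037378893186382621282199311843255533450065552701750774405255399384077755504645181884584298203805857433833603323040926289164494574332185896927807051165134878334444496435514703872000,
  1051379154226968439984961087296833172465599180283299421209510895705744249379905314972972955742455041595082728629290542945966695447712088196337087713839578339022617019977313374175232,
  1036587559566869423325472734027253172265548149950301447123450354636108530833064813810608790333365756322067255364407721682364751062503743382744005390319801252087060454273915031893968,
  1036815536364427257429743002226003032062963032271335489136891142258062158849824398595084457507326316065133486625479221544697625364981831161363169088251748548156581421529961418719232,
  1037378893186382621282199311843255533450065552701750774405255399384077755504645181884584298203805857433833603323040926289164494574332185896927807051165134878334444496435514703872000,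
  1036815536364427257429743002226003032062963032271335489136891142258062158849824398595084457507326316065133486625479221544697625364981831161363169088251748548156581421529961418719232,
  1037378893186382621282199311843255533450065552701750774405255399384077755504645181884584298203805857433833603323040926289164494574332185896927807051165134878334444496435514703872000,
  1045373724748799988793438025583955119044356155995772896524557530640752611857813662019310520299814275697861882758112439150939180022478244447831766131656926543594683873200765310861312,
  1033139155444330663359334177627936741318483331115457801045448530476533311272093582023965655857113202705284540460279698240418001382186806287387866069308176550439222568058652685500416,
  1036416530594250771540169896533968086233638856623988778373151597558503407539202975986728771624954430349190451003568973160965200577724505622011196055887355562098019044252321513996288,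
  1030741781862851861110685726691693301105472802948619754681161517273824858468124513908320921211415148920309914347924326955534858587508028994846283259101008093034511253139090518835200,
  1022521261309090285712116804400563287450275142298542776757937803478465233399461258221031809733090328596680284316677547323866855045644035099370563318113664429491158975009983221989376,
  1037870153196308575162976984976488514337923301842776781713184066937830022881069980888755458965639824022055643666114897103936286029660011095107046312547592901371761402222231022237022,
  1030623063270144770934336685481603870454255939901051172998002767006900267801461215443962687801063197391847763633412809450586883941752950313279890934374553600110309074867711071223808,
  1037378893186382621282199311843255533450065552701750774405255399384077755504645181884584298203805857433833603323040926289164494574332185896927807051165134878334444496435514703872000,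
  1036416530594250771540169896533968086233638856623988778373151597558503407539202975986728771624954430349190451003568973160965200577724505622011196055887355562098019044252321513996288,
  1030741781862851861110685726691693301105472802948619754681161517273824858468124513908320921211415148920309914347924326955534858587508028994846283259101008093034511253139090518835200,
  1030623063270144770934336685481603870454255939901051172998002767006900267801461215443962687801063197391847763633412809450586883941752950313279890934374553600110309074867711071223808,
  1037378893186382621282199311843255533450065552701750774405255399384077755504645181884584298203805857433833603323040926289164494574332185896927807051165134878334444496435514703872000,
  1037378893186382621282199311843255533450065552701750774405255399384077755504645181884584298203805857433833603323040926289164494574332185896927807051165134878334444496435514703872000,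
  1038135724214890321156424449552118337900859442055497162618498082336418499853838544997550301163028633987527086252856959804493093143020489003269572992766264266829364814385379508963168]

/-- Packed table of flag indices. -/
def flTab : ℕ := 892620145238872555583931845615476538776211361856

/-- The squares of the sum-of-squares certificate (type 0): coefficient, vector. -/
def sqs0 : List ((ℤ × ℤ) × ℕ × ℕ) := [
  ((48, 0), 1560874368619872604575416083063074145057382132992159052208175218765600542818697319993089745063539089843743446264522645215817668689155269404439936, 1560874368188223386594687625723906624870159322386322219237881017398653404897616086960960336470120626835936409689213438364202036554395906237005824),
  ((12, 0), 1560874366049286168440902693710173100296993702100861953483323370928273241199511668729829595315841130620173494470288478138703431437743167400574976, 1560874368237077826605096383549678282794760457240872240506002905453218239601333605118015357044620618446983650489474030365300492849666246962053120),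
  ((48, 0), 1560874368175435833965402427591530978653380804572239221666254552492279623457160066334345100352656295892746678090974010175399117384696616779251712, 1560874368175435833965402427591530978652891420346073371446247751353969534781664774751437069381691266329143453403321258433603591206280019872579584),
  ((192, 0), 1560874368180326823305831545003827301273881081620372048350370827636774384976233909318690525131590932983065726514679090432790026467792131161325568, 1560874368180326823305831545003827301273719819998935246447210691792572948136254494660971489176232411160573729222092204346174810070018496361660416),
  ((12, 0), 1560874368193358370868199374843845847940449930077819337765705033536415622222539593023694249347014016009514639975012619900008270958208606112055296, 1560874368193358370868199374843845847939192313405086500701477029695872472421866796769399267556267063552036190132414901806733405805143609428672512),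
  ((-18190569216, 4411883520), 1560874368193125466613893226395641261147724294373997839987145461103560138073195979483530046630322540742335232499754809140721576590480228638261256, 1560874368193302917474316958546654279655509451731017771959969513364371045232661185690460947503602097618488865777785248426985190175864880264904704),
  ((12402734976, -3008102400), 1560874368193225282722881575730586084058353445387321551721858990500266271804403976293842389986156978335117939235774555193713508713534229584019464, 1560874368193314008153093441806092593312246024065831517708271016630671730684677773732460829172689259001950313991065431743066952033364598746775552),
  ((12288, 0), 1560874368193269645437987508768339338685299734726576534715065003565469003011387939791535939162720619233046686169570888351405823395028443112407048, 1560874368193358370868199374843845847939192313405086500701477029695874454824273478116617060016062897106610948569347196251204418247301459748061184),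
  ((45706110976, -11085316096), 1560874368193291826795540475287215965998773439332389570662720649458640508959102387173397801237030210927032064980101278319280015445941140993343492, 1560874368193336189510646408324969220625719168735459009204874023163273090987628561146154615011078577311362115452722417121516727018726827954798592),
  ((88728, 0), 1560874368193258554759211025508901025028563162391762788966763500299168322859912546084689046243525960256746757660811347073831444245853660094922752, 1560874368193347280189422891584407534282455741070272754953175526429573771139103954853001507930273236466068016183550909810741614511407942558810112),
  ((218064, 0), 1560874368193214192044105092471147770401616873052507805973557487233965591652928582586995497066962319358818010727015013916139129564359446566535168, 1560874368193302917474316958546654279655509451731017771959969513364371046999508250468845277086899598361407381605269145302604148297471081557524480),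
  ((58728, 0), 1560874368193258554759211025508901025028564282264133877868868779020308605315204542129103550798879002954489399410824735330649233244230367477497856, 1560874368193347280189422891584407534282455741070272754953175526429573772905951019631385837513570737208986532011034806686360572633014143851429888),
  ((136512, 0), 1560874368193380552225752341362722475252665458074713992198080036228475822194612524643848164187642218298493837863729259705669533709654767804874752, 1560874368193380552225752341362722475252665458074713992198080036228475818660918395087079505021047216901859781685971975380892109475876091541323776),
  ((64152, 0), 1560874368193358370868199374843845847939191193532715411799371750974734174135828546850586885044007355151786822646817704870005587370530953658105856, 1560874368193358370868199374843845847939192313405086500701477029695874454824273478116617060016062897106610948569347196251204418247301459748061184),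
  ((124536, 0), 1560874368193314008153093441806092593312244904193460428806165737909531442928844583352893335867443714253858075713021371712313272689036740129718272, 1560874368193314008153093441806092593312246024065831517708271016630671730684677773732460829172689259001950313991065431743066952033364598746775552),
  ((-8940847744, 2169708544), 1560874368193225282722881575730586084058353445387321551721858990500266275338098105850611049152751979820954981524566315224316187119066071573725192, 1560874368193314008153093441806092593312246024065831517708271016630671727150983644175692170006094257516113282336097637991829035790152196161536000),
  ((-316447855152, 76751044608), 1560874368193258554759211025508901025028563162391762788966763500299168319326218416527920387076930958770909715372019587043228765840321818105217024, 1560874368193347280189422891584407534282455741070272754953175526429573774672798084409770167096868237951905047838518703561979530754620345144049664),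
  ((-133732493808, 32439877632), 1560874368193358370868199374843845847939192313405086500701477029695874458357967607673385719182657898592447985541226973142124715571673582035533824, 1560874368193358370868199374843845847939192313405086500701477029695874454824273478116617060016062897106610948569347196251204418247301459748061184),
  ((78878400, 0), 1560874368193347280189422891584407534282455741070272754953175526429573774672798084409770167096868237996506538235579949845050967299917068156010496, 1560874368193347280189422891584407534282455741070272754953175526429573774672798084409770167096868237951905047838518703561979530754620345144049664),
  ((-11421533440, 2771329024), 1560874368193358370868199374843845847939193433277457589603582308417014742580106668496184553321308442033109148435636241414243843772816210412961792, 1560874368193358370868199374843845847939192313405086500701477029695874454824273478116617060016062897106610948569347196251204418247301459748061184),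
  ((12, 0), 1560874368193358456192015378538022076726846942968750775362362228862779175604799982298143979330751494875592142657898533452592822856154468224860160, 1560874368193358370868199374844140226009230099531036307646881589145570861507013087049999894419536567409772784653165144744794086851817589450997760),
  ((768, 0), 1560874368193358366874099211413092898828710334839024889990169469042892320408323013223134696448336899547664824229794705682214251836620237795491840, 1560874368193358370868199374843853727299557519615566069908879257921601302005718807569619603199198373427930009607729020791894114999648119852892160),
  ((12, 0), 1560874368193358223558487289624806861706758006181795270931720666957027956197487659834611312002208305740132825784462654658099268196084806309642240, 1560874368193358370868199374843850425248686139606047657299160172113740811796203111553967380152589671888963939096097877335235558065275218186731520),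
  ((3072, 0), 1560874368193358365930772343949479062367336877770638694735986817500534659142283318896587972658014391579372711657067002208975567926357822191697920, 1560874368193358370868199374843845847939192313405086500701477029695874456591120542895001389599360397849529464396831093126823376368907661040680960),
  ((-44734933584, 10849910784), 1560874368193358370868199374843845864378990392821919095927841207221233648220897648067198804650090313148798859822975631334043106311582090358947840, 1560874368193358370868199374843845850287734896178919728590957626485211483966802986491029591749464671463710805841007217695426974204565109761638400),
  ((24924, 0), 1560874368193358370868199374843845817408137617472883449236123992713352816485109715323936361137120484316732230041990911160532618797720955602862080, 1560874368193358370868199374843845859681905227274252640148880013642559593469532760875142400349881765920436171617711715969841365547194904645468160),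
  ((1052544, 0), 1560874368193358370869521486781426342788553561247302127492935110162447280546927947263626665402647835577233290110973129579982271174890967510548480, 1560874368193358370868199374843845850287734896178919728590957626485211483966802986491029591749464671463710805841007217695426974204565109761638400),
  ((61668, 0), 1560874368193358370868199374843845826802310188312958538598256937312981494432117611353445970759306291870337176345971934479245663144588020998471680, 1560874368193358370868199374843845850287734896178919728590957626485211483966802986491029591749464671463710805841007217695426974204565109761638400),
  ((287136, 0), 1560874368193358370870843598719006821198116729672685159058029013103660912872958246460054526155205358005667720398970627825921436038199844662149120, 1560874368193358370868199374843845850287734896178919728590957626485211483966802986491029591749464671463710805841007217695426974204565109761638400),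
  ((198828, 0), 1560874368193358370873487822594167815593923271032411779517801088894340331313798881566663081551104424140998264451969321172597208931811668325826560, 1560874368193358370868199374843845850287734896178919728590957626485211483966802986491029591749464671463710805841007217695426974204565109761638400),
  ((192249655104, -46608285696), 1560874368193358370868199374843845845590649730631253272811996432906537429215438099298973187449256124235348122952654810101894750005137975185244160, 1560874368193358370868199374843845850287734896178919728590957626485211483966802986491029591749464671463710805841007217695426974204565109761638400),
  ((-32852553680, 7972782080), 1560874368193358370868199374843845826802309068440587449696151658591841210209978550530747570248421935321897386082333988869746393698693860011540480, 1560874368193358370868199374843845850287734896178919728590957626485211483966802986491029591749464671463710805841007217695426974204565109761638400),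
  ((5116092, 0), 1560874368193358370868199374843845826802307948568216360794046379870700925987839489708049169737537578773457595818696043260247124252799699024609280, 1560874368193358370868199374843845850287734896178919728590957626485211483966802986491029591749464671463710805841007217695426974204565109761638400),
  ((320607744, 0), 1560874368193358370867538318875055599340240398097062073361007691067919530925375618912674650622664542178586880817671933387779615784031164878028800, 1560874368193358370868199374843845847939192313405086500701477029695874456591120542895001389599360397849529464396831093126823376368907661040680960)]

/-- The squares of the sum-of-squares certificate (type 1): coefficient, vector. -/
def sqs1 : List ((ℤ × ℤ) × ℕ × ℕ) := [
  ((3, 0), 1171765525138694285816269180140343309732062023525779158291818481890159939091954482036544181990010254746998319070276197245584871972971911095967808, 1661743301938164385682097214525404186005908212702006851543996990403635072336453730366397033884698554897735817672602816798625267807429671126040576),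
  ((12, 0), 1515893633931286048379521574262563259300333725635032743736010326183514277719030803406154082049608049698130257198921018974928686519898415657123840, 1569706772817963521045631772287129764543787167321017537804949373431927551342631822193371566022370659589535053570425729189140904422492335383773184),
  ((768, 0), 1561009269460587635507084582044191132691766957869908327253901375373024147266278263632716792216359716271106716481820488112788266984030278497861632, 1560739466926129106229313420345101834297616277568542934469488688094104463062854345175386561580854187971080475348580048231162763124529022413832192),
  ((768, 0), 1561067695664601413571375225343902888751827515711728600311757391098234164469628315588225463497005618565601705381802729319010478141197049764249600, 1560681040722115328165023503500128564941126794461405445094531117806735593430710988861763395998927348161307350538284172023751903101428075600019456),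
  ((768, 0), 1560874368193358370868199463892376338371124610610688184599655073497819751847182933189473834149618164633213248843534948517376154523890135945183232, 1560874368193358370868199374843845847939192313405086500701477029695874456591120542895001389599360397849529464396831093126823376368907661040680960),
  ((768, 0), 1560874368193358370868199416728173718833273677005471111962337205025056613233151425735405893845670129956586616462141634055063211273702279246512128, 1560874368193358370868199374843845847939192313405086500701477029695874456591120542895001389599360397849529464396831093126823376368907661040680960),
  ((768, 0), 1560874368193358370868199360659127163536479785472806177586440846658554449355929094087664496453568868010892172261553036385027500160069482257055744, 1560874368193358370868199374843845847939192313405086500701477029695874456591120542895001389599360397849529464396831093126823376368907661040680960),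
  ((768, 0), 1560874368193358370868199391156276413246506707288609102366824964872540748111234707594040912123351635654243078221823775606054717876638542089682944, 1560874368193358370868199374843845847939192313405086500701477029695874456591120542895001389599360397849529464396831093126823376368907661040680960),
  ((768, 0), 1560874368193358370868199415388510224029111422840218764261001245388596620677953497556873947031577479890629984788348501626462693184824706489909248, 1560874368193358370868199374843845847939192313405086500701477029695874456591120542895001389599360397849529464396831093126823376368907661040680960),
  ((1028802300, -249511936), 1560874368193358370868199374843845847939192313405086500701477029962659430193897057150908939059377337543463509066466952673733649923139511462658064, 1560874368193358370868199374843845847939192313405086500701477029725517231435873488923435561761584502259966580471235077520924517874933422228504576),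
  ((21504, 0), 1560872693556937593789923549201792473976745162615391477120666141083169994708694837569317701730731344517400180251173660413997191551610260419510276, 1560874554264071790543563355470740667268353107937274836654900461698079897145272407868001416779821171752128015803228655542762644341714155590385664),
  ((765504, 0), 1560873437839791272491379471709371751293388340744144820934359869388419505372831757745659532074815484321368527414925929672258494535211022437842948, 1560873809981218111842107432963161389951709929808521492841206733511401485860147271805396275084633449679111113731214499514398723414333610264625152),
  ((917568, 0), 1560872693556937593789923549201792473976745162615391477120666141142455544398200729626186046053682975661647567811740739020847943693057833788506116, 1560874554264071790543563355470740667268353107937274836654900461757365446834778299924869761104269380573002247952036624330964927353765677966032896),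
  ((656832, 0), 1560872693556937593789923549201792473976744602679205932669613501900456501666142983328523317634750699259692292591936624160053228888137379423977476, 1560874554264071790543563355470740667268353107937274836654900461757365446834778299924869761104269380573002247952036624330964927353765677966032896),
  ((662400, 0), 1560872693556937593789923549201792483370915493710724388678588528299803653900931346508632203113090231139221247540144361724727013240705338084163588, 1560874554264071790543563355470740667268353107937274836654900461757365446834778299924869761104269380573002247952036624330964927353765677966032896),
  ((403968, 0), 1560872693556937593789923549201792473976745162615391477120666141142455551465588988739723364388369556309948475709916899792025249991610313882992644, 1560874554264071790543563355470740667268353107937274836654900461757365446834778299924869761104269380573002247952036624330964927353765677966032896),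
  ((794112, 0), 1560872693556937593789923549359400498762323079464507637523229889308413648048684045290566503032564265027452645715400233216661718056462154175873028, 1560874554264071790543563355470740667268353107937274836654900461757365446834778299924869761104269380573002247952036624330964927353765677966032896),
  ((-524774106, 127279104), 1560867669647675262555096072275632352089403710246306406378233474978271635458641207336359088664827244827078283144565502728608363545486208134021120, 1560875112476212049569655297351425125255835491533839844515170757675053443962975056758567326158979389049486553948017358396479306754107878051676160),
  ((2145, 0), 1560870646779089977360919762305949461355976422761319781633008388199269678115188888041726410041163804042951671799574579761653575479889256207351808, 1560872135344797334763831607321108015989262779018826469260395844928339798822474512508146759378228500757418945659960734283023623044585696748634112),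
  ((51339, 0), 1560867669647675262555096072275632352089403710246306406378233475215413834216664775563832465968606390817082590092758403305623162608297901002063872, 1560875112476212049569655297351425125255835491533839844515170757912195642720998624986040703456772224332983482543249233549288438802313967554265088),
  ((25275, 0), 1560867669647675262555096072275632352089401470501564228574022918247417663288433790373181552280904663796246732507617357712832512891594684151889920, 1560875112476212049569655297351425125255835491533839844515170757912195642720998624986040703456772224332983482543249233549288438802313967554265088),
  ((52092, 0), 1560867669647675262555096072275632389666085034627638052609923023844806272227587243093617094194262791314362552300448307971527650301866518792634368, 1560875112476212049569655297351425125255835491533839844515170757912195642720998624986040703456772224332983482543249233549288438802313967554265088),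
  ((13392, 0), 1560867669647675262555096072275632352089403710246306406378233475215413805947111739109683192629860068223878958500053760220913937414087980624117760, 1560875112476212049569655297351425125255835491533839844515170757912195642720998624986040703456772224332983482543249233549288438802313967554265088),
  ((8022, 0), 1560867669647675262555096072906064451231715377642771047988488467879246248818598038221354293872158926867288145001471793939266469564893783159472128, 1560875112476212049569655297351425125255835491533839844515170757912195642720998624986040703456772224332983482543249233549288438802313967554265088),
  ((434688, 0), 1560873996051931531517471413590056209280870724340709828794630165543249701259052082806830474427318327947545290814954958497692724877107280031514624, 1560874740334785210218927336097635486597513902469463172608323893789213662233683110926303960446954258886037915432838171141005336832597933703561216),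
  ((1763328, 0), 1560874368193358370868199374843845847939192313405086500701477029666231681746367596866567217436388004600778926028306980554696526486056199432175616, 1560874368193358370868199374843845847939192313405086500701477029666231681746367596866567217437136293439092348322427108732722234862881899852857344),
  ((1432704, 0), 1560874368193358370868199374843845847939192033436993728475950710045232160380338723717735853226921866399801288418404923124299169083595972249911296, 1560874368193358370868199374843845847939192313405086500701477029666231681746367596866567217437136293439092348322427108732722234862881899852857344),
  ((1820352, 0), 1560874368193358370868199374843845852636277478952752956480438223244905736497732905307790295966091632339565765892508791906636061259879951580004352, 1560874368193358370868199374843845847939192313405086500701477029666231681746367596866567217437136293439092348322427108732722234862881899852857344),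
  ((2170752, 0), 1560874368193358370868199374843845847939192313405086500701477029666231678212673467309798558270541291953255316667459473437809347148907634308939776, 1560874368193358370868199374843845847939192313405086500701477029666231681746367596866567217437136293439092348322427108732722234862881899852857344),
  ((1987776, 0), 1560874368193358370868199374765041835546403354980528420500195155583252629921125939034376988948443937594503231664717806725491113116481714162499584, 1560874368193358370868199374843845847939192313405086500701477029666231681746367596866567217437136293439092348322427108732722234862881899852857344),
  ((1812480, 0), 1560874554264071790543563355470740667268353107937274836654900461757365446834778299924869761103895236176146282003507104155325277173382120741011456, 1560874182122644951192835394216951028610031518872898164748053597634383466347462785865133018094451415126056680841625561922681825384049644115329024),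
  ((10359552, 0), 1560874554264071790543563355470740667268353247921321222767663621567865207517792736499285443209376594114948523102578419504874692780676071794147328, 1560874182122644951192835394216951028610031518872898164748053597634383466347462785865133018094451415126056680841625561922681825384049644115329024),
  ((16252416, 0), 1560874554264071790543563355470740664919810525163441608765419864968028419459095645704258221839791711145066284365526485113706246692534082129100800, 1560874182122644951192835394216951028610031518872898164748053597634383466347462785865133018094451415126056680841625561922681825384049644115329024),
  ((2267136, 0), 1560874554264071790543563355470740667268353107937274836654900461757365448601625364703254090687566881338221508978051144348119603748020240764633088, 1560874182122644951192835394216951028610031518872898164748053597634383466347462785865133018094451415126056680841625561922681825384049644115329024),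
  ((7226112, 0), 1560874554264071790543563355431338661071958628724995796554259524715875920922157471008774646859923202673008434821712517240722570488594878106173440, 1560874182122644951192835394216951028610031518872898164748053597634383466347462785865133018094451415126056680841625561922681825384049644115329024),
  ((3357696, 0), 1560874368193358370868199374843845847939192453389132886814240189506374217274134979469417071704841755788331705495902408476372791976201612093816832, 1560874368193358370868199374843845847939192313405086500701477029695874456591120542895001389599360397849529464396831093126823376368907661040680960),
  ((11623680, 0), 1560874368193358370868199374843845850287734896178919728590957626485211483966803197115612928864212211718922884328931998802793143755819537114595328, 1560874368193358370868199374843845847939192313405086500701477029695874456591120542895001389599360397849529464396831093126823376368907661040680960),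
  ((3664128, 0), 1560874368193358370868199374843845847939192313405086500701477029695874458357967607673385719183032043011604691371375133319617702943545781064302592, 1560874368193358370868199374843845847939192313405086500701477029695874456591120542895001389599360397849529464396831093126823376368907661040680960),
  ((14032128, 0), 1560874368193358370868199374883247854135586792617365540802117966737363982503741371811096503844080720190980733872745966675776819959758741137522688, 1560874368193358370868199374843845847939192313405086500701477029695874456591120542895001389599360397849529464396831093126823376368907661040680960),
  ((10552320, 0), 1560874368193358370868199374843845850287735036162966114703720786295711244649817633690028610968945280819411703133883027517991822457049650705727488, 1560874368193358370868199374843845847939192313405086500701477029695874456591120542895001389599360397849529464396831093126823376368907661040680960),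
  ((531456, 0), 1560874368193358370868199374843845847939192453389132886814240189506374219040982044247801401287765112112093510176326162034816381644775894655434752, 1560874368193358370868199374843845847939192313405086500701477029695874456591120542895001389599360397849529464396831093126823376368907661040680960),
  ((8720640, 0), 1560874368193358370868199374883247854135586932601411926914881126547863743186755808385512185948813789291469552677696995390975498660988854728654848, 1560874368193358370868199374843845847939192313405086500701477029695874456591120542895001389599360397849529464396831093126823376368907661040680960),
  ((13352448, 0), 1560874368193358370868199374843845850287734896178919728590957626485211485733650261893997258447135568042684689009355752361236733424393819676213248, 1560874368193358370868199374843845847939192313405086500701477029695874456591120542895001389599360397849529464396831093126823376368907661040680960),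
  ((9641472, 0), 1560874368193358370868199374804443844091340416966640688490316689443721958054182368199517814619491889377471614853017125253839700164968457017753600, 1560874368193358370868199374843845847939192313405086500701477029695874456591120542895001389599360397849529464396831093126823376368907661040680960),
  ((6725376, 0), 1560874368193358370868199374804443841742797834192807460600836092654384932445346778757290604938311720670153421895460259770664259352694700967460864, 1560874368193358370868199374843845847939192313405086500701477029695874456591120542895001389599360397849529464396831093126823376368907661040680960),
  ((-16444415616, 3992190976), 1560872693556937593789923549201792473976745162615391477120666141142455544398200729626186046055179553338274412399981312289549417505185508712513540, 1560874554264071790543563355470740667268353107937274836654900461757365446834778299924869761104269380573002247952036624330964927353765677966032896),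
  ((-502812642, 122232832), 1560867669647675262555096072275632352089403710246306406378233475215413834216664775563832465962620080110575211739796110230817267359787201306034176, 1560875112476212049569655297351425125255835491533839844515170757912195642720998624986040703456772224332983482543249233549288438802313967554265088),
  ((33662802240, -8145862656), 1560874368193358370868199374843845847939192313405086500701477029666231681746367596866567217437136293439092348322427267189047263392120036894179328, 1560874368193358370868199374843845847939192313405086500701477029666231681746367596866567217437136293439092348322427108732722234862881899852857344),
  ((-904152200704, 219357904896), 1560874554264071790543563355470740667268353107937274836654900461757365446834778299924869761104269380595302993150567247472500645626414039472013312, 1560874182122644951192835394216951028610031518872898164748053597634383466347462785865133018094451415126056680841625561922681825384049644115329024),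
  ((315067392, 0), 1560874368193358370868199374843845847939192313405086500701477029695874456591120542895001389599734542268686175543891236443998744821939579771682816, 1560874368193358370868199374843845847939192313405086500701477029695874456591120542895001389599360397849529464396831093126823376368907661040680960),
  ((-634733704704, 154014842880), 1560874368193358370868199374843845847939192453389132886814240189506374217274134979469417071704467611369174994348842265159197423523169693362814976, 1560874368193358370868199374843845847939192313405086500701477029695874456591120542895001389599360397849529464396831093126823376368907661040680960),
  ((226786560, 0), 1560874368193358370868199374843845850287734896178919728590957626485211483966803197115612928863838067299766173181871855485617775302787618383593472, 1560874368193358370868199374843845847939192313405086500701477029695874456591120542895001389599360397849529464396831093126823376368907661040680960),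
  ((268833024, 0), 1560874368193358370868199374843845847939192313405086500701477029695874458357967607673385719182657898592447980224314990002442334490513862333300736, 1560874368193358370868199374843845847939192313405086500701477029695874456591120542895001389599360397849529464396831093126823376368907661040680960),
  ((276571392, 0), 1560874368193358370868199374883247854135586792617365540802117966737363982503741371811096503843706575771824022725685823358601451506726822406520832, 1560874368193358370868199374843845847939192313405086500701477029695874456591120542895001389599360397849529464396831093126823376368907661040680960)]

/-- Conversion of a Boolean to a natural number. -/
def bn (b : Bool) : ℕ := cond b 1 0

/-- Flag index. -/
def fl (ux vx uy vy e : Bool) : ℕ :=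
  Nat.land (Nat.shiftRight flTab (5 * (bn ux + 2 * bn vx + 4 * bn uy + 8 * bn vy + 16 * bn e))) 31

def rowA (k : ℕ) : ℕ := rowsA.getD k 0
def rowB (k : ℕ) : ℕ := rowsB.getD k 0

/-- Table entries (shifted by `2 ^ 28`). -/
def entA (t : Bool) (f g : ℕ) : ℕ := Nat.land (Nat.shiftRight (rowA (cond t (20 + f) f)) (30 * g)) 1073741823
def entB (t : Bool) (f g : ℕ) : ℕ := Nat.land (Nat.shiftRight (rowB (cond t (20 + f) f)) (30 * g)) 1073741823

/-- Perm as a product of swaps. -/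
def mkPerm (a b c d e : Fin 6) : Equiv.Perm (Fin 6) :=
  Equiv.swap 0 a * (Equiv.swap 1 b * (Equiv.swap 2 c * (Equiv.swap 3 d * Equiv.swap 4 e)))

/-- The 45 ways of splitting six points into a pair and an unordered pair of pairs. -/
def perms45 : List (Equiv.Perm (Fin 6)) := [
  mkPerm 0 1 2 3 4,
  mkPerm 0 1 2 4 4,
  mkPerm 0 1 2 5 5,
  mkPerm 0 2 2 3 4,
  mkPerm 0 2 2 4 4,
  mkPerm 0 2 2 5 5,
  mkPerm 0 3 3 3 4,
  mkPerm 0 3 3 4 4,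
  mkPerm 0 3 3 5 5,
  mkPerm 0 4 4 4 4,
  mkPerm 0 4 4 3 4,
  mkPerm 0 4 4 5 4,
  mkPerm 0 5 5 5 5,
  mkPerm 0 5 5 3 5,
  mkPerm 0 5 5 4 5,
  mkPerm 1 2 2 3 4,
  mkPerm 1 2 2 4 4,
  mkPerm 1 2 2 5 5,
  mkPerm 1 3 3 3 4,
  mkPerm 1 3 3 4 4,
  mkPerm 1 3 3 5 5,
  mkPerm 1 4 4 4 4,
  mkPerm 1 4 4 3 4,
  mkPerm 1 4 4 5 4,
  mkPerm 1 5 5 5 5,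
  mkPerm 1 5 5 3 5,
  mkPerm 1 5 5 4 5,
  mkPerm 2 3 2 3 4,
  mkPerm 2 3 2 4 4,
  mkPerm 2 3 2 5 5,
  mkPerm 2 4 2 4 4,
  mkPerm 2 4 2 3 4,
  mkPerm 2 4 2 5 4,
  mkPerm 2 5 2 5 5,
  mkPerm 2 5 2 3 5,
  mkPerm 2 5 2 4 5,
  mkPerm 3 4 3 4 4,
  mkPerm 3 4 3 3 4,
  mkPerm 3 4 3 5 4,
  mkPerm 3 5 3 5 5,
  mkPerm 3 5 3 3 5,
  mkPerm 3 5 3 4 5,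
  mkPerm 4 5 4 5 4,
  mkPerm 4 5 4 4 5,
  mkPerm 4 5 4 3 5]

def sum45 (ent : Bool → ℕ → ℕ → ℕ) (b01 b02 b03 b04 b05 b12 b13 b14 b15 b23 b24 b25 b34 b35 b45 : Bool) : ℕ :=
  (ent b01 (fl b02 b12 b03 b13 b23) (fl b04 b14 b05 b15 b45) +
  (ent b01 (fl b02 b12 b04 b14 b24) (fl b03 b13 b05 b15 b35) +
  (ent b01 (fl b02 b12 b05 b15 b25) (fl b03 b13 b04 b14 b34) +
  (ent b02 (fl b01 b12 b03 b23 b13) (fl b04 b24 b05 b25 b45) +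
  (ent b02 (fl b01 b12 b04 b24 b14) (fl b03 b23 b05 b25 b35) +
  (ent b02 (fl b01 b12 b05 b25 b15) (fl b03 b23 b04 b24 b34) +
  (ent b03 (fl b01 b13 b02 b23 b12) (fl b04 b34 b05 b35 b45) +
  (ent b03 (fl b01 b13 b04 b34 b14) (fl b02 b23 b05 b35 b25) +
  (ent b03 (fl b01 b13 b05 b35 b15) (fl b02 b23 b04 b34 b24) +
  (ent b04 (fl b01 b14 b02 b24 b12) (fl b03 b34 b05 b45 b35) +
  (ent b04 (fl b01 b14 b03 b34 b13) (fl b02 b24 b05 b45 b25) +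
  (ent b04 (fl b01 b14 b05 b45 b15) (fl b02 b24 b03 b34 b23) +
  (ent b05 (fl b01 b15 b02 b25 b12) (fl b03 b35 b04 b45 b34) +
  (ent b05 (fl b01 b15 b03 b35 b13) (fl b02 b25 b04 b45 b24) +
  (ent b05 (fl b01 b15 b04 b45 b14) (fl b02 b25 b03 b35 b23) +
  (ent b12 (fl b01 b02 b13 b23 b03) (fl b14 b24 b15 b25 b45) +
  (ent b12 (fl b01 b02 b14 b24 b04) (fl b13 b23 b15 b25 b35) +
  (ent b12 (fl b01 b02 b15 b25 b05) (fl b13 b23 b14 b24 b34) +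
  (ent b13 (fl b01 b03 b12 b23 b02) (fl b14 b34 b15 b35 b45) +
  (ent b13 (fl b01 b03 b14 b34 b04) (fl b12 b23 b15 b35 b25) +
  (ent b13 (fl b01 b03 b15 b35 b05) (fl b12 b23 b14 b34 b24) +
  (ent b14 (fl b01 b04 b12 b24 b02) (fl b13 b34 b15 b45 b35) +
  (ent b14 (fl b01 b04 b13 b34 b03) (fl b12 b24 b15 b45 b25) +
  (ent b14 (fl b01 b04 b15 b45 b05) (fl b12 b24 b13 b34 b23) +
  (ent b15 (fl b01 b05 b12 b25 b02) (fl b13 b35 b14 b45 b34) +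
  (ent b15 (fl b01 b05 b13 b35 b03) (fl b12 b25 b14 b45 b24) +
  (ent b15 (fl b01 b05 b14 b45 b04) (fl b12 b25 b13 b35 b23) +
  (ent b23 (fl b02 b03 b12 b13 b01) (fl b24 b34 b25 b35 b45) +
  (ent b23 (fl b02 b03 b24 b34 b04) (fl b12 b13 b25 b35 b15) +
  (ent b23 (fl b02 b03 b25 b35 b05) (fl b12 b13 b24 b34 b14) +
  (ent b24 (fl b02 b04 b12 b14 b01) (fl b23 b34 b25 b45 b35) +
  (ent b24 (fl b02 b04 b23 b34 b03) (fl b12 b14 b25 b45 b15) +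
  (ent b24 (fl b02 b04 b25 b45 b05) (fl b12 b14 b23 b34 b13) +
  (ent b25 (fl b02 b05 b12 b15 b01) (fl b23 b35 b24 b45 b34) +
  (ent b25 (fl b02 b05 b23 b35 b03) (fl b12 b15 b24 b45 b14) +
  (ent b25 (fl b02 b05 b24 b45 b04) (fl b12 b15 b23 b35 b13) +
  (ent b34 (fl b03 b04 b13 b14 b01) (fl b23 b24 b35 b45 b25) +
  (ent b34 (fl b03 b04 b23 b24 b02) (fl b13 b14 b35 b45 b15) +
  (ent b34 (fl b03 b04 b35 b45 b05) (fl b13 b14 b23 b24 b12) +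
  (ent b35 (fl b03 b05 b13 b15 b01) (fl b23 b25 b34 b45 b24) +
  (ent b35 (fl b03 b05 b23 b25 b02) (fl b13 b15 b34 b45 b14) +
  (ent b35 (fl b03 b05 b34 b45 b04) (fl b13 b15 b23 b25 b12) +
  (ent b45 (fl b04 b05 b14 b15 b01) (fl b24 b25 b34 b35 b23) +
  (ent b45 (fl b04 b05 b24 b25 b02) (fl b14 b15 b34 b35 b13) +
  (ent b45 (fl b04 b05 b34 b35 b03) (fl b14 b15 b24 b25 b12) + 0)))))))))))))))))))))))))))))))))))))))))))))

/-- Unpacking of the packed vectors. -/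
def vraw (n k : ℕ) : ℕ := Nat.land (Nat.shiftRight n (24 * k)) 16777215

def vget (n k : ℕ) : ℤ := (vraw n k : ℤ) - 8388608

/-- Test whether an entry of a packed vector vanishes. -/
def vz (m n k : ℕ) : Bool := and (Nat.beq (vraw m k) 8388608) (Nat.beq (vraw n k) 8388608)

/-- Rational and irrational part of a product of three elements of `ℤ[√17]`. -/
def mulA (c d x y z w : ℤ) : ℤ := c * (x * z + 17 * (y * w)) + 17 * (d * (x * w + y * z))
def mulB (c d x y z w : ℤ) : ℤ := d * (x * z + 17 * (y * w)) + c * (x * w + y * z)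

/-- The entries of the sum of squares. -/
def sosA (f g : ℕ) : List ((ℤ × ℤ) × ℕ × ℕ) → ℤ
  | [] => 0
  | ((c, d), m, n) :: l => cond (or (vz m n f) (vz m n g))
      (sosA f g l) (mulA c d (vget m f) (vget n f) (vget m g) (vget n g) + sosA f g l)
def sosB (f g : ℕ) : List ((ℤ × ℤ) × ℕ × ℕ) → ℤ
  | [] => 0
  | ((c, d), m, n) :: l => cond (or (vz m n f) (vz m n g))
      (sosB f g l) (mulB c d (vget m f) (vget n f) (vget m g) (vget n g) + sosB f g l)

def allB (f : Bool → Bool) : Bool := and (f false) (f true)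

lemma allB_spec {f : Bool → Bool} (h : allB f = true) (b : Bool) : f b = true := by
  unfold allB at h
  rw [Bool.and_eq_true] at h
  cases b
  · exact h.1
  · exact h.2

def allN (n : ℕ) (f : ℕ → Bool) : Bool := (List.range n).all f

lemma allN_spec {n : ℕ} {f : ℕ → Bool} (h : allN n f = true) (k : ℕ) (hk : k < n) : f k = true := by
  unfold allN at h
  rw [List.all_eq_true] at h
  exact h k (List.mem_range.mpr hk)

def sqsT (t : Bool) : List ((ℤ × ℤ) × ℕ × ℕ) := cond t sqs1 sqs0

def chkSos : Bool := allB fun t => allN 20 fun g => allN (g + 1) fun f =>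
  and (decide (sosA f g (sqsT t) = 262144 * ((entA t f g : ℤ) - 268435456)))
    (decide (sosB f g (sqsT t) = 262144 * ((entB t f g : ℤ) - 268435456)))

lemma chkSos_true : chkSos = true := by decide +kernel

def chkSym : Bool := allB fun t => allN 20 fun g => allN 20 fun f =>
  and (Nat.beq (entA t f g) (entA t g f)) (Nat.beq (entB t f g) (entB t g f))

lemma chkSym_true : chkSym = true := by decide +kernel

/-- Sufficient test for `a + b √17 ≥ 0`. -/
def nonnegZ (a b : ℤ) : Bool :=
  and (decide (0 ≤ a * 10000000000000000 + b * 41231056256176605))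
    (decide (0 ≤ a * 10000000000000000 + b * 41231056256176606))

lemma sqs_nonneg : (allB fun t => (sqsT t).all fun s => nonnegZ s.1.1 s.1.2) = true := by
  decide +kernel

/-! ### Pointwise check over degree-sorted graphs on six vertices -/

/-- Symmetric Boolean matrix with given upper triangle. -/
def mkA (b01 b02 b03 b04 b05 b12 b13 b14 b15 b23 b24 b25 b34 b35 b45 : Bool) (i j : Fin 6) : Bool :=
  match i, j with
  | 0, 0 => false | 0, 1 => b01 | 0, 2 => b02 | 0, 3 => b03 | 0, 4 => b04 | 0, 5 => b05
  | 1, 0 => b01 | 1, 1 => false | 1, 2 => b12 | 1, 3 => b13 | 1, 4 => b14 | 1, 5 => b15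
  | 2, 0 => b02 | 2, 1 => b12 | 2, 2 => false | 2, 3 => b23 | 2, 4 => b24 | 2, 5 => b25
  | 3, 0 => b03 | 3, 1 => b13 | 3, 2 => b23 | 3, 3 => false | 3, 4 => b34 | 3, 5 => b35
  | 4, 0 => b04 | 4, 1 => b14 | 4, 2 => b24 | 4, 3 => b34 | 4, 4 => false | 4, 5 => b45
  | 5, 0 => b05 | 5, 1 => b15 | 5, 2 => b25 | 5, 3 => b35 | 5, 4 => b45 | 5, 5 => false

/-- The colourings of the pattern. -/
def patB (i j : ℕ) : Bool := or (Nat.beq (i + j) 1) (and (Nat.beq i 2) (Nat.beq j 2))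

def exN (f : ℕ → Bool) : Bool := or (f 0) (or (f 1) (f 2))

def hasCol (b01 b02 b03 b04 b05 b12 b13 b14 b15 b23 b24 b25 b34 b35 b45 : Bool) : Bool :=
  exN fun k0 => 
  exN fun k1 => and (b01 == patB k0 k1) (
  exN fun k2 => and (b02 == patB k0 k2) ( and (b12 == patB k1 k2) (
  exN fun k3 => and (b03 == patB k0 k3) ( and (b13 == patB k1 k3) ( and (b23 == patB k2 k3) (
  exN fun k4 => and (b04 == patB k0 k4) ( and (b14 == patB k1 k4) ( and (b24 == patB k2 k4) ( and (b34 == patB k3 k4) (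
  exN fun k5 => and (b05 == patB k0 k5) ( and (b15 == patB k1 k5) ( and (b25 == patB k2 k5) ( and (b35 == patB k3 k5) ( and (b45 == patB k4 k5) (
  true)))))))))))))))

def dg0 (b01 b02 b03 b04 b05 b12 b13 b14 b15 b23 b24 b25 b34 b35 b45 : Bool) : ℕ := bn b01 + bn b02 + bn b03 + bn b04 + bn b05
def dg1 (b01 b02 b03 b04 b05 b12 b13 b14 b15 b23 b24 b25 b34 b35 b45 : Bool) : ℕ := bn b01 + bn b12 + bn b13 + bn b14 + bn b15
def dg2 (b01 b02 b03 b04 b05 b12 b13 b14 b15 b23 b24 b25 b34 b35 b45 : Bool) : ℕ := bn b02 + bn b12 + bn b23 + bn b24 + bn b25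
def dg3 (b01 b02 b03 b04 b05 b12 b13 b14 b15 b23 b24 b25 b34 b35 b45 : Bool) : ℕ := bn b03 + bn b13 + bn b23 + bn b34 + bn b35
def dg4 (b01 b02 b03 b04 b05 b12 b13 b14 b15 b23 b24 b25 b34 b35 b45 : Bool) : ℕ := bn b04 + bn b14 + bn b24 + bn b34 + bn b45
def dg5 (b01 b02 b03 b04 b05 b12 b13 b14 b15 b23 b24 b25 b34 b35 b45 : Bool) : ℕ := bn b05 + bn b15 + bn b25 + bn b35 + bn b45
def eTot (b01 b02 b03 b04 b05 b12 b13 b14 b15 b23 b24 b25 b34 b35 b45 : Bool) : ℕ := bn b01 + bn b02 + bn b03 + bn b04 + bn b05 + bn b12 + bn b13 + bn b14 + bn b15 + bn b23 + bn b24 + bn b25 + bn b34 + bn b35 + bn b45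
def isSorted (b01 b02 b03 b04 b05 b12 b13 b14 b15 b23 b24 b25 b34 b35 b45 : Bool) : Bool :=
  and (Nat.ble (dg0 b01 b02 b03 b04 b05 b12 b13 b14 b15 b23 b24 b25 b34 b35 b45) (dg1 b01 b02 b03 b04 b05 b12 b13 b14 b15 b23 b24 b25 b34 b35 b45)) ( and (Nat.ble (dg1 b01 b02 b03 b04 b05 b12 b13 b14 b15 b23 b24 b25 b34 b35 b45) (dg2 b01 b02 b03 b04 b05 b12 b13 b14 b15 b23 b24 b25 b34 b35 b45)) ( and (Nat.ble (dg2 b01 b02 b03 b04 b05 b12 b13 b14 b15 b23 b24 b25 b34 b35 b45) (dg3 b01 b02 b03 b04 b05 b12 b13 b14 b15 b23 b24 b25 b34 b35 b45)) ( and (Nat.ble (dg3 b01 b02 b03 b04 b05 b12 b13 b14 b15 b23 b24 b25 b34 b35 b45) (dg4 b01 b02 b03 b04 b05 b12 b13 b14 b15 b23 b24 b25 b34 b35 b45)) ( and (Nat.ble (dg4 b01 b02 b03 b04 b05 b12 b13 b14 b15 b23 b24 b25 b34 b35 b45) (dg5 b01 b02 b03 b04 b05 b12 b13 b14 b15 b23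 b24 b25 b34 b35 b45)) (true)))))
def oCnt (b01 b02 b03 b04 b05 b12 b13 b14 b15 b23 b24 b25 b34 b35 b45 : Bool) : ℕ :=
  cond (Nat.beq (eTot b01 b02 b03 b04 b05 b12 b13 b14 b15 b23 b24 b25 b34 b35 b45) (dg0 b01 b02 b03 b04 b05 b12 b13 b14 b15 b23 b24 b25 b34 b35 b45 + 3)) 1 0 + cond (Nat.beq (eTot b01 b02 b03 b04 b05 b12 b13 b14 b15 b23 b24 b25 b34 b35 b45) (dg1 b01 b02 b03 b04 b05 b12 b13 b14 b15 b23 b24 b25 b34 b35 b45 + 3)) 1 0 + cond (Nat.beq (eTot b01 b02 b03 b04 b05 b12 b13 b14 b15 b23 b24 b25 b34 b35 b45) (dg2 b01 b02 b03 b04 b05 b12 b13 b14 b15 b23 b24 b25 b34 b35 b45 + 3)) 1 0 + cond (Nat.beq (eTot b01 b02 b03 b04 b05 b12 b13 b14 b15 b23 b24 b25 b34 b35 b45) (dg3 b01 b02 b03 b04 b05 b12 b13 b14 b15 b23 b24 b25 b34 b35 b45 + 3)) 1 0 + cond (Nat.beq (eTot b01 b02 b03 b04 b05 b12 b13 b14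 b15 b23 b24 b25 b34 b35 b45) (dg4 b01 b02 b03 b04 b05 b12 b13 b14 b15 b23 b24 b25 b34 b35 b45 + 3)) 1 0 + cond (Nat.beq (eTot b01 b02 b03 b04 b05 b12 b13 b14 b15 b23 b24 b25 b34 b35 b45) (dg5 b01 b02 b03 b04 b05 b12 b13 b14 b15 b23 b24 b25 b34 b35 b45 + 3)) 1 0

/-- Final test: `a + b √17` is zero and there is a colouring, or it is at least `90 D / 192`. -/
def finTest (sA sB o : ℕ) (col : Bool) : Bool :=
  or (and (and (Nat.beq (2 * sA + 11796480 * o) (24159191040 - 36979200)) (Nat.beq (2 * sB) (24159191040 + 17625600))) col)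
    (nonnegZ (24159191040 - 36979200 - 368640 - 2 * sA - 11796480 * o) (24159191040 + 17625600 - 2 * sB))

def chk15 : Bool :=
  allB fun b01 => allB fun b02 => allB fun b03 => allB fun b04 => allB fun b05 => allB fun b12 => allB fun b13 => allB fun b14 => allB fun b15 => allB fun b23 => allB fun b24 => allB fun b25 => allB fun b34 => allB fun b35 => allB fun b45 =>
  cond (isSorted b01 b02 b03 b04 b05 b12 b13 b14 b15 b23 b24 b25 b34 b35 b45)
    (finTest (sum45 entA b01 b02 b03 b04 b05 b12 b13 b14 b15 b23 b24 b25 b34 b35 b45) (sum45 entB b01 b02 b03 b04 b05 b12 b13 b14 b15 b23 b24 b25 b34 b35 b45) (oCnt b01 b02 b03 b04 b05 b12 b13 b14 b15 b23 b24 b25 b34 b35 b45) (hasCol b01 b02 b03 b04 b05 b12 b13 b14 b15 b23 b24 b25 b34 b35 b45)) true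

lemma chk15_true : chk15 = true := by decide +kernel

/-! ### Symmetrisation -/

def pat (i j : Fin 3) : Bool := patB i.val j.val

/-- A symmetric matrix which is not coloured by the pattern. -/
def Bad (a : Fin 6 → Fin 6 → Bool) : Prop :=
  ¬ ∃ κ : Fin 6 → Fin 3, ∀ i j, i ≠ j → a i j = pat (κ i) (κ j)

def qi (ent : Bool → ℕ → ℕ → ℕ) (a : Fin 6 → Fin 6 → Bool) : ℕ :=
  ent (a 0 1) (fl (a 0 2) (a 1 2) (a 0 3) (a 1 3) (a 2 3)) (fl (a 0 4) (a 1 4) (a 0 5) (a 1 5) (a 4 5))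

def pull (a : Fin 6 → Fin 6 → Bool) (p : Equiv.Perm (Fin 6)) : Fin 6 → Fin 6 → Bool :=
  fun i j => a (p i) (p j)

def S45 (ent : Bool → ℕ → ℕ → ℕ) (a : Fin 6 → Fin 6 → Bool) : ℕ :=
  (perms45.map (fun p => qi ent (pull a p))).sum

set_option maxRecDepth 100000 in
lemma S45_mkA (ent : Bool → ℕ → ℕ → ℕ) (b01 b02 b03 b04 b05 b12 b13 b14 b15 b23 b24 b25 b34 b35 b45 : Bool) :
    S45 ent (mkA b01 b02 b03 b04 b05 b12 b13 b14 b15 b23 b24 b25 b34 b35 b45) =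
      sum45 ent b01 b02 b03 b04 b05 b12 b13 b14 b15 b23 b24 b25 b34 b35 b45 := by
  rfl

def gen1 : Equiv.Perm (Fin 6) := Equiv.swap 0 1
def gen2 : Equiv.Perm (Fin 6) := Equiv.swap 2 3
def gen3 : Equiv.Perm (Fin 6) := Equiv.swap 4 5
def gen4 : Equiv.Perm (Fin 6) := Equiv.swap 2 4 * Equiv.swap 3 5

def gW (b1 b2 b3 b4 : Bool) : Equiv.Perm (Fin 6) :=
  cond b4 gen4 1 * (cond b1 gen1 1 * (cond b2 gen2 1 * cond b3 gen3 1))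

def per45 (k : Fin 45) : Equiv.Perm (Fin 6) := perms45.get k

def idx5 (k : Fin 45 × Bool × Bool × Bool × Bool) : Equiv.Perm (Fin 6) :=
  per45 k.1 * gW k.2.1 k.2.2.1 k.2.2.2.1 k.2.2.2.2

/-- canonical data read off from a permutation -/
def canon (p : Equiv.Perm (Fin 6)) : ℕ :=
  let a := (p 0).val
  let b := (p 1).val
  let x := min (p 2).val (p 3).val
  let y := max (p 2).val (p 3).val
  let z := min (p 4).val (p 5).val
  let w := max (p 4).val (p 5).val
  (min a b + 6 * max a b) + 36 * (cond (Nat.ble x z) (x + 6 * y) (z + 6 * w))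

def bits (p : Equiv.Perm (Fin 6)) : Bool × Bool × Bool × Bool :=
  let b4 := Nat.ble (min (p 4).val (p 5).val) (min (p 2).val (p 3).val)
  (Nat.ble (p 1).val (p 0).val,
   Nat.ble (p 3).val (p 2).val,
   Nat.ble (p 5).val (p 4).val,
   b4)

lemma bits_idx5 : ∀ k : Fin 45 × Bool × Bool × Bool × Bool, bits (idx5 k) = k.2 ∧ canon (idx5 k) = canon (per45 k.1) := by
  decide +kernel

lemma canon_inj : ∀ k l : Fin 45, canon (per45 k) = canon (per45 l) → k = l := by
  decide +kernel

lemma idx5_bij : Function.Bijective idx5 := by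
  rw [Fintype.bijective_iff_injective_and_card]
  constructor
  · intro k l h
    have h1 := bits_idx5 k
    have h2 := bits_idx5 l
    rw [h] at h1
    have e1 : k.1 = l.1 := canon_inj _ _ (h1.2.symm.trans h2.2)
    have e2 : k.2 = l.2 := h1.1.symm.trans h2.1
    exact Prod.ext e1 e2
  · simp [Fintype.card_perm, Nat.factorial]

def SymB (a : Fin 6 → Fin 6 → Bool) : Prop := ∀ i j, a i j = a j i

lemma SymB.pull {a : Fin 6 → Fin 6 → Bool} (h : SymB a) (p : Equiv.Perm (Fin 6)) : SymB (pull a p) :=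
  fun i j => h (p i) (p j)

lemma pull_mul (a : Fin 6 → Fin 6 → Bool) (p q : Equiv.Perm (Fin 6)) :
    pull a (p * q) = pull (pull a p) q := rfl

def InvEnt (ent : Bool → ℕ → ℕ → ℕ) : Prop :=
  ∀ t u2 v2 u3 v3 u4 v4 u5 v5 e f : Bool,
    ent t (fl u2 v2 u3 v3 e) (fl u4 v4 u5 v5 f) = ent t (fl v2 u2 v3 u3 e) (fl v4 u4 v5 u5 f) ∧
    ent t (fl u2 v2 u3 v3 e) (fl u4 v4 u5 v5 f) = ent t (fl u4 v4 u5 v5 f) (fl u2 v2 u3 v3 e)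

lemma fl_swap : ∀ u2 v2 u3 v3 e : Bool, fl u2 v2 u3 v3 e = fl u3 v3 u2 v2 e := by
  decide +kernel

def chkInv (ent : Bool → ℕ → ℕ → ℕ) : Bool :=
  allB fun t => allB fun u2 => allB fun v2 => allB fun u3 => allB fun v3 => allB fun u4 =>
  allB fun v4 => allB fun u5 => allB fun v5 => allB fun e => allB fun f =>
    and (Nat.beq (ent t (fl u2 v2 u3 v3 e) (fl u4 v4 u5 v5 f)) (ent t (fl v2 u2 v3 u3 e) (fl v4 u4 v5 u5 f)))
      (Nat.beq (ent t (fl u2 v2 u3 v3 e) (fl u4 v4 u5 v5 f)) (ent t (fl u4 v4 u5 v5 f) (fl u2 v2 u3 v3 e)))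

lemma chkInv_spec {ent : Bool → ℕ → ℕ → ℕ} (h : chkInv ent = true) : InvEnt ent := by
  intro t u2 v2 u3 v3 u4 v4 u5 v5 e f
  have := allB_spec (allB_spec (allB_spec (allB_spec (allB_spec (allB_spec (allB_spec (allB_spec (allB_spec
    (allB_spec (allB_spec h t) u2) v2) u3) v3) u4) v4) u5) v5) e) f
  rw [Bool.and_eq_true] at this
  exact ⟨Nat.eq_of_beq_eq_true this.1, Nat.eq_of_beq_eq_true this.2⟩

lemma invA : InvEnt entA := chkInv_spec (by decide +kernel)
lemma invB : InvEnt entB := chkInv_spec (by decide +kernel)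

lemma qi_gen1 {ent} (hi : InvEnt ent) {a : Fin 6 → Fin 6 → Bool} (h : SymB a) :
    qi ent (pull a gen1) = qi ent a := by
  have e : qi ent (pull a gen1) = ent (a 1 0) (fl (a 1 2) (a 0 2) (a 1 3) (a 0 3) (a 2 3))
    (fl (a 1 4) (a 0 4) (a 1 5) (a 0 5) (a 4 5)) := rfl
  rw [e, h 1 0, ← (hi _ _ _ _ _ _ _ _ _ _ _).1]
  rfl

lemma qi_gen2 {ent} (hi : InvEnt ent) {a : Fin 6 → Fin 6 → Bool} (h : SymB a) :
    qi ent (pull a gen2) = qi ent a := by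
  have e : qi ent (pull a gen2) = ent (a 0 1) (fl (a 0 3) (a 1 3) (a 0 2) (a 1 2) (a 3 2))
    (fl (a 0 4) (a 1 4) (a 0 5) (a 1 5) (a 4 5)) := rfl
  rw [e, h 3 2, fl_swap (a 0 3)]
  rfl

lemma qi_gen3 {ent} (hi : InvEnt ent) {a : Fin 6 → Fin 6 → Bool} (h : SymB a) :
    qi ent (pull a gen3) = qi ent a := by
  have e : qi ent (pull a gen3) = ent (a 0 1) (fl (a 0 2) (a 1 2) (a 0 3) (a 1 3) (a 2 3))
    (fl (a 0 5) (a 1 5) (a 0 4) (a 1 4) (a 5 4)) := rfl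
  rw [e, h 5 4, fl_swap (a 0 5)]
  rfl

lemma qi_gen4 {ent} (hi : InvEnt ent) {a : Fin 6 → Fin 6 → Bool} (h : SymB a) :
    qi ent (pull a gen4) = qi ent a := by
  have e : qi ent (pull a gen4) = ent (a 0 1) (fl (a 0 4) (a 1 4) (a 0 5) (a 1 5) (a 4 5))
    (fl (a 0 2) (a 1 2) (a 0 3) (a 1 3) (a 2 3)) := rfl
  rw [e, (hi _ _ _ _ _ _ _ _ _ _ _).2]
  rfl

lemma pull_one (a : Fin 6 → Fin 6 → Bool) : pull a 1 = a := rfl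

lemma qi_gW {ent} (hi : InvEnt ent) {a : Fin 6 → Fin 6 → Bool} (h : SymB a) (b1 b2 b3 b4 : Bool) :
    qi ent (pull a (gW b1 b2 b3 b4)) = qi ent a := by
  unfold gW
  rw [pull_mul, pull_mul, pull_mul]
  have s1 : ∀ (b : Bool) (a : Fin 6 → Fin 6 → Bool), SymB a → qi ent (pull a (cond b gen1 1)) = qi ent a := by
    intro b a h; cases b
    · rfl
    · exact qi_gen1 hi h
  have s2 : ∀ (b : Bool) (a : Fin 6 → Fin 6 → Bool), SymB a → qi ent (pull a (cond b gen2 1)) = qi ent a := by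
    intro b a h; cases b
    · rfl
    · exact qi_gen2 hi h
  have s3 : ∀ (b : Bool) (a : Fin 6 → Fin 6 → Bool), SymB a → qi ent (pull a (cond b gen3 1)) = qi ent a := by
    intro b a h; cases b
    · rfl
    · exact qi_gen3 hi h
  have s4 : ∀ (b : Bool) (a : Fin 6 → Fin 6 → Bool), SymB a → qi ent (pull a (cond b gen4 1)) = qi ent a := by
    intro b a h; cases b
    · rfl
    · exact qi_gen4 hi h
  rw [s3 _ _ (((h.pull _).pull _).pull _), s2 _ _ ((h.pull _).pull _), s1 _ _ (h.pull _), s4 _ _ h]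

lemma sum_perm_eq {ent} (hi : InvEnt ent) {a : Fin 6 → Fin 6 → Bool} (h : SymB a) :
    ∑ p : Equiv.Perm (Fin 6), qi ent (pull a p) = 16 * S45 ent a := by
  rw [← Function.Bijective.sum_comp idx5_bij (fun p => qi ent (pull a p))]
  rw [Fintype.sum_prod_type]
  have : ∀ k : Fin 45, ∑ y : Bool × Bool × Bool × Bool, qi ent (pull a (idx5 (k, y))) = 16 * qi ent (pull a (per45 k)) := by
    intro k
    have : ∀ y : Bool × Bool × Bool × Bool, qi ent (pull a (idx5 (k, y))) = qi ent (pull a (per45 k)) := by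
      rintro ⟨b1, b2, b3, b4⟩
      unfold idx5
      rw [pull_mul, qi_gW hi (h.pull _)]
    simp [this]
  simp only [this]
  rw [← Finset.mul_sum]
  congr 1

/-! ### The pointwise inequality -/

def deg6 (a : Fin 6 → Fin 6 → Bool) (i : Fin 6) : ℕ := ∑ j, if j = i then 0 else bn (a i j)
def ed6 (a : Fin 6 → Fin 6 → Bool) : ℕ := ∑ i, deg6 a i
def o6 (a : Fin 6 → Fin 6 → Bool) : ℕ := ∑ i, if ed6 a = 2 * deg6 a i + 6 then 1 else 0

def toMk (a : Fin 6 → Fin 6 → Bool) : Fin 6 → Fin 6 → Bool :=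
  mkA (a 0 1) (a 0 2) (a 0 3) (a 0 4) (a 0 5) (a 1 2) (a 1 3) (a 1 4) (a 1 5) (a 2 3) (a 2 4) (a 2 5) (a 3 4) (a 3 5) (a 4 5)

lemma toMk_sym (a : Fin 6 → Fin 6 → Bool) : SymB (toMk a) := by
  intro i j; fin_cases i <;> fin_cases j <;> rfl

lemma toMk_eq {a : Fin 6 → Fin 6 → Bool} (h : SymB a) : ∀ i j, i ≠ j → a i j = toMk a i j := by
  intro i j hij
  fin_cases i <;> fin_cases j <;> first | (exact absurd rfl hij) | rfl | (exact h _ _)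

lemma qi_congr {ent} {a a' : Fin 6 → Fin 6 → Bool} (h : ∀ i j, i ≠ j → a i j = a' i j) (p : Equiv.Perm (Fin 6)) :
    qi ent (pull a p) = qi ent (pull a' p) := by
  have h' : ∀ i j, i ≠ j → pull a p i j = pull a' p i j := fun i j hij => h _ _ (fun e => hij (p.injective e))
  unfold qi
  rw [h' 0 1 (by decide), h' 0 2 (by decide), h' 1 2 (by decide), h' 0 3 (by decide), h' 1 3 (by decide),
    h' 2 3 (by decide), h' 0 4 (by decide), h' 1 4 (by decide), h' 0 5 (by decide), h' 1 5 (by decide), h' 4 5 (by decide)]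

lemma deg6_congr {a a' : Fin 6 → Fin 6 → Bool} (h : ∀ i j, i ≠ j → a i j = a' i j) : deg6 a = deg6 a' := by
  funext i
  unfold deg6
  apply Finset.sum_congr rfl
  intro j _
  by_cases hj : j = i
  · simp [hj]
  · simp [hj, h i j (Ne.symm hj)]

lemma o6_congr {a a' : Fin 6 → Fin 6 → Bool} (h : ∀ i j, i ≠ j → a i j = a' i j) : o6 a = o6 a' := by
  unfold o6 ed6
  rw [deg6_congr h]

lemma bad_congr {a a' : Fin 6 → Fin 6 → Bool} (h : ∀ i j, i ≠ j → a i j = a' i j) : Bad a ↔ Bad a' := by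
  unfold Bad
  have : ∀ κ : Fin 6 → Fin 3, (∀ i j, i ≠ j → a i j = pat (κ i) (κ j)) ↔ (∀ i j, i ≠ j → a' i j = pat (κ i) (κ j)) := by
    intro κ
    constructor
    · intro H i j hij; rw [← h i j hij]; exact H i j hij
    · intro H i j hij; rw [h i j hij]; exact H i j hij
  simp only [this]

lemma deg6_pull (a : Fin 6 → Fin 6 → Bool) (p : Equiv.Perm (Fin 6)) (i : Fin 6) : deg6 (pull a p) i = deg6 a (p i) := by
  unfold deg6
  rw [← Equiv.sum_comp p (fun j => if j = p i then 0 else bn (a (p i) j))]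
  apply Finset.sum_congr rfl
  intro j _
  simp [pull]

lemma ed6_pull (a : Fin 6 → Fin 6 → Bool) (p : Equiv.Perm (Fin 6)) : ed6 (pull a p) = ed6 a := by
  unfold ed6
  simp only [deg6_pull]
  exact Equiv.sum_comp p (fun i => deg6 a i)

lemma o6_pull (a : Fin 6 → Fin 6 → Bool) (p : Equiv.Perm (Fin 6)) : o6 (pull a p) = o6 a := by
  unfold o6
  simp only [deg6_pull, ed6_pull]
  exact Equiv.sum_comp p (fun i => if ed6 a = 2 * deg6 a i + 6 then 1 else 0)

lemma bad_pull (a : Fin 6 → Fin 6 → Bool) (p : Equiv.Perm (Fin 6)) : Bad (pull a p) ↔ Bad a := by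
  unfold Bad
  apply not_congr
  constructor
  · rintro ⟨κ, h⟩
    refine ⟨fun i => κ (p.symm i), fun i j hij => ?_⟩
    have := h (p.symm i) (p.symm j) (fun e => hij (p.symm.injective e))
    simpa [pull] using this
  · rintro ⟨κ, h⟩
    exact ⟨fun i => κ (p i), fun i j hij => h _ _ (fun e => hij (p.injective e))⟩

lemma sum_pull {ent} (a : Fin 6 → Fin 6 → Bool) (p : Equiv.Perm (Fin 6)) :
    ∑ q : Equiv.Perm (Fin 6), qi ent (pull (pull a p) q) = ∑ q : Equiv.Perm (Fin 6), qi ent (pull a q) := by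
  rw [← Equiv.sum_comp (Equiv.mulLeft p) (fun q => qi ent (pull a q))]
  rfl

lemma exN_spec {f : ℕ → Bool} (h : exN f = true) : ∃ k : Fin 3, f k.val = true := by
  unfold exN at h
  rw [Bool.or_eq_true, Bool.or_eq_true] at h
  rcases h with h | h | h
  · exact ⟨0, h⟩
  · exact ⟨1, h⟩
  · exact ⟨2, h⟩

lemma pat_symm (i j : Fin 3) : pat i j = pat j i := by
  revert i j; decide

lemma hasCol_spec (b01 b02 b03 b04 b05 b12 b13 b14 b15 b23 b24 b25 b34 b35 b45 : Bool)
    (h : hasCol b01 b02 b03 b04 b05 b12 b13 b14 b15 b23 b24 b25 b34 b35 b45 = true) :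
    ¬ Bad (mkA b01 b02 b03 b04 b05 b12 b13 b14 b15 b23 b24 b25 b34 b35 b45) := by
  unfold hasCol at h
  obtain ⟨k0, h⟩ := exN_spec h
  obtain ⟨k1, h⟩ := exN_spec h
  rw [Bool.and_eq_true] at h
  obtain ⟨h01, h⟩ := h
  obtain ⟨k2, h⟩ := exN_spec h
  simp only [Bool.and_eq_true] at h
  obtain ⟨h02, h12, h⟩ := h
  obtain ⟨k3, h⟩ := exN_spec h
  simp only [Bool.and_eq_true] at h
  obtain ⟨h03, h13, h23, h⟩ := h
  obtain ⟨k4, h⟩ := exN_spec h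
  simp only [Bool.and_eq_true] at h
  obtain ⟨h04, h14, h24, h34, h⟩ := h
  obtain ⟨k5, h⟩ := exN_spec h
  simp only [Bool.and_eq_true] at h
  obtain ⟨h05, h15, h25, h35, h45, h⟩ := h
  rw [beq_iff_eq] at h01 h02 h12 h03 h13 h23 h04 h14 h24 h34 h05 h15 h25 h35 h45
  unfold Bad
  rw [not_not]
  refine ⟨![k0, k1, k2, k3, k4, k5], ?_⟩
  have key : ∀ i j : Fin 6, i < j → mkA b01 b02 b03 b04 b05 b12 b13 b14 b15 b23 b24 b25 b34 b35 b45 i j = pat (![k0, k1, k2, k3, k4, k5] i) (![k0, k1, k2, k3, k4, k5] j) := by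
    intro i j hij
    fin_cases i <;> fin_cases j <;> first | (exact absurd hij (by decide)) | assumption
  intro i j hij
  rcases lt_or_gt_of_ne hij with h' | h'
  · exact key i j h'
  · rw [pat_symm]
    rw [← key j i h']
    fin_cases i <;> fin_cases j <;> rfl

lemma deg_mkA (b01 b02 b03 b04 b05 b12 b13 b14 b15 b23 b24 b25 b34 b35 b45 : Bool) :
    deg6 (mkA b01 b02 b03 b04 b05 b12 b13 b14 b15 b23 b24 b25 b34 b35 b45) 0 = dg0 b01 b02 b03 b04 b05 b12 b13 b14 b15 b23 b24 b25 b34 b35 b45 ∧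
    deg6 (mkA b01 b02 b03 b04 b05 b12 b13 b14 b15 b23 b24 b25 b34 b35 b45) 1 = dg1 b01 b02 b03 b04 b05 b12 b13 b14 b15 b23 b24 b25 b34 b35 b45 ∧
    deg6 (mkA b01 b02 b03 b04 b05 b12 b13 b14 b15 b23 b24 b25 b34 b35 b45) 2 = dg2 b01 b02 b03 b04 b05 b12 b13 b14 b15 b23 b24 b25 b34 b35 b45 ∧
    deg6 (mkA b01 b02 b03 b04 b05 b12 b13 b14 b15 b23 b24 b25 b34 b35 b45) 3 = dg3 b01 b02 b03 b04 b05 b12 b13 b14 b15 b23 b24 b25 b34 b35 b45 ∧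
    deg6 (mkA b01 b02 b03 b04 b05 b12 b13 b14 b15 b23 b24 b25 b34 b35 b45) 4 = dg4 b01 b02 b03 b04 b05 b12 b13 b14 b15 b23 b24 b25 b34 b35 b45 ∧
    deg6 (mkA b01 b02 b03 b04 b05 b12 b13 b14 b15 b23 b24 b25 b34 b35 b45) 5 = dg5 b01 b02 b03 b04 b05 b12 b13 b14 b15 b23 b24 b25 b34 b35 b45 := by
  refine ⟨?_, ?_, ?_, ?_, ?_, ?_⟩ <;> unfold deg6 <;> rw [Fin.sum_univ_six] <;>
    simp [mkA, dg0, dg1, dg2, dg3, dg4, dg5]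

lemma ed_mkA (b01 b02 b03 b04 b05 b12 b13 b14 b15 b23 b24 b25 b34 b35 b45 : Bool) :
    ed6 (mkA b01 b02 b03 b04 b05 b12 b13 b14 b15 b23 b24 b25 b34 b35 b45) = 2 * eTot b01 b02 b03 b04 b05 b12 b13 b14 b15 b23 b24 b25 b34 b35 b45 := by
  obtain ⟨h0, h1, h2, h3, h4, h5⟩ := deg_mkA b01 b02 b03 b04 b05 b12 b13 b14 b15 b23 b24 b25 b34 b35 b45
  unfold ed6
  rw [Fin.sum_univ_six, h0, h1, h2, h3, h4, h5]
  unfold dg0 dg1 dg2 dg3 dg4 dg5 eTot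
  ring

lemma o_mkA (b01 b02 b03 b04 b05 b12 b13 b14 b15 b23 b24 b25 b34 b35 b45 : Bool) :
    o6 (mkA b01 b02 b03 b04 b05 b12 b13 b14 b15 b23 b24 b25 b34 b35 b45) = oCnt b01 b02 b03 b04 b05 b12 b13 b14 b15 b23 b24 b25 b34 b35 b45 := by
  obtain ⟨h0, h1, h2, h3, h4, h5⟩ := deg_mkA b01 b02 b03 b04 b05 b12 b13 b14 b15 b23 b24 b25 b34 b35 b45
  unfold o6
  rw [Fin.sum_univ_six, h0, h1, h2, h3, h4, h5, ed_mkA]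
  have key : ∀ e d : ℕ, (if 2 * e = 2 * d + 6 then 1 else 0) = cond (Nat.beq e (d + 3)) 1 0 := by
    intro e d
    by_cases h : e = d + 3
    · subst h
      have : Nat.beq (d + 3) (d + 3) = true := by simp
      rw [this, if_pos (by ring)]; rfl
    · have : Nat.beq e (d + 3) = false := by
        rw [← Bool.not_eq_true]; intro h'; exact h (Nat.eq_of_beq_eq_true h')
      rw [this, if_neg (by omega)]; rfl
  simp only [key]
  rfl

lemma sqrt17_lo : (4.1231056256176605 : ℝ) < √17 := by
  apply Real.lt_sqrt_of_sq_lt; norm_num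
lemma sqrt17_hi : √17 < (4.1231056256176606 : ℝ) := by
  rw [Real.sqrt_lt' (by norm_num)]; norm_num

lemma nonnegZ_spec {a b : ℤ} (h : nonnegZ a b = true) : (0 : ℝ) ≤ a + b * √17 := by
  unfold nonnegZ at h
  rw [Bool.and_eq_true, decide_eq_true_iff, decide_eq_true_iff] at h
  obtain ⟨h1, h2⟩ := h
  have h1' : (0 : ℝ) ≤ a * 10000000000000000 + b * 41231056256176605 := by exact_mod_cast h1
  have h2' : (0 : ℝ) ≤ a * 10000000000000000 + b * 41231056256176606 := by exact_mod_cast h2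
  have l := sqrt17_lo
  have u := sqrt17_hi
  rcases le_total (0 : ℝ) b with hb | hb
  · nlinarith
  · nlinarith

noncomputable def LAM : ℝ := (255 * √17 - 535) / 1024

/-- The real value of the certificate form. -/
noncomputable def qR (a : Fin 6 → Fin 6 → Bool) : ℝ :=
  (((qi entA a : ℕ) : ℝ) - 268435456 + (((qi entB a : ℕ) : ℝ) - 268435456) * √17) / 786432

lemma sum_qR {a : Fin 6 → Fin 6 → Bool} (h : SymB a) : ∑ p : Equiv.Perm (Fin 6), qR (pull a p) =
    16 * (((S45 entA a : ℕ) : ℝ) - 45 * 268435456 + (((S45 entB a : ℕ) : ℝ) - 45 * 268435456) * √17) / 786432 := by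
  unfold qR
  rw [← Finset.sum_div, Finset.sum_add_distrib, ← Finset.sum_mul, Finset.sum_sub_distrib, Finset.sum_sub_distrib]
  rw [← Nat.cast_sum, ← Nat.cast_sum, sum_perm_eq invA h, sum_perm_eq invB h]
  have h720 : Nat.factorial 6 = 720 := rfl
  simp only [Finset.sum_const, Finset.card_univ, Fintype.card_perm, Fintype.card_fin, nsmul_eq_mul, h720]
  push_cast
  ring

lemma pointwise_mkA (b01 b02 b03 b04 b05 b12 b13 b14 b15 b23 b24 b25 b34 b35 b45 : Bool)
    (hs : isSorted b01 b02 b03 b04 b05 b12 b13 b14 b15 b23 b24 b25 b34 b35 b45 = true) :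
    (if Bad (mkA b01 b02 b03 b04 b05 b12 b13 b14 b15 b23 b24 b25 b34 b35 b45) then (90 / 192 : ℝ) else 0) ≤
      90 * LAM - 15 * (o6 (mkA b01 b02 b03 b04 b05 b12 b13 b14 b15 b23 b24 b25 b34 b35 b45) : ℝ) -
      (1 / 8) * ∑ p : Equiv.Perm (Fin 6), qR (pull (mkA b01 b02 b03 b04 b05 b12 b13 b14 b15 b23 b24 b25 b34 b35 b45) p) := by
  have hsym : SymB (mkA b01 b02 b03 b04 b05 b12 b13 b14 b15 b23 b24 b25 b34 b35 b45) := by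
    intro i j; fin_cases i <;> fin_cases j <;> rfl
  rw [sum_qR hsym, S45_mkA, S45_mkA, o_mkA]
  have h := allB_spec (allB_spec (allB_spec (allB_spec (allB_spec (allB_spec (allB_spec (allB_spec (allB_spec
    (allB_spec (allB_spec (allB_spec (allB_spec (allB_spec (allB_spec chk15_true b01) b02) b03) b04) b05) b12) b13) b14) b15) b23) b24) b25) b34) b35) b45
  rw [hs] at h
  simp only [cond_true] at h
  unfold finTest at h
  rw [Bool.or_eq_true] at h
  generalize sum45 entA b01 b02 b03 b04 b05 b12 b13 b14 b15 b23 b24 b25 b34 b35 b45 = sA at h ⊢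
  generalize sum45 entB b01 b02 b03 b04 b05 b12 b13 b14 b15 b23 b24 b25 b34 b35 b45 = sB at h ⊢
  generalize oCnt b01 b02 b03 b04 b05 b12 b13 b14 b15 b23 b24 b25 b34 b35 b45 = o at h ⊢
  rcases h with h | h
  · rw [Bool.and_eq_true, Bool.and_eq_true] at h
    obtain ⟨⟨h1, h2⟩, h3⟩ := h
    rw [if_neg (hasCol_spec _ _ _ _ _ _ _ _ _ _ _ _ _ _ _ h3)]
    have e1 := Nat.eq_of_beq_eq_true h1
    have e2 := Nat.eq_of_beq_eq_true h2
    have e1' : (2 * sA + 11796480 * o : ℝ) = 24159191040 - 36979200 := by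
      have : 2 * sA + 11796480 * o + 36979200 = 24159191040 := by omega
      have : (2 * sA + 11796480 * o + 36979200 : ℝ) = 24159191040 := by exact_mod_cast this
      linarith
    have e2' : (2 * sB : ℝ) = 24159191040 + 17625600 := by exact_mod_cast e2
    unfold LAM
    have : (sA : ℝ) = (24159191040 - 36979200 - 11796480 * o) / 2 := by linarith
    rw [this]
    have : (sB : ℝ) = (24159191040 + 17625600) / 2 := by linarith
    rw [this]
    apply le_of_eq
    ring
  · have h' := nonnegZ_spec h
    push_cast at h'
    have : (if Bad (mkA b01 b02 b03 b04 b05 b12 b13 b14 b15 b23 b24 b25 b34 b35 b45) then (90 / 192 : ℝ) else 0) ≤ 90 / 192 := by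
      split_ifs <;> norm_num
    refine this.trans ?_
    unfold LAM
    have e : 90 * ((255 * √17 - 535) / 1024) - 15 * (o : ℝ) - 1 / 8 * (16 * ((sA : ℝ) - 45 * 268435456 + ((sB : ℝ) - 45 * 268435456) * √17) / 786432) - 90 / 192
      = ((24159191040 - 36979200 - 368640 - 2 * sA - 11796480 * o) + (24159191040 + 17625600 - 2 * sB) * √17) / 786432 := by ring
    have := div_nonneg h' (by norm_num : (0 : ℝ) ≤ 786432)
    linarith

theorem pointwise {a : Fin 6 → Fin 6 → Bool} (hs : SymB a) :
    (if Bad a then (90 / 192 : ℝ) else 0) ≤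
      90 * LAM - 15 * (o6 a : ℝ) - (1 / 8) * ∑ p : Equiv.Perm (Fin 6), qR (pull a p) := by
  obtain ⟨p, hp⟩ : ∃ p : Equiv.Perm (Fin 6), Monotone (deg6 a ∘ p) := ⟨Tuple.sort (deg6 a), Tuple.monotone_sort _⟩
  set a2 := pull a p with ha2
  have e1 : Bad a ↔ Bad (toMk a2) := (bad_pull a p).symm.trans (bad_congr (toMk_eq (hs.pull p)))
  have e2 : o6 a = o6 (toMk a2) := (o6_pull a p).symm.trans (o6_congr (toMk_eq (hs.pull p)))
  have e3 : ∑ q : Equiv.Perm (Fin 6), qR (pull a q) = ∑ q : Equiv.Perm (Fin 6), qR (pull (toMk a2) q) := by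
    rw [← Equiv.sum_comp (Equiv.mulLeft p) (fun q => qR (pull a q))]
    apply Finset.sum_congr rfl
    intro q _
    have : pull a (Equiv.mulLeft p q) = pull a2 q := rfl
    rw [this]
    unfold qR
    rw [qi_congr (toMk_eq (hs.pull p)) q, qi_congr (toMk_eq (hs.pull p)) q]
  rw [e2, e3]
  simp only [e1]
  unfold toMk
  apply pointwise_mkA
  have hd : ∀ i, deg6 (toMk a2) i = deg6 a (p i) := by
    intro i
    rw [← deg6_congr (toMk_eq (hs.pull p)), deg6_pull]
  obtain ⟨h0, h1, h2, h3, h4, h5⟩ := deg_mkA (a2 0 1) (a2 0 2) (a2 0 3) (a2 0 4) (a2 0 5) (a2 1 2) (a2 1 3) (a2 1 4) (a2 1 5) (a2 2 3) (a2 2 4) (a2 2 5) (a2 3 4) (a2 3 5) (a2 4 5)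
  unfold isSorted
  rw [← h0, ← h1, ← h2, ← h3, ← h4, ← h5]
  have hm : ∀ i j : Fin 6, i ≤ j → deg6 (toMk a2) i ≤ deg6 (toMk a2) j := by
    intro i j hij
    rw [hd, hd]; exact hp hij
  unfold toMk at hm
  simp only [Bool.and_eq_true, and_true]
  exact ⟨Nat.ble_eq_true_of_le (hm 0 1 (by decide)), Nat.ble_eq_true_of_le (hm 1 2 (by decide)),
    Nat.ble_eq_true_of_le (hm 2 3 (by decide)), Nat.ble_eq_true_of_le (hm 3 4 (by decide)),
    Nat.ble_eq_true_of_le (hm 4 5 (by decide))⟩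

/-! ### The integrated inequality -/

def e5 (a : Fin 5 → Fin 5 → Bool) : ℕ := ∑ i, ∑ j, if i < j then bn (a i j) else 0

def Tri (a : Fin 5 → Fin 5 → Bool) : Prop := e5 a = 3

/-- restriction to a tuple -/
def onT {V : Type*} {k : ℕ} (A : V → V → Bool) (x : Fin k → V) : Fin k → Fin k → Bool := fun i j => A (x i) (x j)

lemma tup_sum_cons {V : Type*} [Fintype V] {M : Type*} [AddCommMonoid M] {n : ℕ} (F : (Fin (n + 1) → V) → M) :
    ∑ x, F x = ∑ a : V, ∑ y : Fin n → V, F (Fin.cons a y) := by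
  rw [← Equiv.sum_comp (Fin.consEquiv (fun _ => V)) F, Fintype.sum_prod_type]
  rfl

lemma sum_zero_tuple {V : Type*} [Fintype V] {M : Type*} [AddCommMonoid M] (F : (Fin 0 → V) → M) :
    ∑ x, F x = F (fun i => i.elim0) := by
  rw [Fintype.sum_eq_single (fun i => i.elim0)]
  intro x hx
  exact absurd (funext fun i => i.elim0) hx

lemma sum6 {V : Type*} [Fintype V] (F : V → V → V → V → V → V → ℝ) :
    ∑ x : Fin 6 → V, F (x 0) (x 1) (x 2) (x 3) (x 4) (x 5) = ∑ a, ∑ b, ∑ c, ∑ d, ∑ e, ∑ f, F a b c d e f := by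
  simp only [tup_sum_cons, sum_zero_tuple]
  rfl

noncomputable def cR (s : (ℤ × ℤ) × ℕ × ℕ) : ℝ := s.1.1 + s.1.2 * √17
noncomputable def wR (s : (ℤ × ℤ) × ℕ × ℕ) (f : ℕ) : ℝ := vget s.2.1 f + vget s.2.2 f * √17

lemma vz_spec {m n f : ℕ} (h : vz m n f = true) : vget m f = 0 ∧ vget n f = 0 := by
  unfold vz at h
  rw [Bool.and_eq_true] at h
  have h1 := Nat.eq_of_beq_eq_true h.1
  have h2 := Nat.eq_of_beq_eq_true h.2
  unfold vget
  rw [h1, h2]; norm_num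

lemma sq17 : √17 * √17 = (17 : ℝ) := Real.mul_self_sqrt (by norm_num)

lemma sos_spec (f g : ℕ) (l : List ((ℤ × ℤ) × ℕ × ℕ)) :
    (sosA f g l : ℝ) + sosB f g l * √17 = (l.map (fun s => cR s * (wR s f * wR s g))).sum := by
  induction l with
  | nil => simp [sosA, sosB]
  | cons s l ih =>
    obtain ⟨⟨c, d⟩, m, n⟩ := s
    rw [List.map_cons, List.sum_cons, ← ih]
    have eA : sosA f g (((c, d), m, n) :: l) = cond (or (vz m n f) (vz m n g))
      (sosA f g l) (mulA c d (vget m f) (vget n f) (vget m g) (vget n g) + sosA f g l) := rfl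
    have eB : sosB f g (((c, d), m, n) :: l) = cond (or (vz m n f) (vz m n g))
      (sosB f g l) (mulB c d (vget m f) (vget n f) (vget m g) (vget n g) + sosB f g l) := rfl
    rw [eA, eB]
    cases h : (vz m n f || vz m n g)
    · simp only [cond_false, mulA, mulB, cR, wR]
      push_cast
      have := sq17
      linear_combination ( -(c : ℝ) * vget n f * vget n g - (d : ℝ) * (vget m f * vget n g + vget n f * vget m g) - (d : ℝ) * vget n f * vget n g * √17 ) * this
    · simp only [cond_true, cR, wR]
      rw [Bool.or_eq_true] at h
      rcases h with h | h
      · obtain ⟨h1, h2⟩ := vz_spec h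
        simp [h1, h2]
      · obtain ⟨h1, h2⟩ := vz_spec h
        simp [h1, h2]

lemma ent_spec (t : Bool) (f g : ℕ) (hf : f < 20) (hg : g < 20) :
    ((entA t f g : ℝ) - 268435456 + ((entB t f g : ℝ) - 268435456) * √17) =
      ((sqsT t).map (fun s => cR s * (wR s f * wR s g))).sum / 262144 := by
  have key : ∀ f g : ℕ, f ≤ g → g < 20 → ((entA t f g : ℝ) - 268435456 + ((entB t f g : ℝ) - 268435456) * √17) =
      ((sqsT t).map (fun s => cR s * (wR s f * wR s g))).sum / 262144 := by
    intro f g hfg hg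
    have h := allN_spec (allN_spec (allB_spec chkSos_true t) g hg) f (by omega)
    rw [Bool.and_eq_true, decide_eq_true_iff, decide_eq_true_iff] at h
    rw [← sos_spec, h.1, h.2]
    push_cast
    ring
  rcases le_total f g with h | h
  · exact key f g h hg
  · have hs := allN_spec (allN_spec (allB_spec chkSym_true t) g hg) f hf
    rw [Bool.and_eq_true] at hs
    rw [Nat.eq_of_beq_eq_true hs.1, Nat.eq_of_beq_eq_true hs.2, key g f h hf]
    congr 3
    funext s
    ring

lemma fl_lt : ∀ u2 v2 u3 v3 e : Bool, fl u2 v2 u3 v3 e < 20 := by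
  decide +kernel

lemma cR_nonneg (t : Bool) : ∀ s ∈ sqsT t, 0 ≤ cR s := by
  intro s hs
  have h := allB_spec sqs_nonneg t
  rw [List.all_eq_true] at h
  exact nonnegZ_spec (h s hs)

lemma list_sum_swap {V : Type*} [Fintype V] {α : Type*} (l : List α) (F : α → V → ℝ) :
    ∑ v, (l.map (fun s => F s v)).sum = (l.map (fun s => ∑ v, F s v)).sum := by
  induction l with
  | nil => simp
  | cons s l ih => simp [Finset.sum_add_distrib, ih]

lemma psd {V : Type*} [Fintype V] (A : V → V → Bool) (ω : V → ℝ) (hω : ∀ v, 0 ≤ ω v) :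
    0 ≤ ∑ x : Fin 6 → V, (∏ i, ω (x i)) * qR (onT A x) := by
  have e : ∀ x : Fin 6 → V, (∏ i, ω (x i)) * qR (onT A x) =
      (fun a b c d e f => (ω a * ω b) * ((ω c * ω d) * (ω e * ω f) *
        (((sqsT (A a b)).map (fun s => cR s * (wR s (fl (A a c) (A b c) (A a d) (A b d) (A c d)) *
          wR s (fl (A a e) (A b e) (A a f) (A b f) (A e f))))).sum / 262144 / 786432)))
        (x 0) (x 1) (x 2) (x 3) (x 4) (x 5) := by
    intro x
    rw [Fin.prod_univ_six]
    unfold qR qi onT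
    rw [ent_spec _ _ _ (fl_lt _ _ _ _ _) (fl_lt _ _ _ _ _)]
    ring
  simp only [e]
  rw [sum6 (fun a b c d e f => (ω a * ω b) * ((ω c * ω d) * (ω e * ω f) *
        (((sqsT (A a b)).map (fun s => cR s * (wR s (fl (A a c) (A b c) (A a d) (A b d) (A c d)) *
          wR s (fl (A a e) (A b e) (A a f) (A b f) (A e f))))).sum / 262144 / 786432)))]
  apply Finset.sum_nonneg; intro a _
  apply Finset.sum_nonneg; intro b _
  have e2 : ∑ c, ∑ d, ∑ e, ∑ f, (ω a * ω b) * ((ω c * ω d) * (ω e * ω f) *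
        (((sqsT (A a b)).map (fun s => cR s * (wR s (fl (A a c) (A b c) (A a d) (A b d) (A c d)) *
          wR s (fl (A a e) (A b e) (A a f) (A b f) (A e f))))).sum / 262144 / 786432)) =
      (ω a * ω b) * ((sqsT (A a b)).map (fun s => cR s *
        (∑ c, ∑ d, ω c * ω d * wR s (fl (A a c) (A b c) (A a d) (A b d) (A c d))) ^ 2)).sum / 262144 / 786432 := by
    have : ∀ s, cR s * (∑ c, ∑ d, ω c * ω d * wR s (fl (A a c) (A b c) (A a d) (A b d) (A c d))) ^ 2 =
        ∑ c, ∑ d, ∑ e, ∑ f, (ω c * ω d) * (ω e * ω f) * (cR s * (wR s (fl (A a c) (A b c) (A a d) (A b d) (A c d)) *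
          wR s (fl (A a e) (A b e) (A a f) (A b f) (A e f)))) := by
      intro s
      rw [sq, Finset.sum_mul, Finset.mul_sum]
      refine Finset.sum_congr rfl fun c _ => ?_
      rw [Finset.sum_mul, Finset.mul_sum]
      refine Finset.sum_congr rfl fun d _ => ?_
      rw [Finset.mul_sum, Finset.mul_sum]
      refine Finset.sum_congr rfl fun e _ => ?_
      rw [Finset.mul_sum, Finset.mul_sum]
      refine Finset.sum_congr rfl fun f _ => ?_
      ring
    simp only [this]
    rw [← list_sum_swap]
    simp only [← list_sum_swap]
    rw [Finset.mul_sum, Finset.sum_div, Finset.sum_div]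
    refine Finset.sum_congr rfl fun c _ => ?_
    rw [Finset.mul_sum, Finset.sum_div, Finset.sum_div]
    refine Finset.sum_congr rfl fun d _ => ?_
    rw [Finset.mul_sum, Finset.sum_div, Finset.sum_div]
    refine Finset.sum_congr rfl fun e _ => ?_
    rw [Finset.mul_sum, Finset.sum_div, Finset.sum_div]
    refine Finset.sum_congr rfl fun f _ => ?_
    rw [List.sum_map_mul_left]
    ring
  rw [e2]
  apply div_nonneg _ (by norm_num)
  apply div_nonneg _ (by norm_num)
  apply mul_nonneg (mul_nonneg (hω a) (hω b))
  apply List.sum_nonneg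
  intro r hr
  rw [List.mem_map] at hr
  obtain ⟨s, hs, rfl⟩ := hr
  exact mul_nonneg (cR_nonneg _ s hs) (sq_nonneg _)

lemma reindex {V : Type*} [Fintype V] (ω : V → ℝ) (A : V → V → Bool) (G : (Fin 6 → Fin 6 → Bool) → ℝ) (p : Equiv.Perm (Fin 6)) :
    ∑ x : Fin 6 → V, (∏ i, ω (x i)) * G (pull (onT A x) p) = ∑ x : Fin 6 → V, (∏ i, ω (x i)) * G (onT A x) := by
  rw [← Equiv.sum_comp (Equiv.arrowCongr p.symm (Equiv.refl V)) (fun x : Fin 6 → V => (∏ i, ω (x i)) * G (onT A x))]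
  refine Finset.sum_congr rfl fun x _ => ?_
  congr 1
  exact (Equiv.prod_comp p (fun i => ω (x i))).symm

lemma tri_iff {a : Fin 6 → Fin 6 → Bool} (hs : SymB a) :
    ed6 a = 2 * deg6 a 5 + 6 ↔ Tri (fun i j => a i.castSucc j.castSucc) := by
  rw [deg6_congr (toMk_eq hs) |> congrFun <| 5]
  have h1 : ed6 a = ed6 (toMk a) := by unfold ed6; rw [deg6_congr (toMk_eq hs)]
  rw [h1]
  unfold toMk
  rw [ed_mkA, (deg_mkA _ _ _ _ _ _ _ _ _ _ _ _ _ _ _).2.2.2.2.2]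
  have : e5 (fun i j => a i.castSucc j.castSucc) = bn (a 0 1) + bn (a 0 2) + bn (a 0 3) + bn (a 0 4) + bn (a 1 2) +
      bn (a 1 3) + bn (a 1 4) + bn (a 2 3) + bn (a 2 4) + bn (a 3 4) := by
    unfold e5
    simp only [Fin.sum_univ_five]
    simp
    ring
  unfold Tri
  rw [this]
  unfold eTot dg5
  omega

noncomputable def ind (P : Prop) : ℝ := if P then 1 else 0

lemma ind_nonneg (P : Prop) : 0 ≤ ind P := by unfold ind; split_ifs <;> norm_num
lemma ind_le_one (P : Prop) : ind P ≤ 1 := by unfold ind; split_ifs <;> norm_num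

/-- first five entries of a six-tuple -/
def five {V : Type*} (x : Fin 6 → V) : Fin 5 → V := fun i => x i.castSucc

theorem certificate {V : Type*} [Fintype V] (A : V → V → Bool) (hA : ∀ u v, A u v = A v u) (ω : V → ℝ) (hω : ∀ v, 0 ≤ ω v) :
    0 ≤ ∑ x : Fin 6 → V, (∏ i, ω (x i)) * (LAM - ind (Tri (onT A (five x))) - (1 / 192) * ind (Bad (onT A x))) := by
  have hsym : ∀ x : Fin 6 → V, SymB (onT A x) := fun x i j => hA _ _
  have h1 : 0 ≤ ∑ x : Fin 6 → V, (∏ i, ω (x i)) * (90 * LAM - 15 * (o6 (onT A x) : ℝ)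
      - (1 / 8) * ∑ p : Equiv.Perm (Fin 6), qR (pull (onT A x) p) - 90 / 192 * ind (Bad (onT A x))) := by
    apply Finset.sum_nonneg
    intro x _
    apply mul_nonneg (Finset.prod_nonneg fun i _ => hω _)
    have := pointwise (hsym x)
    have e : (90 / 192 : ℝ) * ind (Bad (onT A x)) = if Bad (onT A x) then (90 / 192 : ℝ) else 0 := by
      unfold ind; split_ifs <;> simp
    rw [e]; linarith
  have h2 : ∑ x : Fin 6 → V, (∏ i, ω (x i)) * ∑ p : Equiv.Perm (Fin 6), qR (pull (onT A x) p) =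
      720 * ∑ x : Fin 6 → V, (∏ i, ω (x i)) * qR (onT A x) := by
    simp only [Finset.mul_sum]
    rw [Finset.sum_comm]
    simp only [reindex ω A qR]
    rw [Finset.sum_const, Finset.card_univ, Fintype.card_perm, Fintype.card_fin, nsmul_eq_mul, Finset.mul_sum]
    norm_num [Nat.factorial]
  have h3 : ∑ x : Fin 6 → V, (∏ i, ω (x i)) * (o6 (onT A x) : ℝ) =
      6 * ∑ x : Fin 6 → V, (∏ i, ω (x i)) * ind (Tri (onT A (five x))) := by
    have : ∀ x : Fin 6 → V, (o6 (onT A x) : ℝ) = ∑ i : Fin 6,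
        (fun b : Fin 6 → Fin 6 → Bool => ind (ed6 b = 2 * deg6 b 5 + 6)) (pull (onT A x) (Equiv.swap i 5)) := by
      intro x
      unfold o6
      rw [Nat.cast_sum]
      refine Finset.sum_congr rfl fun i _ => ?_
      simp only [ed6_pull, deg6_pull, Equiv.swap_apply_right]
      unfold ind
      split_ifs <;> simp
    simp only [this, Finset.mul_sum]
    rw [Finset.sum_comm]
    simp only [reindex ω A (fun b : Fin 6 → Fin 6 → Bool => ind (ed6 b = 2 * deg6 b 5 + 6))]
    rw [Finset.sum_const, Finset.card_univ, Fintype.card_fin, nsmul_eq_mul, Finset.mul_sum]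
    push_cast
    refine Finset.sum_congr rfl fun x _ => ?_
    rw [propext (tri_iff (hsym x))]
    rfl
  have h4 := psd A ω hω
  have e : ∑ x : Fin 6 → V, (∏ i, ω (x i)) * (90 * LAM - 15 * (o6 (onT A x) : ℝ)
      - (1 / 8) * ∑ p : Equiv.Perm (Fin 6), qR (pull (onT A x) p) - 90 / 192 * ind (Bad (onT A x))) =
      90 * (∑ x : Fin 6 → V, (∏ i, ω (x i)) * (LAM - (1 / 192) * ind (Bad (onT A x)))) -
      15 * (∑ x : Fin 6 → V, (∏ i, ω (x i)) * (o6 (onT A x) : ℝ)) -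
      (1 / 8) * ∑ x : Fin 6 → V, (∏ i, ω (x i)) * ∑ p : Equiv.Perm (Fin 6), qR (pull (onT A x) p) := by
    rw [Finset.mul_sum, Finset.mul_sum, Finset.mul_sum, ← Finset.sum_sub_distrib, ← Finset.sum_sub_distrib]
    refine Finset.sum_congr rfl fun x _ => ?_
    ring
  rw [e, h2, h3] at h1
  have e' : ∑ x : Fin 6 → V, (∏ i, ω (x i)) * (LAM - ind (Tri (onT A (five x))) - (1 / 192) * ind (Bad (onT A x))) =
      ∑ x : Fin 6 → V, (∏ i, ω (x i)) * (LAM - (1 / 192) * ind (Bad (onT A x))) -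
      ∑ x : Fin 6 → V, (∏ i, ω (x i)) * ind (Tri (onT A (five x))) := by
    rw [← Finset.sum_sub_distrib]
    refine Finset.sum_congr rfl fun x _ => ?_
    ring
  rw [e']
  linarith

/-! ### Consequences of the certificate -/

section cons
variable {V : Type*} [Fintype V]

noncomputable def T5 (A : V → V → Bool) : ℝ := ∑ y : Fin 5 → V, ind (Tri (onT A y))

noncomputable def Dv (A : V → V → Bool) (v : V) : ℝ :=
  ∑ y : Fin 5 → V, ind (Tri (onT A y)) * ∑ i, ind (y i = v)

noncomputable def badv (A : V → V → Bool) (v : V) : ℝ :=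
  ∑ x : Fin 6 → V, ind (x 4 = v) * ind (Bad (onT A x))

/-- number of vertices as a real number -/
noncomputable def NN (V : Type*) [Fintype V] : ℝ := (Fintype.card V : ℝ)

lemma NN_nonneg : 0 ≤ NN V := by unfold NN; positivity

lemma sum_one_V : ∑ _v : V, (1 : ℝ) = NN V := by simp [NN]

lemma sum_snoc {n : ℕ} (F : (Fin n → V) → ℝ) (g : V → ℝ) :
    ∑ x : Fin (n + 1) → V, F (fun i => x i.castSucc) * g (x (Fin.last n)) = (∑ y, F y) * ∑ a, g a := by
  rw [← Equiv.sum_comp (Fin.snocEquiv (fun _ => V)), Fintype.sum_prod_type, Finset.sum_comm, Finset.sum_mul]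
  refine Finset.sum_congr rfl fun y _ => ?_
  rw [Finset.mul_sum]
  refine Finset.sum_congr rfl fun a _ => ?_
  simp [Fin.snocEquiv]

lemma sum_prod_pow (n : ℕ) (g : V → ℝ) : ∑ x : Fin n → V, ∏ i, g (x i) = (∑ v, g v) ^ n := by
  rw [Finset.sum_pow']
  simp

lemma prod_ge {n : ℕ} (r : Fin n → ℝ) (hr : ∀ i, 0 ≤ r i) : 1 + ∑ i, r i ≤ ∏ i, (1 + r i) := by
  induction n with
  | zero => simp
  | succ n ih =>
    rw [Fin.sum_univ_succ, Fin.prod_univ_succ]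
    have h := ih (fun i => r i.succ) (fun i => hr _)
    have h1 : 0 ≤ ∑ i : Fin n, r i.succ := Finset.sum_nonneg fun i _ => hr _
    nlinarith [hr 0, mul_le_mul_of_nonneg_left h (hr 0), mul_nonneg (hr 0) h1]

theorem vertex_raw (A : V → V → Bool) (hA : ∀ u v, A u v = A v u) (v : V) (t : ℝ) (ht : 0 ≤ t) :
    (NN V + t) * (T5 A + t * Dv A v) + (1 / 192) * (t * badv A v) ≤ LAM * (NN V + t) ^ 6 := by
  set ω : V → ℝ := fun u => 1 + t * ind (u = v) with hω
  have hω0 : ∀ u, 0 ≤ t * ind (u = v) := fun u => mul_nonneg ht (ind_nonneg _)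
  have hω1 : ∀ u, 0 ≤ ω u := fun u => by simp only [hω]; linarith [hω0 u]
  have hs : ∑ u, ω u = NN V + t := by
    simp only [hω, Finset.sum_add_distrib, sum_one_V, ← Finset.mul_sum]
    congr 1
    simp [ind]
  have h := certificate A hA ω hω1
  have e : ∑ x : Fin 6 → V, (∏ i, ω (x i)) * (LAM - ind (Tri (onT A (five x))) - (1 / 192) * ind (Bad (onT A x))) =
      LAM * (∑ x : Fin 6 → V, ∏ i, ω (x i)) - ∑ x : Fin 6 → V, (∏ i, ω (x i)) * ind (Tri (onT A (five x))) -
      (1 / 192) * ∑ x : Fin 6 → V, (∏ i, ω (x i)) * ind (Bad (onT A x)) := by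
    rw [Finset.mul_sum, Finset.mul_sum, ← Finset.sum_sub_distrib, ← Finset.sum_sub_distrib]
    refine Finset.sum_congr rfl fun x _ => ?_
    ring
  rw [e, sum_prod_pow, hs] at h
  have h2 : (NN V + t) * (T5 A + t * Dv A v) ≤ ∑ x : Fin 6 → V, (∏ i, ω (x i)) * ind (Tri (onT A (five x))) := by
    have e2 : ∀ x : Fin 6 → V, (∏ i, ω (x i)) * ind (Tri (onT A (five x))) =
        ((fun y : Fin 5 → V => (∏ i, ω (y i)) * ind (Tri (onT A y))) (fun i => x i.castSucc)) * ω (x (Fin.last 5)) := by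
      intro x
      have h5 : five x = fun i => x i.castSucc := rfl
      rw [Fin.prod_univ_castSucc, h5]
      show _ = (_ * _) * _
      generalize ind _ = q
      ring
    simp only [e2]
    rw [sum_snoc (fun y : Fin 5 → V => (∏ i, ω (y i)) * ind (Tri (onT A y))) ω, hs, mul_comm]
    apply mul_le_mul_of_nonneg_right _ (by have := NN_nonneg (V := V); linarith)
    unfold T5 Dv
    rw [Finset.mul_sum, ← Finset.sum_add_distrib]
    apply Finset.sum_le_sum
    intro y _
    have := prod_ge (fun i => t * ind (y i = v)) (fun i => hω0 _)
    rw [← Finset.mul_sum] at this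
    have := mul_le_mul_of_nonneg_right this (ind_nonneg (Tri (onT A y)))
    calc _ = (1 + t * ∑ i, ind (y i = v)) * ind (Tri (onT A y)) := by ring
      _ ≤ _ := this
  have h3 : t * badv A v ≤ ∑ x : Fin 6 → V, (∏ i, ω (x i)) * ind (Bad (onT A x)) := by
    unfold badv
    rw [Finset.mul_sum]
    apply Finset.sum_le_sum
    intro x _
    rw [← mul_assoc]
    apply mul_le_mul_of_nonneg_right _ (ind_nonneg _)
    have := prod_ge (fun i => t * ind (x i = v)) (fun i => hω0 _)
    have h4 : t * ind (x 4 = v) ≤ ∑ i, t * ind (x i = v) :=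
      Finset.single_le_sum (f := fun i => t * ind (x i = v)) (fun i _ => hω0 _) (Finset.mem_univ 4)
    simp only [hω]
    linarith
  linarith

lemma LAM_lo : 0.504 ≤ LAM := by
  unfold LAM; have := sqrt17_lo; linarith
lemma LAM_hi : LAM ≤ 0.505 := by
  unfold LAM; have := sqrt17_hi; linarith

lemma T5_nonneg (A : V → V → Bool) : 0 ≤ T5 A := Finset.sum_nonneg fun _ _ => ind_nonneg _
lemma Dv_nonneg (A : V → V → Bool) (v : V) : 0 ≤ Dv A v :=
  Finset.sum_nonneg fun _ _ => mul_nonneg (ind_nonneg _) (Finset.sum_nonneg fun _ _ => ind_nonneg _)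
lemma badv_nonneg (A : V → V → Bool) (v : V) : 0 ≤ badv A v :=
  Finset.sum_nonneg fun _ _ => mul_nonneg (ind_nonneg _) (ind_nonneg _)

theorem T5_le (A : V → V → Bool) (hA : ∀ u v, A u v = A v u) : T5 A ≤ LAM * NN V ^ 5 := by
  rcases isEmpty_or_nonempty V with hV | ⟨⟨v⟩⟩
  · have : T5 A = 0 := by
      unfold T5
      apply Finset.sum_eq_zero
      intro y _
      exact (hV.false (y 0)).elim
    rw [this]
    have := LAM_lo
    have := NN_nonneg (V := V)
    positivity
  · have h := vertex_raw A hA v 0 le_rfl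
    have hN : 0 < NN V := by unfold NN; exact_mod_cast Fintype.card_pos_iff.mpr ⟨v⟩
    simp only [add_zero, zero_mul, mul_zero] at h
    have : NN V * T5 A ≤ NN V * (LAM * NN V ^ 5) := by linarith [h, (by ring : NN V * (LAM * NN V ^ 5) = LAM * NN V ^ 6)]
    exact le_of_mul_le_mul_left this hN

theorem vertex_bound (A : V → V → Bool) (hA : ∀ u v, A u v = A v u) (v : V) (θ : ℝ) (h0 : 0 < θ) (h1 : θ ≤ 1)
    (hT : (LAM - θ ^ 2) * NN V ^ 5 ≤ T5 A) :
    NN V * Dv A v + badv A v / 384 ≤ (5 * LAM + 27 * θ) * NN V ^ 5 := by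
  have hN : 0 < NN V := by unfold NN; exact_mod_cast Fintype.card_pos_iff.mpr ⟨v⟩
  have h := vertex_raw A hA v (θ * NN V) (by positivity)
  set N := NN V
  have hb := badv_nonneg A v
  have hd := Dv_nonneg A v
  have e1 : N * (1 + θ) * (T5 A + θ * N * Dv A v) + N * ((1 + θ) * (θ * badv A v / 384)) ≤ N * (1 + θ) * (LAM * (1 + θ) ^ 5 * N ^ 5) := by
    have : N * ((1 + θ) * (θ * badv A v / 384)) ≤ N * (2 * (θ * badv A v / 384)) := by
      have : 0 ≤ θ * badv A v / 384 := by positivity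
      gcongr; linarith
    calc _ ≤ N * (1 + θ) * (T5 A + θ * N * Dv A v) + N * (2 * (θ * badv A v / 384)) := by linarith
      _ = (N + θ * N) * (T5 A + θ * N * Dv A v) + 1 / 192 * (θ * N * badv A v) := by ring
      _ ≤ _ := h
      _ = _ := by ring
  have e2 : T5 A + θ * N * Dv A v + θ * badv A v / 384 ≤ LAM * (1 + θ) ^ 5 * N ^ 5 := by
    have : N * (1 + θ) * (T5 A + θ * N * Dv A v + θ * badv A v / 384) ≤ N * (1 + θ) * (LAM * (1 + θ) ^ 5 * N ^ 5) := by
      linarith [e1]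
    exact le_of_mul_le_mul_left this (by positivity)
  have e3 : (1 + θ) ^ 5 ≤ 1 + 5 * θ + 26 * θ ^ 2 := by
    nlinarith [pow_pos h0 2, pow_pos h0 3, pow_pos h0 4, mul_le_mul_of_nonneg_left h1 (pow_pos h0 2).le,
      mul_le_mul_of_nonneg_left h1 (pow_pos h0 3).le, mul_le_mul_of_nonneg_left h1 (pow_pos h0 4).le]
  have e4 : LAM * (1 + θ) ^ 5 * N ^ 5 ≤ LAM * N ^ 5 + (5 * LAM * θ + 26 * θ ^ 2) * N ^ 5 := by
    have l1 := LAM_lo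
    have l2 := LAM_hi
    have : LAM * (1 + θ) ^ 5 ≤ LAM + (5 * LAM * θ + 26 * θ ^ 2) := by
      nlinarith [pow_pos h0 2]
    calc _ ≤ (LAM + (5 * LAM * θ + 26 * θ ^ 2)) * N ^ 5 := by gcongr
      _ = _ := by ring
  have e5 : θ * (N * Dv A v + badv A v / 384) ≤ θ * ((5 * LAM + 27 * θ) * N ^ 5) := by
    nlinarith
  exact le_of_mul_le_mul_left e5 h0

end cons

/-! ### Tuples: marginals, injectivity, counting -/

section tuples
variable {V : Type*} [Fintype V]

lemma ind_true {P : Prop} (h : P) : ind P = 1 := by simp [ind, h]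
lemma ind_false {P : Prop} (h : ¬ P) : ind P = 0 := by simp [ind, h]
lemma ind_mono {P Q : Prop} (h : P → Q) : ind P ≤ ind Q := by
  by_cases hp : P
  · rw [ind_true hp, ind_true (h hp)]
  · rw [ind_false hp]; exact ind_nonneg _
lemma ind_congr {P Q : Prop} (h : P ↔ Q) : ind P = ind Q := by rw [propext h]

lemma exists_perm01 {m : ℕ} (i j : Fin (m + 2)) (hij : i ≠ j) :
    ∃ p : Equiv.Perm (Fin (m + 2)), p 0 = i ∧ p 1 = j := by
  refine ⟨Equiv.swap 0 i * Equiv.swap 1 (Equiv.swap 0 i j), ?_, ?_⟩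
  · have h1 : (0 : Fin (m + 2)) ≠ Equiv.swap 0 i j := by
      intro h
      apply hij
      have := congrArg (Equiv.swap 0 i) h
      simpa using this
    simp only [Equiv.Perm.mul_apply]
    rw [Equiv.swap_apply_of_ne_of_ne (by simp) h1]
    simp
  · simp

lemma sum_reperm {n : ℕ} (p : Equiv.Perm (Fin n)) (F : (Fin n → V) → ℝ) :
    ∑ y : Fin n → V, F (fun i => y (p i)) = ∑ y, F y :=
  Equiv.sum_comp (Equiv.arrowCongr p.symm (Equiv.refl V)) F

lemma marg2 {m : ℕ} (i j : Fin (m + 2)) (hij : i ≠ j) (g : V → V → ℝ) :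
    ∑ y : Fin (m + 2) → V, g (y i) (y j) = NN V ^ m * ∑ a, ∑ b, g a b := by
  obtain ⟨p, h0, h1⟩ := exists_perm01 i j hij
  have := sum_reperm (V := V) p (fun y => g (y 0) (y 1))
  simp only [h0, h1] at this
  rw [this]
  simp only [tup_sum_cons, Finset.mul_sum]
  refine Finset.sum_congr rfl fun a _ => Finset.sum_congr rfl fun b _ => ?_
  have : ∀ y : Fin m → V, g ((Fin.cons a (Fin.cons b y : Fin (m + 1) → V) : Fin (m + 2) → V) 0) ((Fin.cons a (Fin.cons b y : Fin (m + 1) → V) : Fin (m + 2) → V) 1) = g a b := fun y => rfl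
  simp only [this]
  simp [NN]

lemma marg1 {m : ℕ} (i : Fin (m + 1)) (g : V → ℝ) :
    ∑ y : Fin (m + 1) → V, g (y i) = NN V ^ m * ∑ a, g a := by
  have := sum_reperm (V := V) (Equiv.swap 0 i) (fun y => g (y 0))
  simp only [Equiv.swap_apply_left] at this
  rw [this]
  simp only [tup_sum_cons, Finset.mul_sum]
  refine Finset.sum_congr rfl fun a _ => ?_
  have : ∀ y : Fin m → V, g ((Fin.cons a y : Fin (m + 1) → V) 0) = g a := fun y => rfl
  simp only [this]
  simp [NN]

/-- counting with colours -/
lemma sum_colour {n : ℕ} {K : Type*} [Fintype K] (c : V → K) (F : (Fin n → K) → ℝ) :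
    ∑ y : Fin n → V, F (fun i => c (y i)) = ∑ κ : Fin n → K, F κ * ∏ i, (∑ v, ind (c v = κ i)) := by
  have h : ∀ κ : Fin n → K, ∏ i, (∑ v, ind (c v = κ i)) = ∑ y : Fin n → V, ∏ i, ind (c (y i) = κ i) := by
    intro κ
    rw [Finset.prod_univ_sum]
    simp
  simp only [h, Finset.mul_sum]
  rw [Finset.sum_comm]
  refine Finset.sum_congr rfl fun y _ => ?_
  rw [Fintype.sum_eq_single (fun i => c (y i))]
  · have : ∏ i, ind (c (y i) = (fun i => c (y i)) i) = 1 := Finset.prod_eq_one fun i _ => ind_true rfl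
    rw [this, mul_one]
  · intro κ hκ
    have : ∃ i, c (y i) ≠ κ i := by
      by_contra hc
      push Not at hc
      exact hκ (funext fun i => (hc i).symm)
    obtain ⟨i, hi⟩ := this
    rw [Finset.prod_eq_zero (Finset.mem_univ i) (ind_false hi), mul_zero]

/-- graphs as symmetric Boolean matrices with zero diagonal -/
def Gr (A : V → V → Bool) : Prop := (∀ u v, A u v = A v u) ∧ ∀ v, A v v = false

noncomputable def Tinj (A : V → V → Bool) : ℝ :=
  ∑ y : Fin 5 → V, ind (Function.Injective y) * ind (Tri (onT A y))

noncomputable def dd (A B : V → V → Bool) : ℝ := ∑ a, ∑ b, ind (A a b ≠ B a b)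

lemma not_inj_le {n : ℕ} (y : Fin n → V) : ind (¬ Function.Injective y) ≤
    ∑ i, ∑ j, (if i < j then ind (y i = y j) else 0) := by
  have hnn : ∀ i j : Fin n, 0 ≤ (if i < j then ind (y i = y j) else 0) := by
    intro i j; split_ifs; exact ind_nonneg _; exact le_rfl
  by_cases h : Function.Injective y
  · rw [ind_false (by simpa using h)]
    exact Finset.sum_nonneg fun i _ => Finset.sum_nonneg fun j _ => hnn i j
  · rw [ind_true h]
    unfold Function.Injective at h
    push Not at h
    obtain ⟨i, j, hij, hne⟩ := h
    have key : ∀ i j : Fin n, y i = y j → i < j → 1 ≤ ∑ i, ∑ j, (if i < j then ind (y i = y j) else 0) := by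
      intro i j h hlt
      calc (1 : ℝ) = (if i < j then ind (y i = y j) else 0) := by rw [if_pos hlt, ind_true h]
        _ ≤ ∑ j, (if i < j then ind (y i = y j) else 0) :=
          Finset.single_le_sum (f := fun j => if i < j then ind (y i = y j) else 0) (fun j _ => hnn i j) (Finset.mem_univ j)
        _ ≤ _ := Finset.single_le_sum (f := fun i => ∑ j, if i < j then ind (y i = y j) else 0)
          (fun i _ => Finset.sum_nonneg fun j _ => hnn i j) (Finset.mem_univ i)
    rcases lt_or_gt_of_ne hne with hl | hl
    · exact key i j hij hl
    · exact key j i hij.symm hl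

/-- sums over ordered pairs of positions -/
lemma pairs_sum {m : ℕ} (g : V → V → ℝ) :
    ∑ y : Fin (m + 2) → V, ∑ i, ∑ j, (if i < j then g (y i) (y j) else 0) =
      ((∑ i : Fin (m + 2), ∑ j : Fin (m + 2), if i < j then 1 else 0 : ℕ) : ℝ) * (NN V ^ m * ∑ a, ∑ b, g a b) := by
  rw [Finset.sum_comm]
  push_cast
  rw [Finset.sum_mul]
  refine Finset.sum_congr rfl fun i _ => ?_
  rw [Finset.sum_comm, Finset.sum_mul]
  refine Finset.sum_congr rfl fun j _ => ?_
  by_cases h : i < j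
  · simp only [if_pos h, one_mul]
    exact marg2 i j h.ne g
  · simp [if_neg h]

lemma sumDiagV : ∑ a : V, ∑ b : V, ind (a = b) = NN V := by
  simp [ind, NN]

lemma T5_Tinj (A : V → V → Bool) : T5 A ≤ Tinj A + 10 * NN V ^ 4 := by
  have h1 : T5 A ≤ Tinj A + ∑ y : Fin 5 → V, ind (¬ Function.Injective y) := by
    unfold T5 Tinj
    rw [← Finset.sum_add_distrib]
    refine Finset.sum_le_sum fun y _ => ?_
    by_cases h : Function.Injective y
    · rw [ind_true h]; linarith [ind_nonneg (¬ Function.Injective y)]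
    · rw [ind_false h, ind_true h]; linarith [ind_le_one (Tri (onT A y))]
  have h2 : ∑ y : Fin 5 → V, ind (¬ Function.Injective y) ≤ 10 * NN V ^ 4 := by
    calc _ ≤ ∑ y : Fin 5 → V, ∑ i, ∑ j, (if i < j then ind (y i = y j) else 0) :=
          Finset.sum_le_sum fun y _ => not_inj_le y
      _ = _ := by
        rw [pairs_sum (m := 3) (fun a b => ind (a = b)), sumDiagV]
        have : (∑ i : Fin (3 + 2), ∑ j : Fin (3 + 2), if i < j then 1 else 0 : ℕ) = 10 := by decide
        rw [this]
        push_cast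
        ring
  linarith

lemma Tinj_le_T5 (A : V → V → Bool) : Tinj A ≤ T5 A := by
  unfold T5 Tinj
  refine Finset.sum_le_sum fun y _ => ?_
  exact mul_le_of_le_one_left (ind_nonneg _) (ind_le_one _)

/-- changing the matrix -/
lemma T5_change (A B : V → V → Bool) : T5 A ≤ T5 B + 10 * NN V ^ 3 * dd A B := by
  have h1 : T5 A ≤ T5 B + ∑ y : Fin 5 → V, ∑ i, ∑ j, (if i < j then ind (A (y i) (y j) ≠ B (y i) (y j)) else 0) := by
    unfold T5
    rw [← Finset.sum_add_distrib]
    refine Finset.sum_le_sum fun y _ => ?_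
    have hnn : ∀ i j : Fin 5, 0 ≤ (if i < j then ind (A (y i) (y j) ≠ B (y i) (y j)) else 0) := by
      intro i j; split_ifs; exact ind_nonneg _; exact le_rfl
    by_cases h : ∀ i j : Fin 5, i < j → A (y i) (y j) = B (y i) (y j)
    · have : Tri (onT A y) ↔ Tri (onT B y) := by
        unfold Tri
        have : e5 (onT A y) = e5 (onT B y) := by
          unfold e5
          refine Finset.sum_congr rfl fun i _ => Finset.sum_congr rfl fun j _ => ?_
          by_cases hij : i < j
          · simp only [if_pos hij, onT, h i j hij]
          · simp only [if_neg hij]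
        rw [this]
      rw [ind_congr this]
      have := Finset.sum_nonneg (s := Finset.univ) fun i _ => Finset.sum_nonneg (s := Finset.univ) fun j _ => hnn i j
      linarith
    · push Not at h
      obtain ⟨i, j, hlt, hne⟩ := h
      have : 1 ≤ ∑ i, ∑ j, (if i < j then ind (A (y i) (y j) ≠ B (y i) (y j)) else 0) := by
        calc (1 : ℝ) = (if i < j then ind (A (y i) (y j) ≠ B (y i) (y j)) else 0) := by rw [if_pos hlt, ind_true hne]
          _ ≤ ∑ j, (if i < j then ind (A (y i) (y j) ≠ B (y i) (y j)) else 0) :=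
            Finset.single_le_sum (f := fun j => if i < j then ind (A (y i) (y j) ≠ B (y i) (y j)) else 0) (fun j _ => hnn i j) (Finset.mem_univ j)
          _ ≤ _ := Finset.single_le_sum (f := fun i => ∑ j, if i < j then ind (A (y i) (y j) ≠ B (y i) (y j)) else 0)
            (fun i _ => Finset.sum_nonneg fun j _ => hnn i j) (Finset.mem_univ i)
      linarith [ind_le_one (Tri (onT A y)), ind_nonneg (Tri (onT B y))]
  rw [pairs_sum (m := 3) (fun a b => ind (A a b ≠ B a b))] at h1
  have : (∑ i : Fin (3 + 2), ∑ j : Fin (3 + 2), if i < j then 1 else 0 : ℕ) = 10 := by decide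
  rw [this] at h1
  unfold dd
  push_cast at h1
  linarith

end tuples

/-! ### Cloning a vertex -/

section clone
variable {V : Type*} [Fintype V]

noncomputable def Dinj (A : V → V → Bool) (v : V) : ℝ :=
  ∑ y : Fin 5 → V, ind (Function.Injective y) * ind (Tri (onT A y)) * ind (∃ i, y i = v)

lemma ind_ex_le {n : ℕ} (y : Fin n → V) (v : V) : ind (∃ i, y i = v) ≤ ∑ i, ind (y i = v) := by
  by_cases h : ∃ i, y i = v
  · obtain ⟨i, hi⟩ := h
    rw [ind_true ⟨i, hi⟩, ← ind_true hi]
    exact Finset.single_le_sum (f := fun i => ind (y i = v)) (fun i _ => ind_nonneg _) (Finset.mem_univ i)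
  · rw [ind_false h]
    exact Finset.sum_nonneg fun i _ => ind_nonneg _

lemma ind_ex_eq {n : ℕ} (y : Fin n → V) (hy : Function.Injective y) (v : V) :
    ind (∃ i, y i = v) = ∑ i, ind (y i = v) := by
  by_cases h : ∃ i, y i = v
  · obtain ⟨i, hi⟩ := h
    rw [ind_true ⟨i, hi⟩, Fintype.sum_eq_single i, ind_true hi]
    intro j hj
    exact ind_false fun e => hj (hy (e.trans hi.symm))
  · rw [ind_false h]
    symm
    exact Finset.sum_eq_zero fun i _ => ind_false fun e => h ⟨i, e⟩

lemma Dinj_le (A : V → V → Bool) (v : V) : Dinj A v ≤ Dv A v := by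
  unfold Dinj Dv
  refine Finset.sum_le_sum fun y _ => ?_
  have h1 := ind_ex_le y v
  have h2 := ind_le_one (Function.Injective y)
  have h3 := ind_nonneg (Function.Injective y)
  have h4 := ind_nonneg (Tri (onT A y))
  calc _ ≤ 1 * ind (Tri (onT A y)) * ∑ i, ind (y i = v) := by
        have := ind_nonneg (∃ i, y i = v)
        gcongr
      _ = _ := by ring

lemma sum_Dinj (A : V → V → Bool) : ∑ v, Dinj A v = 5 * Tinj A := by
  unfold Dinj Tinj
  rw [Finset.sum_comm, Finset.mul_sum]
  refine Finset.sum_congr rfl fun y _ => ?_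
  rw [← Finset.mul_sum]
  by_cases hy : Function.Injective y
  · have : ∑ v, ind (∃ i, y i = v) = 5 := by
      simp only [ind_ex_eq y hy]
      rw [Finset.sum_comm]
      simp [ind]
    rw [this]; ring
  · rw [ind_false hy]; ring

lemma exists_Dinj [Nonempty V] (A : V → V → Bool) : ∃ u, 5 * Tinj A ≤ NN V * Dinj A u := by
  by_contra h
  push Not at h
  have h1 : ∑ u, NN V * Dinj A u < ∑ _u : V, 5 * Tinj A := by
    apply Finset.sum_lt_sum_of_nonempty Finset.univ_nonempty
    intro u _
    exact h u
  rw [← Finset.mul_sum, sum_Dinj, Finset.sum_const, nsmul_eq_mul] at h1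
  simp [NN] at h1

lemma two_mem (u v : V) : ∑ y : Fin 5 → V, ind ((∃ i, y i = u) ∧ (∃ i, y i = v) ∧ u ≠ v) ≤ 20 * NN V ^ 3 := by
  by_cases huv : u = v
  · have : ∑ y : Fin 5 → V, ind ((∃ i, y i = u) ∧ (∃ i, y i = v) ∧ u ≠ v) = 0 :=
      Finset.sum_eq_zero fun y _ => ind_false fun h => h.2.2 huv
    rw [this]
    have := NN_nonneg (V := V)
    positivity
  have h1 : ∀ y : Fin 5 → V, ind ((∃ i, y i = u) ∧ (∃ i, y i = v) ∧ u ≠ v) ≤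
      ∑ i, ∑ j, (if i < j then (ind (y i = u) * ind (y j = v) + ind (y i = v) * ind (y j = u)) else 0) := by
    intro y
    have hnn : ∀ i j : Fin 5, 0 ≤ (if i < j then (ind (y i = u) * ind (y j = v) + ind (y i = v) * ind (y j = u)) else 0) := by
      intro i j
      split_ifs
      · exact add_nonneg (mul_nonneg (ind_nonneg _) (ind_nonneg _)) (mul_nonneg (ind_nonneg _) (ind_nonneg _))
      · exact le_rfl
    by_cases h : (∃ i, y i = u) ∧ (∃ i, y i = v) ∧ u ≠ v
    · rw [ind_true h]
      obtain ⟨⟨i, hi⟩, ⟨j, hj⟩, _⟩ := h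
      have hij : i ≠ j := by
        rintro rfl
        exact huv (hi.symm.trans hj)
      have key : ∀ i j : Fin 5, i < j → 1 ≤ (ind (y i = u) * ind (y j = v) + ind (y i = v) * ind (y j = u)) →
          1 ≤ ∑ i, ∑ j, (if i < j then (ind (y i = u) * ind (y j = v) + ind (y i = v) * ind (y j = u)) else 0) := by
        intro i j hlt h1
        calc (1 : ℝ) ≤ (if i < j then (ind (y i = u) * ind (y j = v) + ind (y i = v) * ind (y j = u)) else 0) := by rw [if_pos hlt]; exact h1
          _ ≤ ∑ j, (if i < j then (ind (y i = u) * ind (y j = v) + ind (y i = v) * ind (y j = u)) else 0) :=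
            Finset.single_le_sum (f := fun j => if i < j then (ind (y i = u) * ind (y j = v) + ind (y i = v) * ind (y j = u)) else 0) (fun j _ => hnn i j) (Finset.mem_univ j)
          _ ≤ _ := Finset.single_le_sum (f := fun i => ∑ j, if i < j then (ind (y i = u) * ind (y j = v) + ind (y i = v) * ind (y j = u)) else 0)
            (fun i _ => Finset.sum_nonneg fun j _ => hnn i j) (Finset.mem_univ i)
      rcases lt_or_gt_of_ne hij with hl | hl
      · refine key i j hl ?_
        rw [ind_true hi, ind_true hj]
        have := mul_nonneg (ind_nonneg (y i = v)) (ind_nonneg (y j = u))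
        linarith
      · refine key j i hl ?_
        rw [ind_true hi, ind_true hj]
        have := mul_nonneg (ind_nonneg (y j = u)) (ind_nonneg (y i = v))
        linarith
    · rw [ind_false h]
      exact Finset.sum_nonneg fun i _ => Finset.sum_nonneg fun j _ => hnn i j
  calc _ ≤ _ := Finset.sum_le_sum fun y _ => h1 y
    _ = _ := pairs_sum (m := 3) (fun a b => ind (a = u) * ind (b = v) + ind (a = v) * ind (b = u))
    _ = _ := by
      have : (∑ i : Fin (3 + 2), ∑ j : Fin (3 + 2), if i < j then 1 else 0 : ℕ) = 10 := by decide
      rw [this]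
      have : ∑ a : V, ∑ b : V, (ind (a = u) * ind (b = v) + ind (a = v) * ind (b = u)) = 2 := by
        simp only [Finset.sum_add_distrib, ← Finset.mul_sum]
        simp [ind]
        norm_num
      rw [this]
      push_cast
      ring

/-- the cloning map -/
noncomputable def clo (u v : V) : V → V := fun w => if w = v then u else w

lemma clone_T (A : V → V → Bool) (u v : V) (huv : u ≠ v) :
    Tinj A - Dinj A v + Dinj A u - 20 * NN V ^ 3 ≤ Tinj (fun a b => A (clo u v a) (clo u v b)) := by
  set A' : V → V → Bool := fun a b => A (clo u v a) (clo u v b) with hA'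
  have hlow : ∑ y : Fin 5 → V, ind (Function.Injective y) * ind (Tri (onT A y)) * ind (¬ ∃ i, y i = v) +
      ∑ y : Fin 5 → V, ind (Function.Injective y) * ind (Tri (onT A' y)) * (ind (∃ i, y i = v) * ind (¬ ∃ i, y i = u)) ≤ Tinj A' := by
    unfold Tinj
    rw [← Finset.sum_add_distrib]
    refine Finset.sum_le_sum fun y _ => ?_
    by_cases hv : ∃ i, y i = v
    · rw [ind_true hv, ind_false (not_not.mpr hv)]
      have h1 := mul_nonneg (ind_nonneg (Function.Injective y)) (ind_nonneg (Tri (onT A' y)))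
      have h2 := ind_le_one (¬ ∃ i, y i = u)
      nlinarith
    · rw [ind_false hv, ind_true hv]
      have : onT A' y = onT A y := by
        funext i j
        simp only [onT, hA', clo]
        rw [if_neg fun e => hv ⟨i, e⟩, if_neg fun e => hv ⟨j, e⟩]
      rw [this]
      linarith
  have h1 : ∑ y : Fin 5 → V, ind (Function.Injective y) * ind (Tri (onT A y)) * ind (¬ ∃ i, y i = v) = Tinj A - Dinj A v := by
    unfold Tinj Dinj
    rw [← Finset.sum_sub_distrib]
    refine Finset.sum_congr rfl fun y _ => ?_
    by_cases hv : ∃ i, y i = v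
    · rw [ind_true hv, ind_false (not_not.mpr hv)]; ring
    · rw [ind_false hv, ind_true hv]; ring
  have h2 : ∑ y : Fin 5 → V, ind (Function.Injective y) * ind (Tri (onT A' y)) * (ind (∃ i, y i = v) * ind (¬ ∃ i, y i = u)) =
      ∑ y : Fin 5 → V, ind (Function.Injective y) * ind (Tri (onT A y)) * (ind (∃ i, y i = u) * ind (¬ ∃ i, y i = v)) := by
    rw [← Equiv.sum_comp (Equiv.arrowCongr (Equiv.refl (Fin 5)) (Equiv.swap u v))]
    refine Finset.sum_congr rfl fun y _ => ?_
    have e0 : (Equiv.arrowCongr (Equiv.refl (Fin 5)) (Equiv.swap u v)) y = fun i => Equiv.swap u v (y i) := rfl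
    rw [e0]
    have e1 : ind (Function.Injective fun i => Equiv.swap u v (y i)) = ind (Function.Injective y) :=
      ind_congr ((Equiv.swap u v).injective.of_comp_iff y)
    have e2 : ind (∃ i, Equiv.swap u v (y i) = v) = ind (∃ i, y i = u) := by
      apply ind_congr
      refine exists_congr fun i => ?_
      rw [Equiv.swap_apply_eq_iff]
      simp
    have e3 : ind (¬ ∃ i, Equiv.swap u v (y i) = u) = ind (¬ ∃ i, y i = v) := by
      apply ind_congr
      refine not_congr (exists_congr fun i => ?_)
      rw [Equiv.swap_apply_eq_iff]
      simp
    rw [e1, e2, e3]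
    by_cases hv : ∃ i, y i = v
    · rw [ind_false (not_not.mpr hv)]; ring
    · have : onT A' (fun i => Equiv.swap u v (y i)) = onT A y := by
        have hc : ∀ i, clo u v (Equiv.swap u v (y i)) = y i := by
          intro i
          have hi : y i ≠ v := fun e => hv ⟨i, e⟩
          by_cases hu : y i = u
          · rw [hu]; simp [clo]
          · rw [Equiv.swap_apply_of_ne_of_ne hu hi]; simp [clo, hi]
        funext i j
        simp only [onT, hA', hc]
      rw [this]
  have h3 : Dinj A u - 20 * NN V ^ 3 ≤ ∑ y : Fin 5 → V, ind (Function.Injective y) * ind (Tri (onT A y)) * (ind (∃ i, y i = u) * ind (¬ ∃ i, y i = v)) := by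
    have := two_mem u v
    have h4 : Dinj A u ≤ ∑ y : Fin 5 → V, ind (Function.Injective y) * ind (Tri (onT A y)) * (ind (∃ i, y i = u) * ind (¬ ∃ i, y i = v)) + ∑ y : Fin 5 → V, ind ((∃ i, y i = u) ∧ (∃ i, y i = v) ∧ u ≠ v) := by
      unfold Dinj
      rw [← Finset.sum_add_distrib]
      refine Finset.sum_le_sum fun y _ => ?_
      by_cases hv : ∃ i, y i = v
      · rw [ind_false (not_not.mpr hv)]
        by_cases hu : ∃ i, y i = u
        · rw [ind_true (P := _ ∧ _) ⟨hu, hv, huv⟩, ind_true hu]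
          have h5 : ind (Function.Injective y) * ind (Tri (onT A y)) ≤ 1 :=
            mul_le_one₀ (ind_le_one _) (ind_nonneg _) (ind_le_one _)
          linarith
        · rw [ind_false hu]
          have := ind_nonneg ((∃ i, y i = u) ∧ (∃ i, y i = v) ∧ u ≠ v)
          linarith
      · rw [ind_true hv]
        have := ind_nonneg ((∃ i, y i = u) ∧ (∃ i, y i = v) ∧ u ≠ v)
        linarith
    linarith
  linarith

lemma clone_d (A : V → V → Bool) (u v : V) : dd A (fun a b => A (clo u v a) (clo u v b)) ≤ 2 * NN V := by
  unfold dd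
  have : ∀ a b, ind (A a b ≠ A (clo u v a) (clo u v b)) ≤ ind (a = v) + ind (b = v) := by
    intro a b
    by_cases ha : a = v
    · rw [ind_true ha]
      linarith [ind_le_one (A a b ≠ A (clo u v a) (clo u v b)), ind_nonneg (b = v)]
    by_cases hb : b = v
    · rw [ind_true hb]
      linarith [ind_le_one (A a b ≠ A (clo u v a) (clo u v b)), ind_nonneg (a = v)]
    · rw [ind_false (P := A a b ≠ _)]
      · exact add_nonneg (ind_nonneg _) (ind_nonneg _)
      · simp [clo, ha, hb]
  calc _ ≤ ∑ a, ∑ b, (ind (a = v) + ind (b = v)) := Finset.sum_le_sum fun a _ => Finset.sum_le_sum fun b _ => this a b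
    _ = _ := by
      simp only [Finset.sum_add_distrib]
      simp [ind, NN]
      ring

/-- All vertices are in few bad tuples in a locally optimal graph. -/
theorem badv_small (A : V → V → Bool) (hA : Gr A) (hN : (10 : ℝ) ^ 20 ≤ NN V)
    (hT : (LAM - (3 / 10 ^ 19) ^ 2) * NN V ^ 5 ≤ Tinj A)
    (H : ∀ A' : V → V → Bool, Gr A' → Tinj A' ≤ Tinj A + (3 / 10 ^ 19) * NN V ^ 3 * dd A A') (v : V) :
    badv A v ≤ (41 / 10 ^ 16) * NN V ^ 5 := by
  haveI : Nonempty V := ⟨v⟩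
  obtain ⟨u, hu⟩ := exists_Dinj A
  have hvb := vertex_bound A hA.1 v (3 / 10 ^ 19) (by norm_num) (by norm_num) (hT.trans (Tinj_le_T5 A))
  have hDv := Dinj_le A v
  have hlow : Dinj A u ≤ Dinj A v + 20 * NN V ^ 3 + (3 / 10 ^ 19) * NN V ^ 3 * (2 * NN V) := by
    have hN0 : 0 ≤ NN V := NN_nonneg
    by_cases huv : u = v
    · rw [huv]
      have : 0 ≤ 20 * NN V ^ 3 + (3 / 10 ^ 19) * NN V ^ 3 * (2 * NN V) := by positivity
      linarith
    · have h1 := clone_T A u v huv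
      have h2 := H (fun a b => A (clo u v a) (clo u v b)) ⟨fun a b => hA.1 _ _, fun a => hA.2 _⟩
      have h3 : (3 / 10 ^ 19) * NN V ^ 3 * dd A (fun a b => A (clo u v a) (clo u v b)) ≤ (3 / 10 ^ 19) * NN V ^ 3 * (2 * NN V) :=
        mul_le_mul_of_nonneg_left (clone_d A u v) (by positivity)
      linarith
  set N := NN V
  have hN0 : 0 < N := lt_of_lt_of_le (by norm_num) hN
  have h4 : N * Dinj A u ≤ N * Dv A v + 20 * N ^ 4 + (6 / 10 ^ 19) * N ^ 5 := by
    have := mul_le_mul_of_nonneg_left (hlow.trans (by linarith : _ ≤ Dv A v + 20 * N ^ 3 + (3 / 10 ^ 19) * N ^ 3 * (2 * N))) hN0.le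
    linarith [this, (by ring : N * (Dv A v + 20 * N ^ 3 + (3 / 10 ^ 19) * N ^ 3 * (2 * N)) = N * Dv A v + 20 * N ^ 4 + (6 / 10 ^ 19) * N ^ 5)]
  have h5 : (10 : ℝ) ^ 20 * N ^ 4 ≤ N ^ 5 := by
    rw [pow_succ N 4, mul_comm]
    exact mul_le_mul_of_nonneg_left hN (by positivity)
  have h6 : 0 ≤ N ^ 5 := by positivity
  nlinarith

end clone

/-! ### Finding a good colouring -/

def good4 (b01 b02 b12 b03 b13 b23 : Bool) : Bool :=
  (b01 && b02 && !b12) || (b01 && b02 && b12 && !b03 && !b13 && !b23)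

def cTt (b12 x0 x1 x3 : Bool) : Fin 3 :=
  cond b12 (cond x0 2 (cond x3 1 0)) (cond x0 1 (cond x1 0 2))

lemma good_colour : ∀ k0 k1 k2 k3 k4 k5 : Fin 3,
    good4 (pat k0 k1) (pat k0 k2) (pat k1 k2) (pat k0 k3) (pat k1 k3) (pat k2 k3) = true →
    pat k4 k5 = pat (cTt (pat k1 k2) (pat k4 k0) (pat k4 k1) (pat k4 k3)) (cTt (pat k1 k2) (pat k5 k0) (pat k5 k1) (pat k5 k3)) := by
  decide +kernel

def mk5 (b01 b02 b03 b04 b12 b13 b14 b23 b24 b34 : Bool) (i j : Fin 5) : Bool :=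
  mkA b01 b02 b03 b04 false b12 b13 b14 false b23 b24 false b34 false false i.castSucc j.castSucc

def isG (a : Fin 5 → Fin 5 → Bool) (i j k l : Fin 5) : Bool :=
  good4 (a i j) (a i k) (a j k) (a i l) (a j l) (a k l)

def l5 : List (Fin 5) := [0, 1, 2, 3, 4]

def exG (a : Fin 5 → Fin 5 → Bool) : Bool :=
  l5.any fun i => l5.any fun j => (a i j) && l5.any fun k => (a i k) && (!decide (k = j)) && l5.any fun l =>
    (!decide (l = i)) && (!decide (l = j)) && (!decide (l = k)) && isG a i j k l

def chkG : Bool :=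
  allB fun b01 => allB fun b02 => allB fun b03 => allB fun b04 => allB fun b12 => allB fun b13 => allB fun b14 =>
  allB fun b23 => allB fun b24 => allB fun b34 =>
    cond (Nat.beq (bn b01 + bn b02 + bn b03 + bn b04 + bn b12 + bn b13 + bn b14 + bn b23 + bn b24 + bn b34) 3)
      (exG (mk5 b01 b02 b03 b04 b12 b13 b14 b23 b24 b34)) true

lemma chkG_true : chkG = true := by decide +kernel

lemma e5_expand (a : Fin 5 → Fin 5 → Bool) : e5 a = bn (a 0 1) + bn (a 0 2) + bn (a 0 3) + bn (a 0 4) + bn (a 1 2) + bn (a 1 3) + bn (a 1 4)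
    + bn (a 2 3) + bn (a 2 4) + bn (a 3 4) := by
  unfold e5
  simp [Fin.sum_univ_five]
  ring

lemma tri_good (a : Fin 5 → Fin 5 → Bool) (hs : ∀ i j, a i j = a j i) (hd : ∀ i, a i i = false) (h : Tri a) :
    ∃ p : Equiv.Perm (Fin 5), isG a (p 0) (p 1) (p 2) (p 3) = true := by
  have ha : a = mk5 (a 0 1) (a 0 2) (a 0 3) (a 0 4) (a 1 2) (a 1 3) (a 1 4) (a 2 3) (a 2 4) (a 3 4) := by
    funext i j
    fin_cases i <;> fin_cases j <;> first | rfl | (exact hd _) | (exact hs _ _)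
  have hc := allB_spec (allB_spec (allB_spec (allB_spec (allB_spec (allB_spec (allB_spec (allB_spec (allB_spec (allB_spec chkG_true
    (a 0 1)) (a 0 2)) (a 0 3)) (a 0 4)) (a 1 2)) (a 1 3)) (a 1 4)) (a 2 3)) (a 2 4)) (a 3 4)
  unfold Tri at h
  rw [e5_expand] at h
  rw [h] at hc
  change exG _ = true at hc
  rw [← ha] at hc
  unfold exG at hc
  rw [List.any_eq_true] at hc
  obtain ⟨i, -, hc⟩ := hc
  rw [List.any_eq_true] at hc
  obtain ⟨j, -, hc⟩ := hc
  rw [Bool.and_eq_true, List.any_eq_true] at hc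
  obtain ⟨hij, k, -, hc⟩ := hc
  rw [Bool.and_eq_true, Bool.and_eq_true, List.any_eq_true] at hc
  obtain ⟨⟨hik, hkj⟩, l, -, hc⟩ := hc
  simp only [Bool.and_eq_true, Bool.not_eq_true', decide_eq_false_iff_not] at hc hkj
  obtain ⟨⟨⟨hli, hlj⟩, hlk⟩, hg⟩ := hc
  have hij' : i ≠ j := by rintro rfl; rw [hd] at hij; exact absurd hij (by simp)
  have hik' : i ≠ k := by rintro rfl; rw [hd] at hik; exact absurd hik (by simp)
  have hinj : Function.Injective ![i, j, k, l] := by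
    intro p q hpq
    fin_cases p <;> fin_cases q <;> simp at hpq <;> first | rfl | (exfalso; first | exact hij' hpq | exact hij' hpq.symm | exact hik' hpq | exact hik' hpq.symm | exact hli hpq | exact hli hpq.symm | exact hkj hpq | exact hkj hpq.symm | exact hlj hpq | exact hlj hpq.symm | exact hlk hpq | exact hlk hpq.symm)
  obtain ⟨m, hm⟩ : ∃ m : Fin 5, m ≠ i ∧ m ≠ j ∧ m ≠ k ∧ m ≠ l := by
    clear * -
    revert i j k l
    decide +kernel
  have hinj5 : Function.Injective (![i, j, k, l, m] : Fin 5 → Fin 5) := by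
    obtain ⟨m1, m2, m3, m4⟩ := hm
    intro p q hpq
    fin_cases p <;> fin_cases q <;> simp at hpq <;> first | rfl | (exfalso; first | exact hij' hpq | exact hij' hpq.symm | exact hik' hpq | exact hik' hpq.symm | exact hli hpq | exact hli hpq.symm | exact hkj hpq | exact hkj hpq.symm | exact hlj hpq | exact hlj hpq.symm | exact hlk hpq | exact hlk hpq.symm | exact m1 hpq | exact m1 hpq.symm | exact m2 hpq | exact m2 hpq.symm | exact m3 hpq | exact m3 hpq.symm | exact m4 hpq | exact m4 hpq.symm)
  refine ⟨Equiv.ofBijective _ (Finite.injective_iff_bijective.mp hinj5), ?_⟩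
  exact hg

section colouring
variable {V : Type*} [Fintype V]

def G4 (A : V → V → Bool) (t : Fin 4 → V) : Prop :=
  good4 (A (t 0) (t 1)) (A (t 0) (t 2)) (A (t 1) (t 2)) (A (t 0) (t 3)) (A (t 1) (t 3)) (A (t 2) (t 3)) = true

/-- number of non-matching pairs; pairs of equal vertices also count -/
noncomputable def wr (A : V → V → Bool) (c : V → Fin 3) (a b : V) : ℝ := ind (a = b ∨ A a b ≠ pat (c a) (c b))

/-- genuine errors -/
noncomputable def er (A : V → V → Bool) (c : V → Fin 3) (a b : V) : ℝ := ind (a ≠ b ∧ A a b ≠ pat (c a) (c b))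

lemma T5_good (A : V → V → Bool) (hA : Gr A) : T5 A ≤ 120 * (NN V * ∑ t : Fin 4 → V, ind (G4 A t)) := by
  have h1 : ∀ y : Fin 5 → V, ind (Tri (onT A y)) ≤ ∑ p : Equiv.Perm (Fin 5), ind (isG (onT A fun i => y (p i)) 0 1 2 3 = true) := by
    intro y
    by_cases h : Tri (onT A y)
    · obtain ⟨p, hp⟩ := tri_good (onT A y) (fun i j => hA.1 _ _) (fun i => hA.2 _) h
      have : isG (onT A fun i => y (p i)) 0 1 2 3 = true := hp
      rw [ind_true h, ← ind_true this]
      exact Finset.single_le_sum (f := fun p : Equiv.Perm (Fin 5) => ind (isG (onT A fun i => y (p i)) 0 1 2 3 = true)) (fun _ _ => ind_nonneg _) (Finset.mem_univ p)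
    · rw [ind_false h]
      exact Finset.sum_nonneg fun _ _ => ind_nonneg _
  calc T5 A ≤ ∑ y : Fin 5 → V, ∑ p : Equiv.Perm (Fin 5), ind (isG (onT A fun i => y (p i)) 0 1 2 3 = true) :=
        Finset.sum_le_sum fun y _ => h1 y
    _ = ∑ p : Equiv.Perm (Fin 5), ∑ y : Fin 5 → V, ind (isG (onT A y) 0 1 2 3 = true) := by
        rw [Finset.sum_comm]
        refine Finset.sum_congr rfl fun p _ => ?_
        exact sum_reperm p (fun y => ind (isG (onT A y) 0 1 2 3 = true))
    _ = 120 * ∑ y : Fin 5 → V, ind (isG (onT A y) 0 1 2 3 = true) := by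
        rw [Finset.sum_const, Finset.card_univ, Fintype.card_perm, Fintype.card_fin, nsmul_eq_mul]
        norm_num [Nat.factorial]
    _ = _ := by
        have := sum_snoc (V := V) (n := 4) (fun t => ind (G4 A t)) (fun _ => 1)
        rw [sum_one_V] at this
        rw [mul_comm (NN V), ← this]
        congr 1
        refine Finset.sum_congr rfl fun y _ => ?_
        rw [mul_one]
        rfl

lemma sumX6 (F : (Fin 6 → V) → ℝ) : ∑ x, F x = ∑ t : Fin 4 → V, ∑ v, ∑ u, F ![t 0, t 1, t 2, t 3, v, u] := by
  simp only [tup_sum_cons, sum_zero_tuple]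
  rfl

lemma badv_eq (A : V → V → Bool) (v : V) : badv A v = ∑ t : Fin 4 → V, ∑ u, ind (Bad (onT A ![t 0, t 1, t 2, t 3, v, u])) := by
  unfold badv
  rw [sumX6]
  refine Finset.sum_congr rfl fun t _ => ?_
  rw [Fintype.sum_eq_single v]
  · refine Finset.sum_congr rfl fun u _ => ?_
    show ind (v = v) * _ = _
    rw [ind_true rfl, one_mul]
  · intro w hw
    refine Finset.sum_eq_zero fun u _ => ?_
    show ind (w = v) * _ = _
    rw [ind_false hw, zero_mul]

theorem exists_colouring (A : V → V → Bool) (hA : Gr A) (hN : 0 < NN V) (β : ℝ) (hβ : 0 ≤ β) (hT : 0.5 * NN V ^ 5 ≤ T5 A)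
    (hb : ∀ v, badv A v ≤ β * NN V ^ 5) :
    ∃ c : V → Fin 3, ∑ a, ∑ b, er A c a b ≤ 240 * β * NN V ^ 2 := by
  have h1 := T5_good A hA
  set g := ∑ t : Fin 4 → V, ind (G4 A t) with hg
  have h2 : NN V ^ 4 ≤ 240 * g := by
    have : NN V * NN V ^ 4 ≤ NN V * (240 * g) := by
      have e : NN V * NN V ^ 4 = NN V ^ 5 := by ring
      rw [e]; linarith
    exact le_of_mul_le_mul_left this hN
  have h3 : ∑ v, badv A v ≤ β * NN V ^ 6 := by
    calc _ ≤ ∑ _v : V, β * NN V ^ 5 := Finset.sum_le_sum fun v _ => hb v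
      _ = _ := by rw [Finset.sum_const, nsmul_eq_mul, Finset.card_univ]; unfold NN; ring
  have h4 : ∑ v, badv A v = ∑ t : Fin 4 → V, ∑ v, ∑ u, ind (Bad (onT A ![t 0, t 1, t 2, t 3, v, u])) := by
    simp only [badv_eq]
    exact Finset.sum_comm
  obtain ⟨t, ht, htb⟩ : ∃ t : Fin 4 → V, G4 A t ∧ ∑ v, ∑ u, ind (Bad (onT A ![t 0, t 1, t 2, t 3, v, u])) ≤ 240 * β * NN V ^ 2 := by
    by_contra hcon
    push Not at hcon
    have hg0 : 0 < g := by
      have : 0 < NN V ^ 4 := by positivity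
      linarith
    have h5 : 240 * β * NN V ^ 2 * g < ∑ t : Fin 4 → V, ∑ v, ∑ u, ind (Bad (onT A ![t 0, t 1, t 2, t 3, v, u])) := by
      rw [hg, Finset.mul_sum]
      have hle : ∀ t : Fin 4 → V, 240 * β * NN V ^ 2 * ind (G4 A t) ≤ ∑ v, ∑ u, ind (Bad (onT A ![t 0, t 1, t 2, t 3, v, u])) := by
        intro t
        by_cases ht : G4 A t
        · rw [ind_true ht, mul_one]; exact (hcon t ht).le
        · rw [ind_false ht, mul_zero]
          exact Finset.sum_nonneg fun _ _ => Finset.sum_nonneg fun _ _ => ind_nonneg _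
      obtain ⟨t, ht⟩ : ∃ t, G4 A t := by
        by_contra hno
        push Not at hno
        have : g = 0 := Finset.sum_eq_zero fun t _ => ind_false (hno t)
        linarith
      refine Finset.sum_lt_sum (fun t _ => hle t) ⟨t, Finset.mem_univ _, ?_⟩
      rw [ind_true ht, mul_one]
      exact hcon t ht
    rw [← h4] at h5
    have h6 : β * NN V ^ 6 ≤ 240 * β * NN V ^ 2 * g := by
      have := mul_le_mul_of_nonneg_left h2 (by positivity : 0 ≤ β * NN V ^ 2)
      calc _ = β * NN V ^ 2 * NN V ^ 4 := by ring
        _ ≤ _ := this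
        _ = _ := by ring
    linarith
  refine ⟨fun v => cTt (A (t 1) (t 2)) (A v (t 0)) (A v (t 1)) (A v (t 3)), le_trans ?_ htb⟩
  refine Finset.sum_le_sum fun v _ => Finset.sum_le_sum fun u _ => ?_
  apply ind_mono
  rintro ⟨-, hne⟩ ⟨κ, hκ⟩
  apply hne
  have q : ∀ i j, i ≠ j → A ((![t 0, t 1, t 2, t 3, v, u] : Fin 6 → V) i) ((![t 0, t 1, t 2, t 3, v, u] : Fin 6 → V) j) = pat (κ i) (κ j) := hκ
  have q01 : A (t 0) (t 1) = _ := q 0 1 (by decide)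
  have q02 : A (t 0) (t 2) = _ := q 0 2 (by decide)
  have q12 : A (t 1) (t 2) = _ := q 1 2 (by decide)
  have q03 : A (t 0) (t 3) = _ := q 0 3 (by decide)
  have q13 : A (t 1) (t 3) = _ := q 1 3 (by decide)
  have q23 : A (t 2) (t 3) = _ := q 2 3 (by decide)
  have q40 : A v (t 0) = _ := q 4 0 (by decide)
  have q41 : A v (t 1) = _ := q 4 1 (by decide)
  have q43 : A v (t 3) = _ := q 4 3 (by decide)
  have q50 : A u (t 0) = _ := q 5 0 (by decide)
  have q51 : A u (t 1) = _ := q 5 1 (by decide)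
  have q53 : A u (t 3) = _ := q 5 3 (by decide)
  have q45 : A v u = _ := q 4 5 (by decide)
  unfold G4 at ht
  rw [q01, q02, q12, q03, q13, q23] at ht
  beta_reduce
  rw [q40, q41, q43, q50, q51, q53, q45, q12]
  exact good_colour _ _ _ _ _ _ ht

end colouring

/-! ### Polynomial counts -/

def cnt {n : ℕ} (k : Fin 3) (κ : Fin n → Fin 3) : ℕ := ∑ i, if κ i = k then 1 else 0

lemma cnt_eq_card {n : ℕ} (k : Fin 3) (κ : Fin n → Fin 3) : cnt k κ = (Finset.univ.filter (fun i => κ i = k)).card := by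
  unfold cnt
  simp

lemma prod_key {n : ℕ} (s : Fin 3 → ℝ) (κ : Fin n → Fin 3) :
    ∏ i, s (κ i) = s 0 ^ cnt 0 κ * s 1 ^ cnt 1 κ * s 2 ^ cnt 2 κ := by
  rw [← Finset.prod_fiberwise Finset.univ κ (fun i => s (κ i)), Fin.prod_univ_three]
  have : ∀ k : Fin 3, ∏ i with κ i = k, s (κ i) = s k ^ cnt k κ := by
    intro k
    rw [cnt_eq_card, ← Finset.prod_const]
    refine Finset.prod_congr rfl fun i hi => ?_
    rw [(Finset.mem_filter.mp hi).2]
  rw [this, this, this]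

lemma cnt_sum {n : ℕ} (κ : Fin n → Fin 3) : cnt 0 κ + cnt 1 κ + cnt 2 κ = n := by
  unfold cnt
  rw [← Finset.sum_add_distrib, ← Finset.sum_add_distrib]
  have : ∀ i : Fin n, ((if κ i = 0 then 1 else 0) + (if κ i = 1 then 1 else 0) + if κ i = 2 then 1 else 0) = 1 := by
    intro i
    generalize κ i = k
    revert k
    decide
  simp [this]

lemma sum_key {n : ℕ} (s : Fin 3 → ℝ) (w : (Fin n → Fin 3) → ℤ) :
    ∑ κ : Fin n → Fin 3, (w κ : ℝ) * ∏ i, s (κ i) =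
      ∑ p : Fin (n + 1), ∑ q : Fin (n + 1),
        ((∑ κ : Fin n → Fin 3, if cnt 0 κ = p.val ∧ cnt 1 κ = q.val then w κ else 0 : ℤ) : ℝ) *
          (s 0 ^ p.val * s 1 ^ q.val * s 2 ^ (n - p.val - q.val)) := by
  push_cast
  simp only [Finset.sum_mul]
  have e : ∀ p : Fin (n + 1), ∑ q : Fin (n + 1), ∑ κ : Fin n → Fin 3, ((if cnt 0 κ = p.val ∧ cnt 1 κ = q.val then (w κ : ℝ) else 0)) *
          (s 0 ^ p.val * s 1 ^ q.val * s 2 ^ (n - p.val - q.val)) = ∑ κ : Fin n → Fin 3, ∑ q : Fin (n + 1), ((if cnt 0 κ = p.val ∧ cnt 1 κ = q.val then (w κ : ℝ) else 0)) *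
          (s 0 ^ p.val * s 1 ^ q.val * s 2 ^ (n - p.val - q.val)) := fun p => Finset.sum_comm
  simp only [e]
  rw [Finset.sum_comm]
  refine Finset.sum_congr rfl fun κ _ => ?_
  have hs := cnt_sum κ
  rw [Fintype.sum_eq_single (⟨cnt 0 κ, by omega⟩ : Fin (n + 1)), Fintype.sum_eq_single (⟨cnt 1 κ, by omega⟩ : Fin (n + 1))]
  · rw [if_pos ⟨rfl, rfl⟩, prod_key]
    have : n - cnt 0 κ - cnt 1 κ = cnt 2 κ := by omega
    simp only [this]
  · intro q hq
    rw [if_neg, zero_mul]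
    rintro ⟨-, h⟩
    exact hq (Fin.ext h.symm)
  · intro p hp
    refine Finset.sum_eq_zero fun q _ => ?_
    rw [if_neg, zero_mul]
    rintro ⟨h, -⟩
    exact hp (Fin.ext h.symm)

/-- number of edges of the pattern on five coloured points; the status of the first pair is given -/
def t5b (b : Bool) (k0 k1 k2 k3 k4 : Fin 3) : ℤ :=
  cond (Nat.beq (bn b + bn (pat k0 k2) + bn (pat k0 k3) + bn (pat k0 k4) + bn (pat k1 k2) + bn (pat k1 k3) + bn (pat k1 k4)
    + bn (pat k2 k3) + bn (pat k2 k4) + bn (pat k3 k4)) 3) 1 0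

def w5 (κ : Fin 5 → Fin 3) : ℤ := t5b (pat (κ 0) (κ 1)) (κ 0) (κ 1) (κ 2) (κ 3) (κ 4)

def tabP (p q : Fin 6) : ℤ :=
  match p.val, q.val with
  | 2, 0 => 10 | 0, 2 => 10 | 2, 1 => 30 | 1, 2 => 30 | 3, 1 => 20 | 1, 3 => 20 | _, _ => 0

lemma tabP_eq : ∀ p q : Fin 6, (∑ κ : Fin 5 → Fin 3, if cnt 0 κ = p.val ∧ cnt 1 κ = q.val then w5 κ else 0) = tabP p q := by
  simp only [tup_sum_cons, sum_zero_tuple]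
  decide +kernel

lemma ind_Tri_w5 (κ : Fin 5 → Fin 3) : ind (Tri (fun i j => pat (κ i) (κ j))) = (w5 κ : ℝ) := by
  unfold Tri
  rw [e5_expand]
  unfold w5 t5b
  by_cases h : bn (pat (κ 0) (κ 1)) + bn (pat (κ 0) (κ 2)) + bn (pat (κ 0) (κ 3)) + bn (pat (κ 0) (κ 4)) + bn (pat (κ 1) (κ 2)) + bn (pat (κ 1) (κ 3)) + bn (pat (κ 1) (κ 4))
    + bn (pat (κ 2) (κ 3)) + bn (pat (κ 2) (κ 4)) + bn (pat (κ 3) (κ 4)) = 3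
  · rw [ind_true h, h]; simp
  · rw [ind_false h]
    have : Nat.beq (bn (pat (κ 0) (κ 1)) + bn (pat (κ 0) (κ 2)) + bn (pat (κ 0) (κ 3)) + bn (pat (κ 0) (κ 4)) + bn (pat (κ 1) (κ 2)) + bn (pat (κ 1) (κ 3)) + bn (pat (κ 1) (κ 4))
    + bn (pat (κ 2) (κ 3)) + bn (pat (κ 2) (κ 4)) + bn (pat (κ 3) (κ 4))) 3 = false := by
      rw [Bool.eq_false_iff]
      intro h'
      exact h (Nat.eq_of_beq_eq_true h')
    rw [this]
    simp

section poly
variable {V : Type*} [Fintype V]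

noncomputable def sz (c : V → Fin 3) (k : Fin 3) : ℝ := ∑ v, ind (c v = k)

lemma sz_nonneg (c : V → Fin 3) (k : Fin 3) : 0 ≤ sz c k := Finset.sum_nonneg fun _ _ => ind_nonneg _

lemma sz_sum (c : V → Fin 3) : sz c 0 + sz c 1 + sz c 2 = NN V := by
  unfold sz
  rw [← Finset.sum_add_distrib, ← Finset.sum_add_distrib, ← sum_one_V]
  refine Finset.sum_congr rfl fun v _ => ?_
  generalize c v = k
  fin_cases k <;> simp [ind]

def polyP (x y z : ℝ) : ℝ := 10 * z ^ 3 * (x ^ 2 + y ^ 2) + 30 * z ^ 2 * x * y * (x + y) + 20 * z * x * y * (x ^ 2 + y ^ 2)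

lemma T5_pat (c : V → Fin 3) : T5 (fun a b => pat (c a) (c b)) = polyP (sz c 0) (sz c 1) (sz c 2) := by
  have h1 : T5 (fun a b => pat (c a) (c b)) = ∑ κ : Fin 5 → Fin 3, (w5 κ : ℝ) * ∏ i, sz c (κ i) := by
    unfold T5
    have := sum_colour (V := V) c (fun κ : Fin 5 → Fin 3 => (w5 κ : ℝ))
    unfold sz
    rw [← this]
    refine Finset.sum_congr rfl fun y _ => ?_
    exact ind_Tri_w5 (fun i => c (y i))
  rw [h1, sum_key]
  simp only [tabP_eq]
  change (∑ p : Fin 6, ∑ q : Fin 6, ((tabP p q : ℤ) : ℝ) * (sz c 0 ^ p.val * sz c 1 ^ q.val * sz c 2 ^ (5 - p.val - q.val))) = _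
  simp only [Fin.sum_univ_six, tabP, polyP]
  norm_num
  ring

end poly

/-! ### Part sizes -/

lemma polyP_scale (t x y z : ℝ) : polyP (t * x) (t * y) (t * z) = t ^ 5 * polyP x y z := by
  unfold polyP; ring

lemma polyP_symm (x y z : ℝ) : polyP x y z = polyP y x z := by unfold polyP; ring

/-- upper bound with s = x + y -/
lemma polyP_bound {s z q : ℝ} (hs : 0 ≤ s) (hz : z = 1 - s) (hz0 : 0 ≤ z) (x y : ℝ) (hx : 0 ≤ x) (hy : 0 ≤ y) (hxy : x + y = s) (hq : q = (x - y) ^ 2 / 4) :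
    polyP x y z = (5 * z ^ 3 * s ^ 2 + 15 / 2 * z ^ 2 * s ^ 3 + 5 / 2 * z * s ^ 4) - 10 * z ^ 2 * (3 * s - 2 * z) * q - 40 * z * q ^ 2 := by
  subst hq hz
  have : s = x + y := hxy.symm
  subst this
  unfold polyP
  ring

set_option maxHeartbeats 1000000 in
lemma polyP_s {x y z : ℝ} (hx : 0 ≤ x) (hy : 0 ≤ y) (hz : 0 ≤ z) (h1 : x + y + z = 1) (hP : 0.5 ≤ polyP x y z) :
    0.5 ≤ x + y ∧ x + y ≤ 0.7 := by
  obtain ⟨s, hs⟩ : ∃ s, s = x + y := ⟨_, rfl⟩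
  have hz1 : z = 1 - s := by linarith
  have hs0 : 0 ≤ s := by linarith
  obtain ⟨q, hq⟩ : ∃ q, q = (x - y) ^ 2 / 4 := ⟨_, rfl⟩
  have hb := polyP_bound hs0 hz1 hz x y hx hy hs.symm hq
  have hq0 : 0 ≤ q := by rw [hq]; positivity
  have hq1 : q ≤ s ^ 2 / 4 := by
    rw [hq, hs]; nlinarith [mul_nonneg hx hy]
  rw [← hs]
  rw [hb] at hP
  have hs1 : s ≤ 1 := by linarith
  have hqz : 0 ≤ 40 * z * q ^ 2 := by positivity
  have big : ∀ h : 0.4 ≤ s, 0.5 ≤ 5 * z ^ 3 * s ^ 2 + 15 / 2 * z ^ 2 * s ^ 3 + 5 / 2 * z * s ^ 4 := by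
    intro h
    have : 0 ≤ 10 * z ^ 2 * (3 * s - 2 * z) * q := by
      have : 0 ≤ 3 * s - 2 * z := by rw [hz1]; linarith
      positivity
    linarith
  have e : 5 * z ^ 3 * s ^ 2 + 15 / 2 * z ^ 2 * s ^ 3 + 5 / 2 * z * s ^ 4 = 5 / 2 * s ^ 2 * (1 - s) * (2 - s) := by
    rw [hz1]; ring
  rw [e] at big hP
  constructor
  · by_contra hlt
    push Not at hlt
    rcases le_total 0.4 s with h | h
    · have hb := big h
      have a1 : s * (1 - s) ≤ 1 / 4 := by nlinarith [sq_nonneg (s - 1 / 2)]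
      have a2 : s * (2 - s) ≤ 3 / 4 := by nlinarith
      have a3 : 0 ≤ s * (2 - s) := mul_nonneg hs0 (by linarith)
      have := mul_le_mul a1 a2 a3 (by norm_num)
      nlinarith
    · have a0 : -(10 * z ^ 2 * (3 * s - 2 * z) * q) ≤ 10 * z ^ 2 * (2 - 5 * s) * (s ^ 2 / 4) := by
        have e2 : -(10 * z ^ 2 * (3 * s - 2 * z) * q) = 10 * z ^ 2 * (2 - 5 * s) * q := by rw [hz1]; ring
        rw [e2]
        have : 0 ≤ 10 * z ^ 2 * (2 - 5 * s) := mul_nonneg (by positivity) (by linarith)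
        exact mul_le_mul_of_nonneg_left hq1 this
      have a1 : s * (1 - s) ≤ 24 / 100 := by nlinarith
      have a2 : s * (4 - 8 * s + 5 * s ^ 2) ≤ 64 / 100 := by nlinarith [sq_nonneg (s - 0.4), mul_nonneg hs0 (sq_nonneg (s - 0.4))]
      have a3 : 0 ≤ s * (4 - 8 * s + 5 * s ^ 2) := mul_nonneg hs0 (by nlinarith [sq_nonneg (s - 0.8)])
      have a4 := mul_le_mul a1 a2 a3 (by norm_num)
      have e3 : 5 / 2 * s ^ 2 * (1 - s) * (2 - s) + 10 * z ^ 2 * (2 - 5 * s) * (s ^ 2 / 4) = 5 / 2 * (s * (1 - s) * (s * (4 - 8 * s + 5 * s ^ 2))) := by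
        rw [hz1]; ring
      linarith
  · by_contra hgt
    push Not at hgt
    have hb := big (by linarith)
    have a1 : s * (1 - s) ≤ 0.21 - 0.4 * (s - 0.7) := by nlinarith [sq_nonneg (s - 0.7)]
    have a2 : s * (2 - s) ≤ 0.91 + 0.6 * (s - 0.7) := by nlinarith [sq_nonneg (s - 0.7)]
    have a3 : 0 ≤ s * (2 - s) := mul_nonneg hs0 (by linarith)
    have a0 : 0 ≤ s * (1 - s) := mul_nonneg hs0 (by linarith)
    have a4 := mul_le_mul a1 a2 a3 (by linarith)
    have e3 : 5 / 2 * s ^ 2 * (1 - s) * (2 - s) = 5 / 2 * (s * (1 - s) * (s * (2 - s))) := by ring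
    have a5 : (0.21 - 0.4 * (s - 0.7)) * (0.91 + 0.6 * (s - 0.7)) ≤ 0.1911 := by
      obtain ⟨t, ht⟩ : ∃ t, t = s - 0.7 := ⟨_, rfl⟩
      rw [← ht]
      have : 0 < t := by linarith
      nlinarith [mul_pos this this]
    clear a1 a2 a3 a0 hqz hq1 hq hb e big
    rw [e3] at hP
    have a6 : 0 ≤ 10 * z ^ 2 * (3 * s - 2 * z) * q := by
      have : 0 ≤ 3 * s - 2 * z := by rw [hz1]; linarith
      positivity
    have a7 : 0 ≤ 40 * z * q ^ 2 := by positivity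
    norm_num at hP a5 a4
    linarith

lemma polyP_x {x y z : ℝ} (hx : 0 ≤ x) (hy : 0 ≤ y) (hz : 0 ≤ z) (h1 : x + y + z = 1) (hP : 0.5 ≤ polyP x y z) :
    1 / 50 ≤ x := by
  by_contra hlt
  push Not at hlt
  obtain ⟨s1, s2⟩ := polyP_s hx hy hz h1 hP
  obtain ⟨s, hs⟩ : ∃ s, s = x + y := ⟨_, rfl⟩
  rw [← hs] at s1 s2
  have hz1 : z = 1 - s := by linarith
  have e1 : x ^ 2 + y ^ 2 ≤ s ^ 2 := by rw [hs]; nlinarith [mul_nonneg hx hy]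
  have e2 : x * y ≤ s / 50 := by
    have : y ≤ s := by linarith
    nlinarith
  have hxy : 0 ≤ x * y := mul_nonneg hx hy
  have hs0 : 0 ≤ s := by linarith
  have b : polyP x y z ≤ 10 * z ^ 3 * s ^ 2 + 30 * z ^ 2 * (s / 50) * s + 20 * z * (s / 50) * s ^ 2 := by
    have : polyP x y z = 10 * z ^ 3 * (x ^ 2 + y ^ 2) + 30 * z ^ 2 * (x * y) * s + 20 * z * (x * y) * (x ^ 2 + y ^ 2) := by
      rw [hs]; unfold polyP; ring
    rw [this]
    gcongr
  have c1 : z * s ≤ 1 / 4 := by rw [hz1]; nlinarith [sq_nonneg (s - 1 / 2)]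
  have c0 : 0 ≤ z * s := mul_nonneg hz hs0
  have c2 : (z * s) ^ 2 ≤ (1 / 4) ^ 2 := pow_le_pow_left₀ c0 c1 2
  have c3 : z ≤ 1 / 2 := by linarith
  have d1 : 10 * z ^ 3 * s ^ 2 ≤ 10 * (1 / 2) * (1 / 4) ^ 2 := by
    calc _ = 10 * z * (z * s) ^ 2 := by ring
      _ ≤ _ := by gcongr
  have d2 : 30 * z ^ 2 * (s / 50) * s ≤ 3 / 5 * (1 / 4) ^ 2 := by
    calc _ = 3 / 5 * (z * s) ^ 2 := by ring
      _ ≤ _ := by gcongr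
  have d3 : 20 * z * (s / 50) * s ^ 2 ≤ 2 / 5 * (1 / 4) * 0.7 ^ 2 := by
    calc _ = 2 / 5 * (z * s) * s ^ 2 := by ring
      _ ≤ _ := by gcongr
  norm_num at d1 d2 d3 hP
  linarith

/-- sizes, homogeneous form -/
lemma polyP_sizes {N X Y Z : ℝ} (hN : 0 < N) (hX : 0 ≤ X) (hY : 0 ≤ Y) (hZ : 0 ≤ Z) (h1 : X + Y + Z = N) (hP : 0.5 * N ^ 5 ≤ polyP X Y Z) :
    ∃ x y z : ℝ, X = N * x ∧ Y = N * y ∧ Z = N * z ∧ x + y + z = 1 ∧ 1 / 50 ≤ x ∧ 1 / 50 ≤ y ∧ 0.3 ≤ z ∧ z ≤ 0.5 := by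
  have hx : X = N * (X / N) := by field_simp
  have hy : Y = N * (Y / N) := by field_simp
  have hz : Z = N * (Z / N) := by field_simp
  have hx0 : 0 ≤ X / N := by positivity
  have hy0 : 0 ≤ Y / N := by positivity
  have hz0 : 0 ≤ Z / N := by positivity
  have hs : X / N + Y / N + Z / N = 1 := by field_simp; exact h1
  have hp : 0.5 ≤ polyP (X / N) (Y / N) (Z / N) := by
    rw [hx, hy, hz, polyP_scale] at hP
    have : N ^ 5 * 0.5 ≤ N ^ 5 * polyP (X / N) (Y / N) (Z / N) := by linarith
    exact le_of_mul_le_mul_left this (by positivity)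
  have a := polyP_s hx0 hy0 hz0 hs hp
  have b := polyP_x hx0 hy0 hz0 hs hp
  have c := polyP_x hy0 hx0 hz0 (by linarith) (by rw [← polyP_symm]; exact hp)
  exact ⟨_, _, _, hx, hy, hz, hs, b, c, by linarith [a.2], by linarith [a.1]⟩

section minc
variable {V : Type*} [Fintype V]

/-- wrong degree of v when v gets colour k -/
noncomputable def wdk (A : V → V → Bool) (c : V → Fin 3) (v : V) (k : Fin 3) : ℝ :=
  ∑ u, ind (u ≠ v ∧ A v u ≠ pat k (c u))

lemma err_split (A : V → V → Bool) (hA : Gr A) (c : V → Fin 3) (v : V) :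
    ∑ a, ∑ b, er A c a b = 2 * wdk A c v (c v) + ∑ a, ∑ b, ind (a ≠ v) * (ind (b ≠ v) * er A c a b) := by
  have h1 : ∀ a b, er A c a b = ind (a = v) * er A c a b + ind (b = v) * (ind (a ≠ v) * er A c a b) + ind (a ≠ v) * (ind (b ≠ v) * er A c a b) := by
    intro a b
    by_cases ha : a = v
    · rw [ind_true ha, ind_false (not_not.mpr ha)]; ring
    · rw [ind_false ha, ind_true ha]
      by_cases hb : b = v
      · rw [ind_true hb, ind_false (not_not.mpr hb)]; ring
      · rw [ind_false hb, ind_true hb]; ring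
  have h2 : ∑ a, ∑ b, er A c a b = ∑ a, ∑ b, ind (a = v) * er A c a b + ∑ a, ∑ b, ind (b = v) * (ind (a ≠ v) * er A c a b) + ∑ a, ∑ b, ind (a ≠ v) * (ind (b ≠ v) * er A c a b) := by
    simp only [← Finset.sum_add_distrib]
    refine Finset.sum_congr rfl fun a _ => Finset.sum_congr rfl fun b _ => h1 a b
  have h3 : ∑ a, ∑ b, ind (a = v) * er A c a b = wdk A c v (c v) := by
    rw [Fintype.sum_eq_single v]
    · unfold wdk
      refine Finset.sum_congr rfl fun u _ => ?_
      rw [ind_true rfl, one_mul]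
      unfold er
      apply ind_congr
      rw [ne_comm]
    · intro a ha
      refine Finset.sum_eq_zero fun b _ => ?_
      rw [ind_false ha, zero_mul]
  have h4 : ∑ a, ∑ b, ind (b = v) * (ind (a ≠ v) * er A c a b) = wdk A c v (c v) := by
    rw [Finset.sum_comm, Fintype.sum_eq_single v]
    · unfold wdk
      refine Finset.sum_congr rfl fun u _ => ?_
      rw [ind_true rfl, one_mul]
      unfold er
      by_cases hu : u = v
      · rw [ind_false (not_not.mpr hu), ind_false (P := u ≠ v ∧ A v u ≠ pat (c v) (c u)) (fun h => h.1 hu), zero_mul]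
      · rw [ind_true (P := u ≠ v) hu, one_mul]
        apply ind_congr
        rw [hA.1 u v, pat_symm]
    · intro a ha
      refine Finset.sum_eq_zero fun b _ => ?_
      rw [ind_false ha, zero_mul]
  rw [h2, h3, h4]
  ring

theorem exists_min (A : V → V → Bool) (hA : Gr A) (e : ℝ) (h : ∃ c : V → Fin 3, ∑ a, ∑ b, er A c a b ≤ e) :
    ∃ c : V → Fin 3, ∑ a, ∑ b, er A c a b ≤ e ∧ ∀ v k, wdk A c v (c v) ≤ wdk A c v k := by
  obtain ⟨c, hc⟩ := Finite.exists_min (fun c : V → Fin 3 => ∑ a, ∑ b, er A c a b)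
  obtain ⟨c0, hc0⟩ := h
  refine ⟨c, (hc c0).trans hc0, fun v k => ?_⟩
  have h1 := hc (Function.update c v k)
  rw [err_split A hA c v, err_split A hA (Function.update c v k) v] at h1
  have e1 : wdk A (Function.update c v k) v (Function.update c v k v) = wdk A c v k := by
    unfold wdk
    refine Finset.sum_congr rfl fun u _ => ?_
    apply ind_congr
    rw [Function.update_self]
    refine and_congr_right fun hu => ?_
    rw [Function.update_of_ne hu]
  have e2 : ∑ a, ∑ b, ind (a ≠ v) * (ind (b ≠ v) * er A (Function.update c v k) a b) = ∑ a, ∑ b, ind (a ≠ v) * (ind (b ≠ v) * er A c a b) := by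
    refine Finset.sum_congr rfl fun a _ => Finset.sum_congr rfl fun b _ => ?_
    by_cases ha : a = v
    · rw [ind_false (not_not.mpr ha)]; ring
    by_cases hb : b = v
    · rw [ind_false (P := b ≠ v) (not_not.mpr hb)]; ring
    · unfold er
      rw [Function.update_of_ne ha, Function.update_of_ne hb]
  rw [e1, e2] at h1
  linarith

lemma wr_le (A : V → V → Bool) (c : V → Fin 3) (a b : V) : wr A c a b ≤ er A c a b + ind (a = b) := by
  unfold wr er
  by_cases h : a = b
  · rw [ind_true h]; linarith [ind_le_one (a = b ∨ A a b ≠ pat (c a) (c b)), ind_nonneg (a ≠ b ∧ A a b ≠ pat (c a) (c b))]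
  · rw [ind_false h, add_zero]
    apply ind_mono
    rintro (h' | h')
    · exact absurd h' h
    · exact ⟨h, h'⟩

lemma sum_wr_le (A : V → V → Bool) (c : V → Fin 3) : ∑ a, ∑ b, wr A c a b ≤ (∑ a, ∑ b, er A c a b) + NN V := by
  rw [← sumDiagV, ← Finset.sum_add_distrib]
  refine Finset.sum_le_sum fun a _ => ?_
  rw [← Finset.sum_add_distrib]
  exact Finset.sum_le_sum fun b _ => wr_le A c a b

lemma row_wr_le (A : V → V → Bool) (c : V → Fin 3) (v : V) : ∑ b, wr A c v b ≤ wdk A c v (c v) + 1 := by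
  have : ∑ b : V, ind (v = b) = 1 := by simp [ind]
  rw [← this]
  unfold wdk
  rw [← Finset.sum_add_distrib]
  refine Finset.sum_le_sum fun b _ => ?_
  refine (wr_le A c v b).trans ?_
  unfold er
  rw [ne_comm]

lemma dd_le_wr (A : V → V → Bool) (c : V → Fin 3) : dd A (fun a b => pat (c a) (c b)) ≤ ∑ a, ∑ b, wr A c a b :=
  Finset.sum_le_sum fun _ _ => Finset.sum_le_sum fun _ _ => ind_mono fun h => Or.inr h

end minc

/-! ### Vertices with large wrong degree -/

def phi (b0 b1 : Bool) : Fin 3 := cond b0 1 (cond b1 0 2)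

lemma phi_spec0 : ∀ k0 k1 k2 k3 k4 k5 m : Fin 3, ((pat k0 k1 == pat 0 1) && (pat k0 k2 == pat 0 1) && (pat k1 k2 == pat 1 1) && (pat k0 k3 == pat 0 2) &&
    (pat k1 k3 == pat 1 2) && (pat k0 k5 == pat 0 m) && (pat k1 k5 == pat 1 m) && (pat k3 k5 == pat 2 m)) = true →
    pat k4 k5 = pat (phi (pat k4 k0) (pat k4 k1)) m := by
  decide +kernel

lemma phi_spec : ∀ k0 k1 k2 k3 k4 k5 m : Fin 3, pat k0 k1 = pat 0 1 → pat k0 k2 = pat 0 1 → pat k1 k2 = pat 1 1 → pat k0 k3 = pat 0 2 →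
    pat k1 k3 = pat 1 2 → pat k0 k5 = pat 0 m → pat k1 k5 = pat 1 m → pat k3 k5 = pat 2 m →
    pat k4 k5 = pat (phi (pat k4 k0) (pat k4 k1)) m := by
  intro k0 k1 k2 k3 k4 k5 m h1 h2 h3 h4 h5 h6 h7 h8
  apply phi_spec0 k0 k1 k2 k3 k4 k5 m
  rw [h1, h2, h3, h4, h5, h6, h7, h8]
  simp

section wdeg
variable {V : Type*} [Fintype V]

lemma wr_nonneg (A : V → V → Bool) (c : V → Fin 3) (a b : V) : 0 ≤ wr A c a b := ind_nonneg _

lemma wr_zero {A : V → V → Bool} {c : V → Fin 3} {a b : V} (h : ¬ (1 ≤ wr A c a b)) : a ≠ b ∧ A a b = pat (c a) (c b) := by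
  by_contra hc
  apply h
  unfold wr
  rw [ind_true]
  by_contra h'
  push Not at h'
  exact hc h'

lemma one_le_pairs {n : ℕ} (g : V → V → ℝ) (hg : ∀ a b, 0 ≤ g a b) (y : Fin n → V) (i j : Fin n) (hij : i < j) (h : 1 ≤ g (y i) (y j)) :
    1 ≤ ∑ i, ∑ j, (if i < j then g (y i) (y j) else 0) := by
  have hnn : ∀ i j : Fin n, 0 ≤ (if i < j then g (y i) (y j) else 0) := by
    intro i j; split_ifs; exact hg _ _; exact le_rfl
  calc (1 : ℝ) ≤ (if i < j then g (y i) (y j) else 0) := by rw [if_pos hij]; exact h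
    _ ≤ ∑ j, (if i < j then g (y i) (y j) else 0) :=
      Finset.single_le_sum (f := fun j => if i < j then g (y i) (y j) else 0) (fun j _ => hnn i j) (Finset.mem_univ j)
    _ ≤ _ := Finset.single_le_sum (f := fun i => ∑ j, if i < j then g (y i) (y j) else 0)
      (fun i _ => Finset.sum_nonneg fun j _ => hnn i j) (Finset.mem_univ i)

lemma pairs_nonneg {n : ℕ} (g : V → V → ℝ) (hg : ∀ a b, 0 ≤ g a b) (y : Fin n → V) :
    0 ≤ ∑ i, ∑ j, (if i < j then g (y i) (y j) else 0) := by
  refine Finset.sum_nonneg fun i _ => Finset.sum_nonneg fun j _ => ?_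
  split_ifs; exact hg _ _; exact le_rfl

lemma sumX5 (F : (Fin 5 → V) → ℝ) : ∑ y, F y = ∑ t : Fin 4 → V, ∑ u, F ![t 0, t 1, t 2, t 3, u] := by
  simp only [tup_sum_cons, sum_zero_tuple]
  rfl

lemma wdeg_point (A : V → V → Bool) (c : V → Fin 3) (v u : V) (t : Fin 4 → V) :
    (∏ i, ind (c (t i) = (![0, 1, 1, 2] : Fin 4 → Fin 3) i)) * ind (u ≠ v ∧ A v u ≠ pat (phi (A v (t 0)) (A v (t 1))) (c u)) ≤
      ind (Bad (onT A ![t 0, t 1, t 2, t 3, v, u])) + ∑ i, ∑ j, (if i < j then wr A c ((![t 0, t 1, t 2, t 3, u] : Fin 5 → V) i) ((![t 0, t 1, t 2, t 3, u] : Fin 5 → V) j) else 0) := by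
  set y : Fin 5 → V := ![t 0, t 1, t 2, t 3, u] with hy
  have hR : 0 ≤ ∑ i, ∑ j, (if i < j then wr A c (y i) (y j) else 0) := pairs_nonneg _ (wr_nonneg A c) y
  have hB := ind_nonneg (Bad (onT A ![t 0, t 1, t 2, t 3, v, u]))
  have hP1 : (∏ i, ind (c (t i) = (![0, 1, 1, 2] : Fin 4 → Fin 3) i)) ≤ 1 := Finset.prod_le_one (fun _ _ => ind_nonneg _) (fun _ _ => ind_le_one _)
  have hP0 : 0 ≤ (∏ i, ind (c (t i) = (![0, 1, 1, 2] : Fin 4 → Fin 3) i)) := Finset.prod_nonneg (fun _ _ => ind_nonneg _)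
  have hL : (∏ i, ind (c (t i) = (![0, 1, 1, 2] : Fin 4 → Fin 3) i)) * ind (u ≠ v ∧ A v u ≠ pat (phi (A v (t 0)) (A v (t 1))) (c u)) ≤ 1 :=
    mul_le_one₀ hP1 (ind_nonneg _) (ind_le_one _)
  by_cases hw : ∃ i j : Fin 5, i < j ∧ 1 ≤ wr A c (y i) (y j)
  · obtain ⟨i, j, hij, hw⟩ := hw
    have := one_le_pairs _ (wr_nonneg A c) y i j hij hw
    linarith
  push Not at hw
  by_cases hu : u ≠ v ∧ A v u ≠ pat (phi (A v (t 0)) (A v (t 1))) (c u)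
  swap
  · rw [ind_false hu, mul_zero]; linarith
  by_cases hc : ∀ i, c (t i) = (![0, 1, 1, 2] : Fin 4 → Fin 3) i
  swap
  · push Not at hc
    obtain ⟨i, hi⟩ := hc
    rw [Finset.prod_eq_zero (Finset.mem_univ i) (ind_false hi), zero_mul]; linarith
  have c0 : c (t 0) = 0 := hc 0
  have c1 : c (t 1) = 1 := hc 1
  have c2 : c (t 2) = 1 := hc 2
  have c3 : c (t 3) = 2 := hc 3
  have hbad : Bad (onT A ![t 0, t 1, t 2, t 3, v, u]) := by
    rintro ⟨κ, hκ⟩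
    apply hu.2
    have q : ∀ i j, i ≠ j → A ((![t 0, t 1, t 2, t 3, v, u] : Fin 6 → V) i) ((![t 0, t 1, t 2, t 3, v, u] : Fin 6 → V) j) = pat (κ i) (κ j) := hκ
    have w : ∀ i j : Fin 5, i < j → A (y i) (y j) = pat (c (y i)) (c (y j)) := fun i j hij => (wr_zero (not_le.mpr (hw i j hij))).2
    have q01 : A (t 0) (t 1) = _ := q 0 1 (by decide)
    have q02 : A (t 0) (t 2) = _ := q 0 2 (by decide)
    have q12 : A (t 1) (t 2) = _ := q 1 2 (by decide)
    have q03 : A (t 0) (t 3) = _ := q 0 3 (by decide)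
    have q13 : A (t 1) (t 3) = _ := q 1 3 (by decide)
    have q05 : A (t 0) u = _ := q 0 5 (by decide)
    have q15 : A (t 1) u = _ := q 1 5 (by decide)
    have q35 : A (t 3) u = _ := q 3 5 (by decide)
    have q40 : A v (t 0) = _ := q 4 0 (by decide)
    have q41 : A v (t 1) = _ := q 4 1 (by decide)
    have q45 : A v u = _ := q 4 5 (by decide)
    have w01 : A (t 0) (t 1) = pat (c (t 0)) (c (t 1)) := w 0 1 (by decide)
    have w02 : A (t 0) (t 2) = pat (c (t 0)) (c (t 2)) := w 0 2 (by decide)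
    have w12 : A (t 1) (t 2) = pat (c (t 1)) (c (t 2)) := w 1 2 (by decide)
    have w03 : A (t 0) (t 3) = pat (c (t 0)) (c (t 3)) := w 0 3 (by decide)
    have w13 : A (t 1) (t 3) = pat (c (t 1)) (c (t 3)) := w 1 3 (by decide)
    have w05 : A (t 0) u = pat (c (t 0)) (c u) := w 0 4 (by decide)
    have w15 : A (t 1) u = pat (c (t 1)) (c u) := w 1 4 (by decide)
    have w35 : A (t 3) u = pat (c (t 3)) (c u) := w 3 4 (by decide)
    rw [c0, c1] at w01
    rw [c0, c2] at w02
    rw [c1, c2] at w12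
    rw [c0, c3] at w03
    rw [c1, c3] at w13
    rw [c0] at w05
    rw [c1] at w15
    rw [c3] at w35
    rw [q45, q40, q41]
    exact phi_spec (κ 0) (κ 1) (κ 2) (κ 3) (κ 4) (κ 5) (c u) (q01.symm.trans w01) (q02.symm.trans w02) (q12.symm.trans w12)
      (q03.symm.trans w03) (q13.symm.trans w13) (q05.symm.trans w05) (q15.symm.trans w15) (q35.symm.trans w35)
  rw [ind_true hbad]
  linarith

lemma sum_col4 (c : V → Fin 3) : ∑ t : Fin 4 → V, ∏ i, ind (c (t i) = (![0, 1, 1, 2] : Fin 4 → Fin 3) i) = sz c 0 * sz c 1 * sz c 1 * sz c 2 := by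
  have h := Finset.prod_univ_sum (fun _ : Fin 4 => (Finset.univ : Finset V)) (fun i v => ind (c v = (![0, 1, 1, 2] : Fin 4 → Fin 3) i))
  rw [Fintype.piFinset_univ] at h
  rw [← h, Fin.prod_univ_four]
  rfl

theorem wdeg_bound (A : V → V → Bool) (c : V → Fin 3) (v : V) (g : ℝ) (hg : ∀ k, g ≤ wdk A c v k) :
    sz c 0 * sz c 1 * sz c 1 * sz c 2 * g ≤ badv A v + 10 * NN V ^ 3 * ∑ a, ∑ b, wr A c a b := by
  have h1 : ∑ y : Fin 5 → V, ∑ i, ∑ j, (if i < j then wr A c (y i) (y j) else 0) = 10 * NN V ^ 3 * ∑ a, ∑ b, wr A c a b := by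
    rw [pairs_sum (m := 3) (wr A c)]
    have : (∑ i : Fin (3 + 2), ∑ j : Fin (3 + 2), if i < j then 1 else 0 : ℕ) = 10 := by decide
    rw [this]
    push_cast
    ring
  rw [← h1, sumX5, badv_eq, ← Finset.sum_add_distrib, ← sum_col4, Finset.sum_mul]
  refine Finset.sum_le_sum fun t _ => ?_
  rw [← Finset.sum_add_distrib]
  refine le_trans ?_ (Finset.sum_le_sum fun u _ => wdeg_point A c v u t)
  rw [← Finset.mul_sum]
  exact mul_le_mul_of_nonneg_left (hg _) (Finset.prod_nonneg fun _ _ => ind_nonneg _)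

end wdeg

/-! ### Flipping a wrong pair -/

lemma e5_sum (a : Fin 5 → Fin 5 → Bool) (hs : ∀ i j, a i j = a j i) (hd : ∀ i, a i i = false) :
    2 * e5 a = ∑ i, ∑ j, bn (a i j) := by
  rw [e5_expand]
  simp only [Fin.sum_univ_five, hd, hs 1 0, hs 2 0, hs 2 1, hs 3 0, hs 3 1, hs 3 2, hs 4 0, hs 4 1, hs 4 2, hs 4 3]
  have : bn false = 0 := rfl
  rw [this]
  ring

lemma Tri_perm (a : Fin 5 → Fin 5 → Bool) (hs : ∀ i j, a i j = a j i) (hd : ∀ i, a i i = false) (p : Equiv.Perm (Fin 5)) :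
    Tri (fun i j => a (p i) (p j)) ↔ Tri a := by
  have h1 := e5_sum a hs hd
  have h2 := e5_sum (fun i j => a (p i) (p j)) (fun i j => hs _ _) (fun i => hd _)
  have h3 : ∑ i, ∑ j, bn (a (p i) (p j)) = ∑ i, ∑ j, bn (a i j) := by
    rw [← Equiv.sum_comp p (fun i => ∑ j, bn (a i j))]
    refine Finset.sum_congr rfl fun i _ => ?_
    exact Equiv.sum_comp p (fun j => bn (a (p i) j))
  unfold Tri
  omega

lemma t5b_mem (b : Bool) (k0 k1 k2 k3 k4 : Fin 3) : 0 ≤ t5b b k0 k1 k2 k3 k4 ∧ t5b b k0 k1 k2 k3 k4 ≤ 1 := by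
  unfold t5b
  cases Nat.beq _ 3 <;> decide

lemma ind_beq (m : ℕ) : ind (m = 3) = ((cond (Nat.beq m 3) 1 0 : ℤ) : ℝ) := by
  by_cases h : m = 3
  · subst h; rw [ind_true rfl]; simp
  · rw [ind_false h]
    have : Nat.beq m 3 = false := by
      rw [Bool.eq_false_iff]
      intro h'
      exact h (Nat.eq_of_beq_eq_true h')
    rw [this]; simp

section flip
variable {V : Type*} [Fintype V]

noncomputable def flipA (A : V → V → Bool) (u v : V) : V → V → Bool :=
  fun a b => if (a = u ∧ b = v) ∨ (a = v ∧ b = u) then !A a b else A a b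

lemma flip_Gr {A : V → V → Bool} (hA : Gr A) {u v : V} (huv : u ≠ v) : Gr (flipA A u v) := by
  refine ⟨fun a b => ?_, fun a => ?_⟩
  · unfold flipA
    rw [hA.1 a b]
    have : ((a = u ∧ b = v) ∨ (a = v ∧ b = u)) ↔ ((b = u ∧ a = v) ∨ (b = v ∧ a = u)) := by tauto
    simp only [this]
  · unfold flipA
    rw [if_neg, hA.2]
    rintro (⟨h1, h2⟩ | ⟨h1, h2⟩)
    · exact huv (h1.symm.trans h2)
    · exact huv (h2.symm.trans h1)

lemma flip_dd (A : V → V → Bool) (u v : V) : dd A (flipA A u v) ≤ 2 := by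
  unfold dd
  have h : ∀ a b, ind (A a b ≠ flipA A u v a b) ≤ ind (a = u) * ind (b = v) + ind (a = v) * ind (b = u) := by
    intro a b
    by_cases h : (a = u ∧ b = v) ∨ (a = v ∧ b = u)
    · rcases h with ⟨h1, h2⟩ | ⟨h1, h2⟩
      · rw [ind_true h1, ind_true h2]
        have := ind_le_one (A a b ≠ flipA A u v a b)
        have := mul_nonneg (ind_nonneg (a = v)) (ind_nonneg (b = u))
        linarith
      · rw [ind_true h1, ind_true h2]
        have := ind_le_one (A a b ≠ flipA A u v a b)
        have := mul_nonneg (ind_nonneg (a = u)) (ind_nonneg (b = v))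
        linarith
    · rw [ind_false]
      · exact add_nonneg (mul_nonneg (ind_nonneg _) (ind_nonneg _)) (mul_nonneg (ind_nonneg _) (ind_nonneg _))
      · unfold flipA
        rw [if_neg h]
        exact fun h => h rfl
  have hs : ∀ x : V, ∑ a, ind (a = x) = 1 := by intro x; simp [ind]
  calc _ ≤ ∑ a, ∑ b, (ind (a = u) * ind (b = v) + ind (a = v) * ind (b = u)) :=
        Finset.sum_le_sum fun a _ => Finset.sum_le_sum fun b _ => h a b
    _ = 2 := by
        simp only [Finset.sum_add_distrib, ← Finset.mul_sum, ← Finset.sum_mul, hs]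
        norm_num

noncomputable def fD (A B : V → V → Bool) (y : Fin 5 → V) : ℝ :=
  ind (Function.Injective y) * (ind (Tri (onT B y)) - ind (Tri (onT A y)))

lemma fD_perm {A B : V → V → Bool} (hA : Gr A) (hB : Gr B) (p : Equiv.Perm (Fin 5)) (y : Fin 5 → V) :
    fD A B (fun i => y (p i)) = fD A B y := by
  unfold fD
  have h1 : Function.Injective (fun i => y (p i)) ↔ Function.Injective y := by
    constructor
    · intro h i j hij
      have := @h (p.symm i) (p.symm j) (by simpa using hij)
      simpa using this
    · intro h; exact h.comp p.injective
  have h2 : Tri (onT A (fun i => y (p i))) ↔ Tri (onT A y) := Tri_perm (onT A y) (fun i j => hA.1 _ _) (fun i => hA.2 _) p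
  have h3 : Tri (onT B (fun i => y (p i))) ↔ Tri (onT B y) := Tri_perm (onT B y) (fun i j => hB.1 _ _) (fun i => hB.2 _) p
  rw [ind_congr h1, ind_congr h2, ind_congr h3]

lemma flip_exact (A : V → V → Bool) (hA : Gr A) (u v : V) (huv : u ≠ v) :
    Tinj (flipA A u v) - Tinj A = 20 * ∑ w : Fin 3 → V, fD A (flipA A u v) ![u, v, w 0, w 1, w 2] := by
  set B := flipA A u v with hBd
  have hB : Gr B := flip_Gr hA huv
  have h0 : Tinj B - Tinj A = ∑ y, fD A B y := by
    unfold Tinj fD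
    rw [← Finset.sum_sub_distrib]
    exact Finset.sum_congr rfl fun y _ => by ring
  have h1 : ∀ y, fD A B y = ∑ i, ∑ j, fD A B y * (ind (y i = u) * ind (y j = v)) := by
    intro y
    simp only [← Finset.mul_sum, ← Finset.sum_mul]
    by_cases hy : Function.Injective y
    · rw [← ind_ex_eq y hy, ← ind_ex_eq y hy]
      by_cases hu : ∃ i, y i = u
      · by_cases hv : ∃ i, y i = v
        · rw [ind_true hu, ind_true hv]; ring
        · rw [ind_false hv]
          have : onT B y = onT A y := by
            funext i j
            simp only [onT, hBd, flipA]
            rw [if_neg]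
            rintro (⟨h1, h2⟩ | ⟨h1, h2⟩)
            · exact hv ⟨_, h2⟩
            · exact hv ⟨_, h1⟩
          unfold fD
          rw [this]; ring
      · rw [ind_false hu]
        have : onT B y = onT A y := by
          funext i j
          simp only [onT, hBd, flipA]
          rw [if_neg]
          rintro (⟨h1, h2⟩ | ⟨h1, h2⟩)
          · exact hu ⟨_, h1⟩
          · exact hu ⟨_, h2⟩
        unfold fD
        rw [this]; ring
    · unfold fD
      rw [ind_false hy]; ring
  have h2 : ∀ i j : Fin 5, ∑ y, fD A B y * (ind (y i = u) * ind (y j = v)) =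
      (if i ≠ j then 1 else 0) * ∑ y, fD A B y * (ind (y 0 = u) * ind (y 1 = v)) := by
    intro i j
    by_cases hij : i = j
    · subst hij
      rw [if_neg (by simp), zero_mul]
      refine Finset.sum_eq_zero fun y _ => ?_
      by_cases h : y i = u
      · rw [ind_false (P := y i = v) (by rw [h]; exact huv)]; ring
      · rw [ind_false h]; ring
    · rw [if_pos hij, one_mul]
      obtain ⟨p, hp0, hp1⟩ := exists_perm01 (m := 3) i j hij
      rw [← sum_reperm p (fun y => fD A B y * (ind (y 0 = u) * ind (y 1 = v)))]
      refine Finset.sum_congr rfl fun y _ => ?_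
      show _ = fD A B (fun i => y (p i)) * (ind (y (p 0) = u) * ind (y (p 1) = v))
      rw [fD_perm hA hB, hp0, hp1]
  have h3 : ∑ y, fD A B y * (ind (y 0 = u) * ind (y 1 = v)) = ∑ w : Fin 3 → V, fD A B ![u, v, w 0, w 1, w 2] := by
    rw [tup_sum_cons]
    rw [Fintype.sum_eq_single u]
    · rw [tup_sum_cons, Fintype.sum_eq_single v]
      · refine Finset.sum_congr rfl fun w _ => ?_
        have : (Fin.cons u (Fin.cons v w : Fin 4 → V) : Fin 5 → V) = ![u, v, w 0, w 1, w 2] := by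
          funext i; fin_cases i <;> rfl
        rw [this]
        rw [ind_true (P := (![u, v, w 0, w 1, w 2] : Fin 5 → V) 0 = u) rfl, ind_true (P := (![u, v, w 0, w 1, w 2] : Fin 5 → V) 1 = v) rfl]
        ring
      · intro b hb
        refine Finset.sum_eq_zero fun w _ => ?_
        rw [ind_false (P := (Fin.cons u (Fin.cons b w : Fin 4 → V) : Fin 5 → V) 1 = v) hb]; ring
    · intro b hb
      refine Finset.sum_eq_zero fun w _ => ?_
      rw [ind_false (P := (Fin.cons b w : Fin 5 → V) 0 = u) hb]; ring
  rw [h0, Finset.sum_congr rfl (fun y _ => h1 y), Finset.sum_comm]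
  have h4 : ∀ i : Fin 5, ∑ y, ∑ j, fD A B y * (ind (y i = u) * ind (y j = v)) =
      ∑ j : Fin 5, (if i ≠ j then 1 else 0) * ∑ y, fD A B y * (ind (y 0 = u) * ind (y 1 = v)) := by
    intro i
    rw [Finset.sum_comm]
    exact Finset.sum_congr rfl fun j _ => h2 i j
  rw [Finset.sum_congr rfl (fun i _ => h4 i), h3]
  simp only [← Finset.sum_mul]
  congr 1
  have : (∑ i : Fin 5, ∑ j : Fin 5, if i ≠ j then 1 else 0 : ℕ) = 20 := by decide
  exact_mod_cast this

lemma flip_point (A : V → V → Bool) (hA : Gr A) (c : V → Fin 3) (u v : V) (huv : u ≠ v) (hw : A u v ≠ pat (c u) (c v)) (w : Fin 3 → V) :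
    (t5b (pat (c u) (c v)) (c u) (c v) (c (w 0)) (c (w 1)) (c (w 2)) - t5b (!pat (c u) (c v)) (c u) (c v) (c (w 0)) (c (w 1)) (c (w 2)) : ℝ)
      - 2 * ((∑ i, wr A c u (w i)) + (∑ i, wr A c v (w i)) + ∑ i, ∑ j, (if i < j then wr A c (w i) (w j) else 0))
      ≤ fD A (flipA A u v) ![u, v, w 0, w 1, w 2] := by
  set y : Fin 5 → V := ![u, v, w 0, w 1, w 2] with hy
  have hE1 : 0 ≤ ∑ i, wr A c u (w i) := Finset.sum_nonneg fun i _ => wr_nonneg A c _ _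
  have hE2 : 0 ≤ ∑ i, wr A c v (w i) := Finset.sum_nonneg fun i _ => wr_nonneg A c _ _
  have hE3 := pairs_nonneg _ (wr_nonneg A c) w
  by_cases hE : 1 ≤ (∑ i, wr A c u (w i)) + (∑ i, wr A c v (w i)) + ∑ i, ∑ j, (if i < j then wr A c (w i) (w j) else 0)
  · have b1 := (t5b_mem (pat (c u) (c v)) (c u) (c v) (c (w 0)) (c (w 1)) (c (w 2))).2
    have b2 := (t5b_mem (!pat (c u) (c v)) (c u) (c v) (c (w 0)) (c (w 1)) (c (w 2))).1
    have b1' : (t5b (pat (c u) (c v)) (c u) (c v) (c (w 0)) (c (w 1)) (c (w 2)) : ℝ) ≤ 1 := by exact_mod_cast b1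
    have b2' : (0 : ℝ) ≤ t5b (!pat (c u) (c v)) (c u) (c v) (c (w 0)) (c (w 1)) (c (w 2)) := by exact_mod_cast b2
    have b3 : -1 ≤ fD A (flipA A u v) y := by
      unfold fD
      have i1 := ind_nonneg (Function.Injective y)
      have i2 := ind_le_one (Function.Injective y)
      have i3 := ind_nonneg (Tri (onT (flipA A u v) y))
      have i4 := ind_le_one (Tri (onT A y))
      nlinarith
    linarith
  have hu : ∀ i, u ≠ w i ∧ A u (w i) = pat (c u) (c (w i)) := by
    intro i
    apply wr_zero
    intro h
    have := Finset.single_le_sum (f := fun i => wr A c u (w i)) (fun i _ => wr_nonneg A c _ _) (Finset.mem_univ i)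
    linarith
  have hv : ∀ i, v ≠ w i ∧ A v (w i) = pat (c v) (c (w i)) := by
    intro i
    apply wr_zero
    intro h
    have := Finset.single_le_sum (f := fun i => wr A c v (w i)) (fun i _ => wr_nonneg A c _ _) (Finset.mem_univ i)
    linarith
  have hww : ∀ i j, i < j → w i ≠ w j ∧ A (w i) (w j) = pat (c (w i)) (c (w j)) := by
    intro i j hij
    apply wr_zero
    intro h
    have := one_le_pairs _ (wr_nonneg A c) w i j hij h
    linarith
  have hinj : Function.Injective y := by
    have hlt : ∀ i j : Fin 5, i < j → y i ≠ y j := by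
      intro i j hij
      fin_cases i <;> fin_cases j <;> first
        | (exact absurd hij (by decide))
        | exact huv
        | exact (hu 0).1
        | exact (hu 1).1
        | exact (hu 2).1
        | exact (hv 0).1
        | exact (hv 1).1
        | exact (hv 2).1
        | exact (hww 0 1 (by decide)).1
        | exact (hww 0 2 (by decide)).1
        | exact (hww 1 2 (by decide)).1
    intro i j h
    rcases lt_trichotomy i j with h' | h' | h'
    · exact absurd h (hlt i j h')
    · exact h'
    · exact absurd h.symm (hlt j i h')
  have hAuv : A u v = !pat (c u) (c v) := by
    cases h1 : A u v <;> cases h2 : pat (c u) (c v) <;> simp_all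
  have hf : ∀ i j : Fin 5, 1 < j → flipA A u v (y i) (y j) = A (y i) (y j) := by
    intro i j hj
    unfold flipA
    rw [if_neg]
    rintro (⟨-, h2⟩ | ⟨-, h2⟩)
    · have h : j = 1 := hinj (h2 : y j = y 1)
      subst h; exact absurd hj (by decide)
    · have h : j = 0 := hinj (h2 : y j = y 0)
      subst h; exact absurd hj (by decide)
  have hf01 : flipA A u v u v = pat (c u) (c v) := by
    unfold flipA
    rw [if_pos (Or.inl ⟨rfl, rfl⟩), hAuv, Bool.not_not]
  have hTA : ind (Tri (onT A y)) = t5b (!pat (c u) (c v)) (c u) (c v) (c (w 0)) (c (w 1)) (c (w 2)) := by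
    unfold Tri
    rw [ind_beq, e5_expand]
    show (((cond (Nat.beq (bn (A u v) + bn (A u (w 0)) + bn (A u (w 1)) + bn (A u (w 2)) + bn (A v (w 0)) + bn (A v (w 1)) + bn (A v (w 2))
      + bn (A (w 0) (w 1)) + bn (A (w 0) (w 2)) + bn (A (w 1) (w 2))) 3) 1 0 : ℤ)) : ℝ) = _
    rw [hAuv, (hu 0).2, (hu 1).2, (hu 2).2, (hv 0).2, (hv 1).2, (hv 2).2, (hww 0 1 (by decide)).2, (hww 0 2 (by decide)).2, (hww 1 2 (by decide)).2]
    rfl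
  have hTB : ind (Tri (onT (flipA A u v) y)) = t5b (pat (c u) (c v)) (c u) (c v) (c (w 0)) (c (w 1)) (c (w 2)) := by
    unfold Tri
    rw [ind_beq, e5_expand]
    simp only [onT]
    rw [hf 0 2 (by decide), hf 0 3 (by decide), hf 0 4 (by decide), hf 1 2 (by decide), hf 1 3 (by decide), hf 1 4 (by decide),
      hf 2 3 (by decide), hf 2 4 (by decide), hf 3 4 (by decide)]
    show (((cond (Nat.beq (bn (flipA A u v u v) + bn (A u (w 0)) + bn (A u (w 1)) + bn (A u (w 2)) + bn (A v (w 0)) + bn (A v (w 1)) + bn (A v (w 2))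
      + bn (A (w 0) (w 1)) + bn (A (w 0) (w 2)) + bn (A (w 1) (w 2))) 3) 1 0 : ℤ)) : ℝ) = _
    rw [hf01, (hu 0).2, (hu 1).2, (hu 2).2, (hv 0).2, (hv 1).2, (hv 2).2, (hww 0 1 (by decide)).2, (hww 0 2 (by decide)).2, (hww 1 2 (by decide)).2]
    rfl
  unfold fD
  rw [ind_true hinj, hTA, hTB]
  linarith

/-- sum over colourings of the flip gain -/
def tabL (k l : Fin 3) (p q : Fin 4) : ℤ :=
  ∑ κ : Fin 3 → Fin 3, if cnt 0 κ = p.val ∧ cnt 1 κ = q.val then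
    t5b (pat k l) k l (κ 0) (κ 1) (κ 2) - t5b (!pat k l) k l (κ 0) (κ 1) (κ 2) else 0

def polyL (k l : Fin 3) (x y z : ℝ) : ℝ := ∑ p : Fin 4, ∑ q : Fin 4, (tabL k l p q : ℝ) * (x ^ p.val * y ^ q.val * z ^ (3 - p.val - q.val))

lemma sum_flipT (c : V → Fin 3) (k l : Fin 3) :
    ∑ w : Fin 3 → V, (t5b (pat k l) k l (c (w 0)) (c (w 1)) (c (w 2)) - t5b (!pat k l) k l (c (w 0)) (c (w 1)) (c (w 2)) : ℝ)
      = polyL k l (sz c 0) (sz c 1) (sz c 2) := by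
  have h := sum_colour (V := V) c (fun κ : Fin 3 → Fin 3 => ((t5b (pat k l) k l (κ 0) (κ 1) (κ 2) - t5b (!pat k l) k l (κ 0) (κ 1) (κ 2) : ℤ) : ℝ))
  have h' := sum_key (sz c) (fun κ : Fin 3 → Fin 3 => t5b (pat k l) k l (κ 0) (κ 1) (κ 2) - t5b (!pat k l) k l (κ 0) (κ 1) (κ 2))
  have h2 := h.trans h'
  push_cast at h2
  rw [h2]
  unfold polyL tabL
  push_cast
  rfl

end flip

/-! ### Flip gains are positive -/

def tabM (k l : Fin 3) (p q : Fin 4) : ℤ :=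
  (([[1, 3, 0, 0, 0, 6, 0, 0, 0, 0, 0, 0, 0, 0, 0, 0],
    [-1, 3, 3, -1, 3, -6, 0, 0, 3, 0, 0, 0, -1, 0, 0, 0],
    [0, 0, 3, 1, 3, 6, 0, 0, 0, 3, 0, 0, 0, 0, 0, 0],
    [-1, 3, 3, -1, 3, -6, 0, 0, 3, 0, 0, 0, -1, 0, 0, 0],
    [1, 0, 0, 0, 3, 6, 0, 0, 0, 0, 0, 0, 0, 0, 0, 0],
    [0, 3, 0, 0, 0, 6, 3, 0, 3, 0, 0, 0, 1, 0, 0, 0],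
    [0, 0, 3, 1, 3, 6, 0, 0, 0, 3, 0, 0, 0, 0, 0, 0],
    [0, 3, 0, 0, 0, 6, 3, 0, 3, 0, 0, 0, 1, 0, 0, 0],
    [0, 0, 3, 0, 0, -6, 3, 0, 3, 3, 0, 0, 0, 0, 0, 0]] : List (List ℤ)).getD (3 * k.val + l.val) []).getD (4 * p.val + q.val) 0

lemma tabL_eq : ∀ k l : Fin 3, ∀ p q : Fin 4, tabL k l p q = tabM k l p q := by
  unfold tabL
  simp only [tup_sum_cons, sum_zero_tuple]
  decide +kernel

lemma polyL_M (k l : Fin 3) (x y z : ℝ) : polyL k l x y z = ∑ p : Fin 4, ∑ q : Fin 4, (tabM k l p q : ℝ) * (x ^ p.val * y ^ q.val * z ^ (3 - p.val - q.val)) := by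
  unfold polyL
  simp only [tabL_eq]

lemma polyL_00 (x y z : ℝ) : polyL 0 0 x y z = z ^ 3 + 6 * x * y * z + 3 * y * z ^ 2 := by
  rw [polyL_M]; simp [Fin.sum_univ_four, tabM]; ring
lemma polyL_11 (x y z : ℝ) : polyL 1 1 x y z = z ^ 3 + 6 * x * y * z + 3 * x * z ^ 2 := by
  rw [polyL_M]; simp [Fin.sum_univ_four, tabM]; ring
lemma polyL_01 (x y z : ℝ) : polyL 0 1 x y z = 3 * z * (x - y) ^ 2 + 3 * z ^ 2 * (x + y) - z ^ 3 - x ^ 3 - y ^ 3 := by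
  rw [polyL_M]; simp [Fin.sum_univ_four, tabM]; ring
lemma polyL_10 (x y z : ℝ) : polyL 1 0 x y z = 3 * z * (x - y) ^ 2 + 3 * z ^ 2 * (x + y) - z ^ 3 - x ^ 3 - y ^ 3 := by
  rw [polyL_M]; simp [Fin.sum_univ_four, tabM]; ring
lemma polyL_02 (x y z : ℝ) : polyL 0 2 x y z = 3 * x * z ^ 2 + 6 * x * y * z + 3 * y ^ 2 * z + 3 * x ^ 2 * y + y ^ 3 := by
  rw [polyL_M]; simp [Fin.sum_univ_four, tabM]; ring
lemma polyL_20 (x y z : ℝ) : polyL 2 0 x y z = 3 * x * z ^ 2 + 6 * x * y * z + 3 * y ^ 2 * z + 3 * x ^ 2 * y + y ^ 3 := by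
  rw [polyL_M]; simp [Fin.sum_univ_four, tabM]; ring
lemma polyL_12 (x y z : ℝ) : polyL 1 2 x y z = 3 * y * z ^ 2 + 6 * x * y * z + 3 * x ^ 2 * z + 3 * y ^ 2 * x + x ^ 3 := by
  rw [polyL_M]; simp [Fin.sum_univ_four, tabM]; ring
lemma polyL_21 (x y z : ℝ) : polyL 2 1 x y z = 3 * y * z ^ 2 + 6 * x * y * z + 3 * x ^ 2 * z + 3 * y ^ 2 * x + x ^ 3 := by
  rw [polyL_M]; simp [Fin.sum_univ_four, tabM]; ring
lemma polyL_22 (x y z : ℝ) : polyL 2 2 x y z = 3 * z * (x - y) ^ 2 + 3 * x * y * (x + y) := by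
  rw [polyL_M]; simp [Fin.sum_univ_four, tabM]; ring

set_option maxHeartbeats 1000000 in
lemma polyL_pos (k l : Fin 3) {N x y z : ℝ} (hN : 0 < N) (h1 : x + y + z = 1) (hx : 1 / 50 ≤ x) (hy : 1 / 50 ≤ y) (hz : 0.3 ≤ z) (hz' : z ≤ 0.5) :
    N ^ 3 / 200 ≤ polyL k l (N * x) (N * y) (N * z) := by
  have hN3 : 0 < N ^ 3 := by positivity
  have hx0 : 0 < x := by linarith
  have hy0 : 0 < y := by linarith
  have hz0 : 0 < z := by linarith
  have hzz : 0.09 ≤ z ^ 2 := by nlinarith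
  have hxz : 0.0018 ≤ x * z ^ 2 := by nlinarith
  have hyz : 0.0018 ≤ y * z ^ 2 := by nlinarith
  have hq : 0 ≤ (x - y) ^ 2 * (3 * z - 0.75 * (1 - z)) := mul_nonneg (sq_nonneg _) (by linarith)
  have a1 : 0 < x * y * z := by positivity
  have a2 : 0 < x ^ 2 * y := by positivity
  have a3 : 0 < y ^ 2 * x := by positivity
  have a4 : 0 < x ^ 2 * z := by positivity
  have a5 : 0 < y ^ 2 * z := by positivity
  have a6 : 0 < x ^ 3 := by positivity
  have a7 : 0 < y ^ 3 := by positivity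
  have a8 : 0 < z ^ 3 := by positivity
  have g01 : 1 / 200 ≤ 3 * z * (x - y) ^ 2 + 3 * z ^ 2 * (x + y) - z ^ 3 - x ^ 3 - y ^ 3 := by
    have hy' : y = 1 - z - x := by linarith
    have e : 3 * z * (x - y) ^ 2 + 3 * z ^ 2 * (x + y) - z ^ 3 - x ^ 3 - y ^ 3 =
      (x - y) ^ 2 * (3 * z - 0.75 * (1 - z)) + (3 * z ^ 2 * (1 - z) - z ^ 3 - (1 - z) ^ 3 / 4) := by rw [hy']; ring
    have : 1 / 200 ≤ 3 * z ^ 2 * (1 - z) - z ^ 3 - (1 - z) ^ 3 / 4 := by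
      nlinarith [mul_nonneg (sub_nonneg.mpr hz) (sub_nonneg.mpr hz'), mul_nonneg (mul_nonneg (sub_nonneg.mpr hz) (sub_nonneg.mpr hz')) hz0.le]
    linarith
  have g22 : 1 / 200 ≤ 3 * z * (x - y) ^ 2 + 3 * x * y * (x + y) := by
    have hy' : y = 1 - z - x := by linarith
    have e : 3 * z * (x - y) ^ 2 + 3 * x * y * (x + y) = (x - y) ^ 2 * (3 * z - 0.75 * (1 - z)) + 0.75 * (1 - z) ^ 3 := by rw [hy']; ring
    have : (0.5 : ℝ) ^ 3 ≤ (1 - z) ^ 3 := pow_le_pow_left₀ (by norm_num) (by linarith) 3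
    linarith
  have key : ∀ p : ℝ, 1 / 200 ≤ p → N ^ 3 / 200 ≤ N ^ 3 * p := by
    intro p hp
    have := mul_le_mul_of_nonneg_left hp hN3.le
    linarith
  fin_cases k <;> fin_cases l
  · show _ ≤ polyL 0 0 _ _ _
    rw [polyL_00]
    convert key (z ^ 3 + 6 * x * y * z + 3 * y * z ^ 2) (by linarith) using 1; ring
  · show _ ≤ polyL 0 1 _ _ _
    rw [polyL_01]
    convert key _ g01 using 1; ring
  · show _ ≤ polyL 0 2 _ _ _
    rw [polyL_02]
    convert key (3 * x * z ^ 2 + 6 * x * y * z + 3 * y ^ 2 * z + 3 * x ^ 2 * y + y ^ 3) (by linarith) using 1; ring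
  · show _ ≤ polyL 1 0 _ _ _
    rw [polyL_10]
    convert key _ g01 using 1; ring
  · show _ ≤ polyL 1 1 _ _ _
    rw [polyL_11]
    convert key (z ^ 3 + 6 * x * y * z + 3 * x * z ^ 2) (by linarith) using 1; ring
  · show _ ≤ polyL 1 2 _ _ _
    rw [polyL_12]
    convert key (3 * y * z ^ 2 + 6 * x * y * z + 3 * x ^ 2 * z + 3 * y ^ 2 * x + x ^ 3) (by linarith) using 1; ring
  · show _ ≤ polyL 2 0 _ _ _
    rw [polyL_20]
    convert key (3 * x * z ^ 2 + 6 * x * y * z + 3 * y ^ 2 * z + 3 * x ^ 2 * y + y ^ 3) (by linarith) using 1; ring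
  · show _ ≤ polyL 2 1 _ _ _
    rw [polyL_21]
    convert key (3 * y * z ^ 2 + 6 * x * y * z + 3 * x ^ 2 * z + 3 * y ^ 2 * x + x ^ 3) (by linarith) using 1; ring
  · show _ ≤ polyL 2 2 _ _ _
    rw [polyL_22]
    convert key _ g22 using 1; ring

section core
variable {V : Type*} [Fintype V]

lemma flip_gain (A : V → V → Bool) (hA : Gr A) (c : V → Fin 3) (u v : V) (huv : u ≠ v) (hw : A u v ≠ pat (c u) (c v)) :
    20 * (polyL (c u) (c v) (sz c 0) (sz c 1) (sz c 2)
      - 2 * (3 * (NN V ^ 2 * ∑ b, wr A c u b) + 3 * (NN V ^ 2 * ∑ b, wr A c v b) + 3 * (NN V * ∑ a, ∑ b, wr A c a b)))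
      ≤ Tinj (flipA A u v) - Tinj A := by
  rw [flip_exact A hA u v huv]
  have h := Finset.sum_le_sum (s := Finset.univ) (fun w (_ : w ∈ Finset.univ) => flip_point A hA c u v huv hw w)
  have m : ∀ u, ∑ w : Fin 3 → V, ∑ i, wr A c u (w i) = 3 * (NN V ^ 2 * ∑ b, wr A c u b) := by
    intro u
    rw [Finset.sum_comm, Finset.sum_congr rfl (fun i _ => marg1 (m := 2) i (wr A c u))]
    simp
  have p : ∑ w : Fin 3 → V, ∑ i, ∑ j, (if i < j then wr A c (w i) (w j) else 0) = 3 * (NN V * ∑ a, ∑ b, wr A c a b) := by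
    rw [pairs_sum (m := 1) (wr A c)]
    have : (∑ i : Fin (1 + 2), ∑ j : Fin (1 + 2), if i < j then 1 else 0 : ℕ) = 3 := by decide
    rw [this]
    push_cast
    ring
  rw [Finset.sum_sub_distrib, sum_flipT, ← Finset.mul_sum, Finset.sum_add_distrib, Finset.sum_add_distrib, m, m, p] at h
  linarith

theorem core (A : V → V → Bool) (hA : Gr A) (hN : (10 : ℝ) ^ 20 ≤ NN V)
    (hT : (LAM - (3 / 10 ^ 19) ^ 2) * NN V ^ 5 ≤ Tinj A)
    (H : ∀ A', Gr A' → Tinj A' ≤ Tinj A + (3 / 10 ^ 19) * NN V ^ 3 * dd A A') :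
    ∃ c : V → Fin 3, ∀ u v, u ≠ v → A u v = pat (c u) (c v) := by
  set N := NN V with hNd
  have hN0 : 0 < N := by linarith [show (0 : ℝ) < 10 ^ 20 by norm_num]
  have hb := badv_small A hA hN hT H
  have hlo := LAM_lo
  have p2 : 0 < N ^ 2 := by positivity
  have p3 : 0 < N ^ 3 := by positivity
  have p4 : 0 < N ^ 4 := by positivity
  have p5 : 0 < N ^ 5 := by positivity
  have n2 : 10 ^ 20 * N ≤ N ^ 2 := by nlinarith
  have n3 : 10 ^ 20 * N ^ 2 ≤ N ^ 3 := by nlinarith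
  have n5 : 10 ^ 20 * N ^ 4 ≤ N ^ 5 := by nlinarith
  have hT5 : 0.503 * N ^ 5 ≤ T5 A := by
    refine le_trans ?_ (hT.trans (Tinj_le_T5 A))
    exact mul_le_mul_of_nonneg_right (by norm_num at hlo ⊢; linarith) p5.le
  obtain ⟨c, hc, hmin⟩ := exists_min A hA _ (exists_colouring A hA hN0 (41 / 10 ^ 16) (by norm_num) (le_trans (by nlinarith) hT5) hb)
  rw [← hNd] at hc
  have hwr := sum_wr_le A c
  have hW : ∑ a, ∑ b, wr A c a b ≤ N ^ 2 / 10 ^ 12 := by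
    refine hwr.trans ?_
    rw [← hNd]
    norm_num at hc n2 ⊢
    linarith
  have hW0 : 0 ≤ ∑ a, ∑ b, wr A c a b := Finset.sum_nonneg fun a _ => Finset.sum_nonneg fun b _ => wr_nonneg A c a b
  have hdd := (dd_le_wr A c).trans hW
  have hch := T5_change A (fun a b => pat (c a) (c b))
  rw [T5_pat, ← hNd] at hch
  have hE : 10 * N ^ 3 * dd A (fun a b => pat (c a) (c b)) ≤ N ^ 5 / 10 ^ 11 := by
    calc _ ≤ 10 * N ^ 3 * (N ^ 2 / 10 ^ 12) := by gcongr
      _ = _ := by ring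
  obtain ⟨x, y, z, hX, hY, hZ, h1, hx, hy, hz, hz'⟩ := polyP_sizes hN0 (sz_nonneg c 0) (sz_nonneg c 1) (sz_nonneg c 2) (sz_sum c)
    (by norm_num at hE hT5 ⊢; linarith)
  have hrow : ∀ v, wdk A c v (c v) ≤ N / 10000 := by
    intro v
    by_contra hcon
    push Not at hcon
    have hwd := wdeg_bound A c v (N / 10000) (fun k => hcon.le.trans (hmin v k))
    rw [hX, hY, hZ, ← hNd] at hwd
    have hbv := hb v
    have hE' : 10 * N ^ 3 * (∑ a, ∑ b, wr A c a b) ≤ N ^ 5 / 10 ^ 11 := by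
      calc _ ≤ 10 * N ^ 3 * (N ^ 2 / 10 ^ 12) := by gcongr
        _ = _ := by ring
    have hprod : (1 / 50) * (1 / 50) * (1 / 50) * 0.3 ≤ x * y * y * z := by gcongr
    have e : N * x * (N * y) * (N * y) * (N * z) * (N / 10000) = (x * y * y * z) * (N ^ 5 / 10000) := by ring
    rw [e] at hwd
    have := mul_le_mul_of_nonneg_right hprod (show 0 ≤ N ^ 5 / 10000 by positivity)
    norm_num at this hwd hbv hE'
    linarith
  refine ⟨c, ?_⟩
  by_contra hcon
  push Not at hcon
  obtain ⟨u, v, huv, hw⟩ := hcon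
  have hg := flip_gain A hA c u v huv hw
  have hH := H (flipA A u v) (flip_Gr hA huv)
  have hd := flip_dd A u v
  have hp := polyL_pos (c u) (c v) hN0 h1 hx hy hz hz'
  rw [hX, hY, hZ, ← hNd] at hg
  have hr : ∀ v, N ^ 2 * ∑ b, wr A c v b ≤ N ^ 3 / 9999 := by
    intro v
    have h := row_wr_le A c v
    have h' := hrow v
    have : N ^ 2 * ∑ b, wr A c v b ≤ N ^ 2 * (N / 10000 + 1) := by gcongr; linarith
    nlinarith
  have hr1 := hr u
  have hr2 := hr v
  have hr3 : N * ∑ a, ∑ b, wr A c a b ≤ N ^ 3 / 10 ^ 12 := by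
    calc _ ≤ N * (N ^ 2 / 10 ^ 12) := by gcongr
      _ = _ := by ring
  have hd' : (3 / 10 ^ 19) * N ^ 3 * dd A (flipA A u v) ≤ (3 / 10 ^ 19) * N ^ 3 * 2 := by gcongr
  norm_num at hd' hr3 hH
  linarith

end core

/-! ### Stability -/

section stab
variable {V : Type*} [Fintype V]

lemma dd_self (A : V → V → Bool) : dd A A = 0 := by
  unfold dd
  refine Finset.sum_eq_zero fun a _ => Finset.sum_eq_zero fun b _ => ?_
  exact ind_false fun h => h rfl

lemma dd_tri (A B C : V → V → Bool) : dd A C ≤ dd A B + dd B C := by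
  unfold dd
  simp only [← Finset.sum_add_distrib]
  refine Finset.sum_le_sum fun a _ => Finset.sum_le_sum fun b _ => ?_
  by_cases h1 : A a b = B a b
  · rw [h1]
    have := ind_nonneg (B a b ≠ B a b)
    linarith
  · rw [ind_true (P := A a b ≠ B a b) h1]
    have := ind_le_one (A a b ≠ C a b)
    have := ind_nonneg (B a b ≠ C a b)
    linarith

theorem stab (A : V → V → Bool) (hA : Gr A) (hN : (10 : ℝ) ^ 20 ≤ NN V)
    (hT : (LAM - (3 / 10 ^ 19) ^ 2) * NN V ^ 5 ≤ Tinj A) :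
    ∃ B : V → V → Bool, Gr B ∧ (∃ c : V → Fin 3, ∀ u v, u ≠ v → B u v = pat (c u) (c v)) ∧
      (3 / 10 ^ 19) * NN V ^ 3 * dd A B ≤ Tinj B - Tinj A := by
  obtain ⟨B, hB, hmax⟩ := Finset.exists_max_image (Finset.univ.filter fun B : V → V → Bool => Gr B)
    (fun B => Tinj B - (3 / 10 ^ 19) * NN V ^ 3 * dd A B) ⟨A, by simp [hA]⟩
  have hB' : Gr B := (Finset.mem_filter.mp hB).2
  have hmax' : ∀ B', Gr B' → Tinj B' - (3 / 10 ^ 19) * NN V ^ 3 * dd A B' ≤ Tinj B - (3 / 10 ^ 19) * NN V ^ 3 * dd A B :=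
    fun B' h => hmax B' (Finset.mem_filter.mpr ⟨Finset.mem_univ _, h⟩)
  have h1 := hmax' A hA
  rw [dd_self] at h1
  have hk : 0 ≤ (3 / 10 ^ 19) * NN V ^ 3 := by
    have := NN_nonneg (V := V)
    positivity
  have hd : 0 ≤ dd A B := Finset.sum_nonneg fun _ _ => Finset.sum_nonneg fun _ _ => ind_nonneg _
  have hd' := mul_nonneg hk hd
  refine ⟨B, hB', ?_, by linarith⟩
  apply core B hB' hN (hT.trans (by linarith))
  intro A' hA'
  have h2 := hmax' A' hA'
  have h3 := mul_le_mul_of_nonneg_left (dd_tri A B A') hk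
  linarith

lemma Tinj_off {A B : V → V → Bool} (h : ∀ u v, u ≠ v → A u v = B u v) : Tinj A = Tinj B := by
  unfold Tinj
  refine Finset.sum_congr rfl fun y _ => ?_
  by_cases hy : Function.Injective y
  · have : e5 (onT A y) = e5 (onT B y) := by
      unfold e5
      refine Finset.sum_congr rfl fun i _ => Finset.sum_congr rfl fun j _ => ?_
      split_ifs with hij
      · unfold onT
        rw [h _ _ fun e => hij.ne (hy e)]
      · rfl
    unfold Tri
    rw [this]
  · rw [ind_false hy, zero_mul, zero_mul]

end stab

/-! ### Translation to graphs -/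

section graphs
variable {n : ℕ}

noncomputable def adjB (G : SimpleGraph (Fin n)) : Fin n → Fin n → Bool := fun u v => decide (G.Adj u v)

lemma adjB_Gr (G : SimpleGraph (Fin n)) : Gr (adjB G) := by
  refine ⟨fun u v => ?_, fun v => ?_⟩
  · unfold adjB; simp [G.adj_comm]
  · unfold adjB; simp

def toG (A : Fin n → Fin n → Bool) (hA : Gr A) : SimpleGraph (Fin n) where
  Adj u v := A u v = true
  symm := ⟨fun u v h => by rw [hA.1]; exact h⟩
  loopless := ⟨fun v h => by rw [hA.2] at h; exact absurd h (by decide)⟩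

lemma adjB_toG (A : Fin n → Fin n → Bool) (hA : Gr A) : adjB (toG A hA) = A := by
  funext u v
  unfold adjB
  by_cases h : A u v = true
  · rw [h]; exact decide_eq_true h
  · rw [Bool.not_eq_true] at h
    rw [h]; exact decide_eq_false (by show ¬ (A u v = true); rw [h]; decide)

lemma NN_fin : NN (Fin n) = n := by simp [NN]

lemma bn_decide (P : Prop) : bn (decide P) = if P then 1 else 0 := by
  by_cases h : P <;> simp [h, bn]

lemma two_edgeCount (G : SimpleGraph (Fin n)) (S : Finset (Fin n)) :
    2 * edgeCount G S = ∑ a ∈ S, ∑ b ∈ S, bn (adjB G a b) := by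
  have h1 : edgeCount G S = ∑ a ∈ S, ∑ b ∈ S, if a < b then bn (adjB G a b) else 0 := by
    unfold edgeCount
    rw [Finset.card_filter, ← Finset.univ_product_univ, Finset.sum_product]
    rw [← Finset.sum_subset (Finset.subset_univ S)]
    · refine Finset.sum_congr rfl fun a ha => ?_
      rw [← Finset.sum_subset (Finset.subset_univ S)]
      · refine Finset.sum_congr rfl fun b hb => ?_
        unfold adjB
        rw [bn_decide]
        by_cases h : a < b <;> simp [ha, hb, h]
      · intro b _ hb
        simp [hb]
    · intro a _ ha
      simp [ha]
  have h2 : edgeCount G S = ∑ a ∈ S, ∑ b ∈ S, if b < a then bn (adjB G a b) else 0 := by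
    rw [h1, Finset.sum_comm]
    refine Finset.sum_congr rfl fun a _ => Finset.sum_congr rfl fun b _ => ?_
    rw [(adjB_Gr G).1]
  rw [two_mul]
  nth_rewrite 1 [h1]
  rw [h2, ← Finset.sum_add_distrib]
  refine Finset.sum_congr rfl fun a _ => ?_
  rw [← Finset.sum_add_distrib]
  refine Finset.sum_congr rfl fun b _ => ?_
  rcases lt_trichotomy a b with h | h | h
  · simp [h, h.not_gt]
  · subst h; simp [(adjB_Gr G).2, bn]
  · simp [h, h.not_gt]

lemma edgeCount_e5 (G : SimpleGraph (Fin n)) (y : Fin 5 → Fin n) (hy : Function.Injective y) :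
    edgeCount G (Finset.univ.image y) = e5 (onT (adjB G) y) := by
  have h1 := two_edgeCount G (Finset.univ.image y)
  have h2 := e5_sum (onT (adjB G) y) (fun i j => (adjB_Gr G).1 _ _) (fun i => (adjB_Gr G).2 _)
  rw [Finset.sum_image (fun a _ b _ h => hy h)] at h1
  have : ∑ i : Fin 5, ∑ b ∈ Finset.univ.image y, bn (adjB G (y i) b) = ∑ i, ∑ j, bn (onT (adjB G) y i j) := by
    refine Finset.sum_congr rfl fun i _ => ?_
    rw [Finset.sum_image (fun a _ b _ h => hy h)]
    rfl
  rw [this, ← h2] at h1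
  omega

lemma card_orderings (S : Finset (Fin n)) (hS : S.card = 5) :
    (Finset.univ.filter fun y : Fin 5 → Fin n => Function.Injective y ∧ Finset.univ.image y = S).card = 120 := by
  have hc : Fintype.card (Fin 5 ≃ S) = 120 := by
    rw [Fintype.card_equiv (S.equivFinOfCardEq hS).symm]
    simp [Nat.factorial]
  rw [← hc, ← Finset.card_univ]
  symm
  refine Finset.card_bij (fun e _ => fun i => (e i : Fin n)) ?_ ?_ ?_
  · intro e _
    rw [Finset.mem_filter]
    refine ⟨Finset.mem_univ _, fun i j h => e.injective (Subtype.ext h), ?_⟩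
    ext a
    rw [Finset.mem_image]
    constructor
    · rintro ⟨i, -, rfl⟩; exact (e i).2
    · intro ha; exact ⟨e.symm ⟨a, ha⟩, Finset.mem_univ _, by simp⟩
  · intro e _ e' _ h
    ext i
    exact congrArg Fin.val (congrFun h i)
  · intro y hy
    obtain ⟨-, hi, hS'⟩ := Finset.mem_filter.mp hy
    have hm : ∀ i, y i ∈ S := fun i => hS' ▸ Finset.mem_image_of_mem y (Finset.mem_univ i)
    refine ⟨Equiv.ofBijective (fun i => (⟨y i, hm i⟩ : S)) ⟨fun i j h => hi (congrArg Subtype.val h), ?_⟩, Finset.mem_univ _, rfl⟩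
    rintro ⟨a, ha⟩
    rw [← hS'] at ha
    obtain ⟨i, -, hi⟩ := Finset.mem_image.mp ha
    exact ⟨i, Subtype.ext hi⟩

lemma Tinj_num (G : SimpleGraph (Fin n)) : Tinj (adjB G) = 120 * (numKL 5 3 G : ℝ) := by
  have h1 : Tinj (adjB G) = ((Finset.univ.filter fun y : Fin 5 → Fin n => Function.Injective y ∧ Tri (onT (adjB G) y)).card : ℝ) := by
    unfold Tinj
    rw [Finset.card_filter]
    push_cast
    refine Finset.sum_congr rfl fun y _ => ?_
    unfold ind
    by_cases hy : Function.Injective y <;> by_cases ht : Tri (onT (adjB G) y) <;> simp [hy, ht]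
  have h2 : (Finset.univ.filter fun y : Fin 5 → Fin n => Function.Injective y ∧ Tri (onT (adjB G) y)).card = 120 * numKL 5 3 G := by
    unfold numKL
    rw [Finset.card_eq_sum_card_fiberwise (f := fun y => Finset.univ.image y)
      (t := (Finset.powersetCard 5 Finset.univ).filter (fun S => edgeCount G S = 3))]
    · rw [Finset.sum_congr rfl (g := fun _ => 120)]
      · simp [mul_comm]
      · intro S hS
        obtain ⟨hS1, hS2⟩ := Finset.mem_filter.mp hS
        rw [← card_orderings S (Finset.mem_powersetCard.mp hS1).2, Finset.filter_filter]
        congr 1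
        refine Finset.filter_congr fun y _ => ?_
        constructor
        · rintro ⟨⟨h1, h2⟩, h3⟩; exact ⟨h1, h3⟩
        · rintro ⟨h1, h3⟩
          refine ⟨⟨h1, ?_⟩, h3⟩
          unfold Tri
          rw [← edgeCount_e5 G y h1, h3, hS2]
    · intro y hy
      obtain ⟨-, hi, ht⟩ := Finset.mem_filter.mp (Finset.mem_coe.mp hy)
      simp only [Finset.coe_filter, Set.mem_setOf_eq, Finset.mem_powersetCard]
      refine ⟨⟨Finset.subset_univ _, ?_⟩, ?_⟩
      · rw [Finset.card_image_of_injective _ hi]; simp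
      · rw [edgeCount_e5 G y hi]; exact ht
  rw [h1, h2]
  push_cast
  ring

lemma choose5 : 120 * (n.choose 5 : ℝ) = (n.descFactorial 5 : ℝ) := by
  rw [Nat.descFactorial_eq_factorial_mul_choose]
  push_cast
  norm_num [Nat.factorial]

lemma lam_eq (G : SimpleGraph (Fin n)) : lamKL 5 3 G = Tinj (adjB G) / (n.descFactorial 5 : ℝ) := by
  unfold lamKL
  rw [Tinj_num, ← choose5, mul_div_mul_left _ _ (by norm_num : (120 : ℝ) ≠ 0)]

lemma lam_le_max (G : SimpleGraph (Fin n)) : lamKL 5 3 G ≤ lamKLmax 5 3 n :=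
  le_ciSup (f := fun G : SimpleGraph (Fin n) => lamKL 5 3 G) (Set.finite_range _).bddAbove G

lemma lamMax_le : lamKLmax 5 3 n ≤ LAM * (n : ℝ) ^ 5 / (n.descFactorial 5 : ℝ) := by
  unfold lamKLmax
  apply ciSup_le
  intro G
  rw [lam_eq]
  have := (Tinj_le_T5 (adjB G)).trans (T5_le (adjB G) (adjB_Gr G).1)
  rw [NN_fin] at this
  gcongr

end graphs

/-! ### The lower bound construction -/

lemma sz_card {n : ℕ} (c : Fin n → Fin 3) (k : Fin 3) : sz c k = ((Finset.univ.filter fun v => c v = k).card : ℝ) := by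
  unfold sz ind
  rw [Finset.card_filter]
  push_cast
  refine Finset.sum_congr rfl fun v _ => ?_
  split_ifs <;> rfl

lemma card_lt {n m : ℕ} (h : m ≤ n) : (Finset.univ.filter fun v : Fin n => v.val < m).card = m := by
  rw [Fin.card_filter_val_lt]
  omega

lemma lam_ge {n m : ℕ} (hn : 1 ≤ n) (h : 2 * m ≤ n) :
    polyP ((m : ℝ) / n) ((m : ℝ) / n) (1 - 2 * ((m : ℝ) / n)) - 10 / n ≤ lamKLmax 5 3 n := by
  set c : Fin n → Fin 3 := fun v => if v.val < m then 0 else if v.val < 2 * m then 1 else 2 with hc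
  set A : Fin n → Fin n → Bool := fun u v => if u = v then false else pat (c u) (c v) with hAd
  have hA : Gr A := by
    refine ⟨fun u v => ?_, fun v => by simp [hAd]⟩
    simp only [hAd, eq_comm (a := u), pat_symm (c u)]
  have s0 : sz c 0 = m := by
    rw [sz_card, ← card_lt (n := n) (m := m) (by omega)]
    congr 2
    ext v
    simp only [hc, Finset.mem_filter, Finset.mem_univ, true_and]
    split_ifs with h1 h2 <;> simp_all
  have s01 : sz c 0 + sz c 1 = 2 * m := by
    have e : sz c 0 + sz c 1 = ((Finset.univ.filter fun v : Fin n => v.val < 2 * m).card : ℝ) := by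
      unfold sz
      rw [← Finset.sum_add_distrib, Finset.card_filter]
      push_cast
      refine Finset.sum_congr rfl fun v _ => ?_
      unfold ind
      simp only [hc]
      by_cases h1 : v.val < m
      · have : v.val < 2 * m := by omega
        simp [h1, this]
      · by_cases h2 : v.val < 2 * m <;> simp [h1, h2]
    rw [e, card_lt h]
    push_cast
    ring
  have hsum := sz_sum c
  rw [NN_fin] at hsum
  have s1 : sz c 1 = m := by linarith
  have s2 : sz c 2 = n - 2 * m := by linarith
  have hn0 : (0 : ℝ) < n := by exact_mod_cast hn
  have hT : T5 (fun a b => pat (c a) (c b)) = (n : ℝ) ^ 5 * polyP ((m : ℝ) / n) ((m : ℝ) / n) (1 - 2 * ((m : ℝ) / n)) := by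
    rw [T5_pat, s0, s1, s2, ← polyP_scale]
    congr 1 <;> field_simp
  have h1 := T5_Tinj (fun a b => pat (c a) (c b))
  have h2 : Tinj A = Tinj (fun a b => pat (c a) (c b)) := by
    apply Tinj_off
    intro u v huv
    simp [hAd, huv]
  rw [← h2, hT, NN_fin] at h1
  refine le_trans ?_ (lam_le_max (toG A hA))
  rw [lam_eq, adjB_toG]
  have hT0 : 0 ≤ Tinj A := by
    unfold Tinj
    exact Finset.sum_nonneg fun _ _ => mul_nonneg (ind_nonneg _) (ind_nonneg _)
  by_cases hd : n.descFactorial 5 = 0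
  · -- too few vertices
    have hn5 : n < 5 := Nat.descFactorial_eq_zero_iff_lt.mp hd
    have hn5' : (n : ℝ) ≤ 5 := by exact_mod_cast hn5.le
    have hm : (m : ℝ) / n ≤ 1 / 2 := by
      rw [div_le_iff₀ hn0]
      have : (2 * m : ℝ) ≤ n := by exact_mod_cast h
      linarith
    have hm0 : 0 ≤ (m : ℝ) / n := by positivity
    have hle := T5_le (fun a b => pat (c a) (c b)) (fun u v => pat_symm _ _)
    rw [hT, NN_fin, mul_comm] at hle
    have hle' := le_of_mul_le_mul_right hle (by positivity)
    have : (2 : ℝ) ≤ 10 / n := by rw [le_div_iff₀ hn0]; linarith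
    have := LAM_hi
    rw [hd]
    simp only [Nat.cast_zero, div_zero]
    norm_num at this
    linarith
  · have hd0 : (0 : ℝ) < n.descFactorial 5 := by exact_mod_cast Nat.pos_of_ne_zero hd
    have hle : (n.descFactorial 5 : ℝ) ≤ (n : ℝ) ^ 5 := by exact_mod_cast Nat.descFactorial_le_pow n 5
    calc polyP ((m : ℝ) / n) ((m : ℝ) / n) (1 - 2 * ((m : ℝ) / n)) - 10 / n
        ≤ Tinj A / (n : ℝ) ^ 5 := by
          rw [le_div_iff₀ (by positivity)]
          have : 10 / (n : ℝ) * n ^ 5 = 10 * n ^ 4 := by field_simp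
          linarith
      _ ≤ _ := div_le_div_of_nonneg_left hT0 hd0 hle

lemma polyP_opt : polyP ((9 - √17) / 16) ((9 - √17) / 16) (1 - 2 * ((9 - √17) / 16)) = LAM := by
  have h : √17 ^ 2 = 17 := Real.sq_sqrt (by norm_num)
  unfold polyP LAM
  generalize √17 = s at h
  have h3 : s ^ 3 = 17 * s := by rw [pow_succ, h]
  have h4 : s ^ 4 = 289 := by rw [show s ^ 4 = (s ^ 2) ^ 2 by ring, h]; norm_num
  ring_nf
  rw [h, h3, h4]
  ring

lemma up_tendsto : Filter.Tendsto (fun n : ℕ => LAM * (n : ℝ) ^ 5 / (n.descFactorial 5 : ℝ)) Filter.atTop (nhds LAM) := by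
  have h := (Asymptotics.isEquivalent_iff_tendsto_one ?_).mp (isEquivalent_descFactorial 5).symm
  · have := h.const_mul LAM
    rw [mul_one] at this
    refine this.congr fun n => ?_
    simp [mul_div_assoc]
  · filter_upwards [Filter.eventually_ge_atTop 5] with n hn
    intro h0
    exact absurd (Nat.descFactorial_eq_zero_iff_lt.mp (by exact_mod_cast h0)) (by omega)

theorem limit_LAM : Filter.Tendsto (fun n => lamKLmax 5 3 n) Filter.atTop (nhds LAM) := by
  have hup : Filter.Tendsto (fun n : ℕ => LAM * (n : ℝ) ^ 5 / (n.descFactorial 5 : ℝ)) Filter.atTop (nhds LAM) := by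
    exact up_tendsto
  have hlo : Filter.Tendsto (fun n : ℕ => polyP (((⌊(9 - √17) / 16 * (n : ℝ)⌋₊ : ℕ) : ℝ) / n) (((⌊(9 - √17) / 16 * (n : ℝ)⌋₊ : ℕ) : ℝ) / n)
      (1 - 2 * (((⌊(9 - √17) / 16 * (n : ℝ)⌋₊ : ℕ) : ℝ) / n)) - 10 / n) Filter.atTop (nhds LAM) := by
    have ha : 0 ≤ (9 - √17) / 16 := by have := sqrt17_hi; norm_num at this; linarith
    have h1 := (tendsto_nat_floor_mul_div_atTop ha).comp (tendsto_natCast_atTop_atTop (R := ℝ))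
    have h2 : Filter.Tendsto (fun n : ℕ => (10 : ℝ) / n) Filter.atTop (nhds 0) := tendsto_const_div_atTop_nhds_zero_nat 10
    have hcont : Continuous fun t : ℝ => polyP t t (1 - 2 * t) := by unfold polyP; fun_prop
    have h3 := ((hcont.tendsto ((9 - √17) / 16)).comp h1).sub h2
    rw [polyP_opt, sub_zero] at h3
    exact h3
  refine tendsto_of_tendsto_of_tendsto_of_le_of_le' hlo hup ?_ ?_
  · filter_upwards [Filter.eventually_ge_atTop 1] with n hn
    apply lam_ge hn
    have ha : 0 ≤ (9 - √17) / 16 := by have := sqrt17_hi; norm_num at this; linarith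
    have h1 : ((⌊(9 - √17) / 16 * (n : ℝ)⌋₊ : ℕ) : ℝ) ≤ (9 - √17) / 16 * (n : ℝ) := Nat.floor_le (by positivity)
    have h2 : (9 - √17) / 16 * (n : ℝ) ≤ 1 / 2 * n := by
      have := sqrt17_lo
      norm_num at this
      exact mul_le_mul_of_nonneg_right (by linarith) (by positivity)
    have : (2 * (⌊(9 - √17) / 16 * (n : ℝ)⌋₊ : ℕ) : ℝ) ≤ n := by linarith
    exact_mod_cast this
  · filter_upwards with n
    exact lamMax_le

/-! ### Edit distance -/

lemma distToFam_le {n : ℕ} (G H : SimpleGraph (Fin n)) (hH : isBipartitePlusClique H) :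
    (distToFam G isBipartitePlusClique : ℝ) ≤ dd (adjB G) (adjB H) := by
  have h1 : distToFam G isBipartitePlusClique ≤ editDist G H :=
    ciInf_le (f := fun H : {H : SimpleGraph (Fin n) // isBipartitePlusClique H} => editDist G H.1) (OrderBot.bddBelow _) ⟨H, hH⟩
  have h2 : editDist G H ≤ (Finset.univ.filter (fun p : Fin n × Fin n =>
      p.1 < p.2 ∧ ¬ (G.Adj p.1 p.2 ↔ H.Adj ((1 : Equiv.Perm (Fin n)) p.1) ((1 : Equiv.Perm (Fin n)) p.2)))).card :=
    ciInf_le (f := fun σ : Equiv.Perm (Fin n) => (Finset.univ.filter (fun p : Fin n × Fin n =>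
      p.1 < p.2 ∧ ¬ (G.Adj p.1 p.2 ↔ H.Adj (σ p.1) (σ p.2)))).card) (OrderBot.bddBelow _) 1
  have h3 : ((Finset.univ.filter (fun p : Fin n × Fin n =>
      p.1 < p.2 ∧ ¬ (G.Adj p.1 p.2 ↔ H.Adj ((1 : Equiv.Perm (Fin n)) p.1) ((1 : Equiv.Perm (Fin n)) p.2)))).card : ℝ) ≤ dd (adjB G) (adjB H) := by
    rw [Finset.card_filter, ← Finset.univ_product_univ, Finset.sum_product]
    rw [Nat.cast_sum]
    unfold dd
    refine Finset.sum_le_sum fun a _ => ?_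
    rw [Nat.cast_sum]
    refine Finset.sum_le_sum fun b _ => ?_
    by_cases h : a < b ∧ ¬ (G.Adj a b ↔ H.Adj a b)
    · rw [ind_true]
      · split_ifs <;> norm_num
      · intro h'
        apply h.2
        simpa [adjB] using h'
    · rw [if_neg (by exact h), Nat.cast_zero]
      exact ind_nonneg _
  exact (by exact_mod_cast h1.trans h2 : (distToFam G isBipartitePlusClique : ℝ) ≤ _).trans h3

lemma dd_le_sq {n : ℕ} (A B : Fin n → Fin n → Bool) : dd A B ≤ (n : ℝ) ^ 2 := by
  unfold dd
  calc _ ≤ ∑ _a : Fin n, ∑ _b : Fin n, (1 : ℝ) := Finset.sum_le_sum fun a _ => Finset.sum_le_sum fun b _ => ind_le_one _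
    _ = _ := by simp; ring

lemma toG_fam {n : ℕ} (B : Fin n → Fin n → Bool) (hB : Gr B) (c : Fin n → Fin 3) (hc : ∀ u v, u ≠ v → B u v = pat (c u) (c v)) :
    isBipartitePlusClique (toG B hB) := by
  have key : ∀ i j : Fin 3, pat i j = true ↔ ((i = 0 ∧ j = 1) ∨ (i = 1 ∧ j = 0) ∨ (i = 2 ∧ j = 2)) := by decide
  refine ⟨c, fun u v => ?_⟩
  show B u v = true ↔ _
  by_cases huv : u = v
  · subst huv
    rw [hB.2]
    constructor
    · intro h; exact absurd h (by decide)
    · rintro (⟨h1, h2⟩ | ⟨h1, h2⟩ | ⟨h1, -⟩)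
      · rw [h1] at h2; exact absurd h2 (by decide)
      · rw [h1] at h2; exact absurd h2 (by decide)
      · exact absurd rfl h1
  · rw [hc u v huv, key]
    simp [huv]

theorem stability : ∃ C : ℝ, 0 < C ∧ ∀ n : ℕ, (C ≤ n) → ∀ G : SimpleGraph (Fin n),
      (distToFam G isBipartitePlusClique : ℝ) ≤ C * (lamKLmax 5 3 n - lamKL 5 3 G) * n ^ 2 := by
  obtain ⟨n₀, hn₀⟩ := Filter.eventually_atTop.mp
    (limit_LAM.eventually (lt_mem_nhds (show LAM - (3 / 10 ^ 19) ^ 2 / 4 < LAM by norm_num)))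
  have hup : Filter.Tendsto (fun n : ℕ => LAM * (n : ℝ) ^ 5 / (n.descFactorial 5 : ℝ)) Filter.atTop (nhds LAM) := by
    exact up_tendsto
  obtain ⟨n₁, hn₁⟩ := Filter.eventually_atTop.mp
    (hup.eventually (gt_mem_nhds (show LAM < LAM + (3 / 10 ^ 19) ^ 2 / 4 by norm_num)))
  refine ⟨10 ^ 60 + n₀ + n₁, by positivity, fun n hn G => ?_⟩
  have c1 : (0 : ℝ) ≤ n₀ := by positivity
  have c2 : (0 : ℝ) ≤ n₁ := by positivity
  have hn60 : (10 : ℝ) ^ 60 ≤ n := by linarith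
  have hnn0 : n₀ ≤ n := by
    have : (n₀ : ℝ) ≤ n := by linarith [show (0 : ℝ) ≤ 10 ^ 60 by norm_num]
    exact_mod_cast this
  have hnn1 : n₁ ≤ n := by
    have : (n₁ : ℝ) ≤ n := by linarith [show (0 : ℝ) ≤ 10 ^ 60 by norm_num]
    exact_mod_cast this
  have hpos : (0 : ℝ) < n := lt_of_lt_of_le (by norm_num) hn60
  have hn5 : 5 ≤ n := by
    have : (5 : ℝ) ≤ n := le_trans (by norm_num) hn60
    exact_mod_cast this
  have hL : 0 ≤ lamKLmax 5 3 n - lamKL 5 3 G := sub_nonneg.mpr (lam_le_max G)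
  have hd0 : (0 : ℝ) < n.descFactorial 5 := by
    have : n.descFactorial 5 ≠ 0 := fun h => absurd (Nat.descFactorial_eq_zero_iff_lt.mp h) (by omega)
    exact_mod_cast Nat.pos_of_ne_zero this
  have hle : (n.descFactorial 5 : ℝ) ≤ (n : ℝ) ^ 5 := by exact_mod_cast Nat.descFactorial_le_pow n 5
  suffices h : (distToFam G isBipartitePlusClique : ℝ) ≤ 10 ^ 60 * (lamKLmax 5 3 n - lamKL 5 3 G) * n ^ 2 by
    refine h.trans ?_
    gcongr
    linarith
  by_cases hT : (LAM - (3 / 10 ^ 19) ^ 2) * (n : ℝ) ^ 5 ≤ Tinj (adjB G)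
  · obtain ⟨B, hB, ⟨c, hc⟩, hdB⟩ := stab (adjB G) (adjB_Gr G) (by rw [NN_fin]; exact le_trans (by norm_num) hn60) (by rw [NN_fin]; exact hT)
    rw [NN_fin] at hdB
    have h1 := distToFam_le G (toG B hB) (toG_fam B hB c hc)
    rw [adjB_toG] at h1
    have h2 := lam_le_max (toG B hB)
    have h3 : Tinj B - Tinj (adjB G) = (n.descFactorial 5 : ℝ) * (lamKL 5 3 (toG B hB) - lamKL 5 3 G) := by
      rw [lam_eq, lam_eq, adjB_toG]
      field_simp
    have h4 : Tinj B - Tinj (adjB G) ≤ (n : ℝ) ^ 5 * (lamKLmax 5 3 n - lamKL 5 3 G) := by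
      rw [h3]
      calc _ ≤ (n.descFactorial 5 : ℝ) * (lamKLmax 5 3 n - lamKL 5 3 G) := by gcongr
        _ ≤ _ := by gcongr
    have h5 : (3 / 10 ^ 19) * dd (adjB G) B ≤ (n : ℝ) ^ 2 * (lamKLmax 5 3 n - lamKL 5 3 G) := by
      have p3 : (0 : ℝ) < (n : ℝ) ^ 3 := by positivity
      refine le_of_mul_le_mul_left ?_ p3
      calc _ = 3 / 10 ^ 19 * (n : ℝ) ^ 3 * dd (adjB G) B := by ring
        _ ≤ _ := hdB.trans h4
        _ = _ := by ring
    have p : 0 ≤ (n : ℝ) ^ 2 * (lamKLmax 5 3 n - lamKL 5 3 G) := by positivity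
    refine h1.trans ?_
    have e : (10 : ℝ) ^ 60 * (lamKLmax 5 3 n - lamKL 5 3 G) * n ^ 2 = 10 ^ 60 * ((n : ℝ) ^ 2 * (lamKLmax 5 3 n - lamKL 5 3 G)) := by ring
    rw [e]
    norm_num at h5 ⊢
    linarith
  · push Not at hT
    have hB0 : Gr (fun _ _ : Fin n => false) := ⟨fun _ _ => rfl, fun _ => rfl⟩
    have h1 := distToFam_le G (toG _ hB0) (toG_fam _ hB0 (fun _ => 0) (fun _ _ _ => rfl))
    refine (h1.trans (dd_le_sq _ _)).trans ?_
    have h2 := hn₀ n hnn0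
    have h3 := hn₁ n hnn1
    have h4 : lamKL 5 3 G ≤ LAM * (n : ℝ) ^ 5 / (n.descFactorial 5 : ℝ) - (3 / 10 ^ 19) ^ 2 := by
      rw [lam_eq]
      have q : (1 : ℝ) ≤ (n : ℝ) ^ 5 / (n.descFactorial 5 : ℝ) := by rw [le_div_iff₀ hd0]; linarith
      calc _ ≤ (LAM - (3 / 10 ^ 19) ^ 2) * (n : ℝ) ^ 5 / (n.descFactorial 5 : ℝ) := by gcongr
        _ = LAM * (n : ℝ) ^ 5 / (n.descFactorial 5 : ℝ) - (3 / 10 ^ 19) ^ 2 * ((n : ℝ) ^ 5 / (n.descFactorial 5 : ℝ)) := by ring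
        _ ≤ _ := by
          have := mul_le_mul_of_nonneg_left q (show (0 : ℝ) ≤ (3 / 10 ^ 19) ^ 2 by norm_num)
          linarith
    have h5 : (3 / 10 ^ 19) ^ 2 / 2 ≤ lamKLmax 5 3 n - lamKL 5 3 G := by linarith
    have h6 : 1 ≤ 10 ^ 60 * (lamKLmax 5 3 n - lamKL 5 3 G) := by
      norm_num at h5 ⊢
      linarith
    have p2 : (0 : ℝ) < (n : ℝ) ^ 2 := by positivity
    have := mul_le_mul_of_nonneg_right h6 p2.le
    linarith

theorem edge_inducibility_5_3 :
    Filter.Tendsto (fun n => lamKLmax 5 3 n) Filter.atTop (nhds ((255 * Real.sqrt 17 - 535) / 1024)) ∧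
    ∃ C : ℝ, 0 < C ∧ ∀ n : ℕ, (C ≤ n) → ∀ G : SimpleGraph (Fin n),
      (distToFam G isBipartitePlusClique : ℝ) ≤ C * (lamKLmax 5 3 n - lamKL 5 3 G) * n ^ 2 := by
  exact ⟨limit_LAM, stability⟩
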